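/- Let g ≥ 1, n ≥ 1, and let d_1,…,d_n ≥ 1 be integers with Σ_{j=1}^n d_j = g+n−2. Then (2g−3+n)!/(2^{2g−1}(2g−1)! Π_{j=1}^n (2d_j−1)!!) = ⟨τ_{2g} Π_{j=1}^n τ_{d_j}⟩_g − Σ_{j=1}^n ⟨τ_{d_j+2g−1} Π_{i≠j} τ_{d_i}⟩_g + (1/2) Σ_{j=0}^{2g−2} (−1)^j ⟨τ_{2g−2−j} τ_j Π_{i=1}^n τ_{d_i}⟩_{g−1} + (1/2) Σ_{g'=0}^{g} Σ_{{1,…,n}=I⊔J} Σ_{j=0}^{2g−2} (−1)^j ⟨τ_j Π_{i∈I} τ_{d_i}⟩_{g'} ⟨τ_{2g−2−j} Π_{i∈J} τ_{d_i}⟩_{g−g'}, where the sum over I⊔J runs over ordered pairs of disjoint, possibly empty, sets with union {1,…,n}. (This identity is equivalent to the Faber intersection number conjecture.) -/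

import Mathlib

open MvPolynomial Finset

noncomputable section

/-- The polynomial ring `ℚ[x_1,…,x_n]`. -/
abbrev R (n : ℕ) : Type := MvPolynomial (Fin n) ℚ

/-- The field of rational functions `ℚ(x_1,…,x_n)`. -/
abbrev K (n : ℕ) : Type := FractionRing (R n)

/-- `x_1 + ⋯ + x_n` as an element of `K n`. -/
def SX (n : ℕ) : K n := algebraMap (R n) (K n) (∑ j, X j)

/-- `x_1^3 + ⋯ + x_n^3` as an element of `K n`. -/
def SX3 (n : ℕ) : K n := algebraMap (R n) (K n) (∑ j, (X j)^3)

/-- `Δ(x_1,…,x_n) = ((Σ x_j)^3 − Σ x_j^3)/3`. -/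
def Dlt (n : ℕ) : K n := ((SX n)^3 - SX3 n) / 3

/-- The ring homomorphism `ℚ[x_1,…,x_{|I|}] → ℚ(x_1,…,x_n)` substituting the variables
of the subset `I` (in increasing order). -/
def embRH {n : ℕ} (I : Finset (Fin n)) : R I.card →+* K n :=
  (algebraMap (R n) (K n)).comp
    (MvPolynomial.rename (fun i : Fin I.card => ((I.orderIsoOfFin rfl) i : Fin n))).toRingHom

lemma embRH_inj {n : ℕ} (I : Finset (Fin n)) : Function.Injective (embRH I) := by
  have h1 : Function.Injective (fun i : Fin I.card => ((I.orderIsoOfFin rfl) i : Fin n)) := by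
    intro i j hij
    exact (I.orderIsoOfFin rfl).injective (Subtype.val_injective hij)
  have h2 := (IsFractionRing.injective (R n) (K n)).comp (MvPolynomial.rename_injective _ h1)
  simpa [embRH, RingHom.coe_comp] using h2

/-- The field embedding `ℚ(x_1,…,x_{|I|}) → ℚ(x_1,…,x_n)` substituting the variables
of the subset `I` (in increasing order).  Used for expressions like `G_{r'}(x_I)`. -/
def emb {n : ℕ} (I : Finset (Fin n)) : K I.card →+* K n :=
  IsFractionRing.lift (embRH_inj I)

/-- The normalized `n`-point functions `G_g(x_1,…,x_n)`, defined with a fuel parameter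
(first argument) for structural recursion; for `fuel ≥ n` this computes the recursively
defined normalized `n`-point function:  `G_0(x) = x^{-2}`, `G_g(x) = 0` for `g ≥ 1`, and
for `n ≥ 2`,
`G_g = Σ_{r+s=g} ((2r+n−3)!!/(4^s(2r+2s+n−1)!!)) P_r Δ^s` where
`P_r = (1/(2Σx_j)) Σ_{I⊔J={1..n}, I,J≠∅} (Σ_I x)²(Σ_J x)² Σ_{r'≤r} G_{r'}(x_I)G_{r−r'}(x_J)`. -/
def Gf : (fuel : ℕ) → (n : ℕ) → ℕ → K n
  | _, 0, _ => 0
  | _, 1, 0 => (algebraMap (R 1) (K 1) (X 0)) ^ (-2 : ℤ)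
  | _, 1, _+1 => 0
  | 0, _+2, _ => 0
  | fuel+1, n+2, g =>
      ∑ s ∈ Finset.range (g+1),
        (((Nat.doubleFactorial (2*(g-s)+(n+2)-3) : ℚ) /
          (4^s * (Nat.doubleFactorial (2*g+(n+2)-1) : ℚ))) : K (n+2)) *
        ((2 * SX (n+2))⁻¹ *
          ∑ I : Finset (Fin (n+2)),
            if I ≠ ∅ ∧ I ≠ univ then
              (algebraMap (R (n+2)) (K (n+2)) (∑ i ∈ I, X i))^2 *
              (algebraMap (R (n+2)) (K (n+2)) (∑ i ∈ Iᶜ, X i))^2 *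
              ∑ r' ∈ Finset.range ((g-s)+1),
                emb I (Gf fuel I.card r') * emb Iᶜ (Gf fuel Iᶜ.card ((g-s) - r'))
            else 0) *
        (Dlt (n+2))^s

/-- The normalized `n`-point function `G_g(x_1,…,x_n)` as an element of `ℚ(x_1,…,x_n)`. -/
def Gnpt (n g : ℕ) : K n := Gf n n g

/-- `P_r(x_1,…,x_n)`. -/
def Ppoly (n r : ℕ) : K n :=
  (2 * SX n)⁻¹ *
    ∑ I : Finset (Fin n),
      if I ≠ ∅ ∧ I ≠ univ then
        (algebraMap (R n) (K n) (∑ i ∈ I, X i))^2 *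
        (algebraMap (R n) (K n) (∑ i ∈ Iᶜ, X i))^2 *
        ∑ r' ∈ Finset.range (r+1), emb I (Gnpt I.card r') * emb Iᶜ (Gnpt Iᶜ.card (r - r'))
      else 0

/-- The `n`-point function `F_g(x_1,…,x_n) = Σ_{h+d=g} (1/d!)((Σx_j^3)/24)^d G_h(x_1,…,x_n)`. -/
def Fnpt (n g : ℕ) : K n :=
  ∑ d ∈ Finset.range (g+1),
    ((1 / (Nat.factorial d : ℚ)) : K n) * (SX3 n / 24)^d * Gnpt n (g-d)

open Classical in
/-- The coefficient of the monomial `Π x_j^{d_j}` of an element of `ℚ(x_1,…,x_n)` which is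
a polynomial (junk value `0` otherwise). -/
def coeffK {n : ℕ} (f : K n) (d : Fin n → ℕ) : ℚ :=
  if h : ∃ p : R n, algebraMap (R n) (K n) p = f then
    MvPolynomial.coeff (Finsupp.equivFunOnFinite.symm d) h.choose
  else 0

/-- The intersection index `⟨τ_{d_1} ⋯ τ_{d_n}⟩_g`, i.e. the coefficient of `Π x_j^{d_j}`
in `F_g(x_1,…,x_n)`.  For `(g,n) = (0,1), (0,2)` and nonnegative `d_j` the value is `0`
(the conventional values `⟨τ_{-2}⟩_0 = 1`, `⟨τ_k τ_{-1-k}⟩_0 = (-1)^k` have a negative index). -/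
def bracket (g : ℕ) {n : ℕ} (d : Fin n → ℕ) : ℚ :=
  if g = 0 ∧ n ≤ 2 then 0 else coeffK (Fnpt n g) d

/-- `⟨τ_j Π_{i ∈ I} τ_{d_i}⟩_g` for a subset `I ⊆ {1,…,n}`. -/
def bracketI (g : ℕ) {n : ℕ} (j : ℕ) (I : Finset (Fin n)) (d : Fin n → ℕ) : ℚ :=
  bracket g (Fin.cons j (fun i : Fin I.card => d ((I.orderIsoOfFin rfl) i)))

/-! ### Laurent expansions in `y` (formal series in `ℚ[x_1,…,x_n][[y,y⁻¹]]` of bounded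
`y`-degree, realized as Hahn/Laurent series in the variable `t = y⁻¹`, so that the
coefficient of `y^k` is the Hahn coefficient at `-k`). -/

/-- Laurent series in `t = y⁻¹` with coefficients in `ℚ[x_1,…,x_n]`. -/
abbrev Lau (n : ℕ) : Type := LaurentSeries (R n)

/-- The generalized binomial coefficient `C(p,k) = p(p−1)⋯(p−k+1)/k!` for `p : ℤ`, `k : ℕ`. -/
def binomZ (p : ℤ) (k : ℕ) : ℚ := (∏ i ∈ Finset.range k, ((p : ℚ) - i)) / (Nat.factorial k)

/-- The expansion of `(y + c)^m = Σ_{k≥0} C(m,k) c^k y^{m−k}` as a Laurent series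
in `t = y⁻¹` (for `m ≥ 0` this is the usual binomial expansion of the polynomial). -/
def yExpAdd {n : ℕ} (c : R n) (m : ℤ) : Lau n :=
  (HahnSeries.single (-m) (1 : R n)) *
    HahnSeries.ofPowerSeries ℤ (R n)
      (PowerSeries.mk fun k => MvPolynomial.C (binomZ m k) * c^k)

/-- The expansion of `(±y + c)^m`, where the sign is `+` if `σ = true` and `−` otherwise;
it is computed as `(±1)^m (y ± c)^m`. -/
def LExp {n : ℕ} (σ : Bool) (c : R n) (m : ℤ) : Lau n :=
  (if σ then 1 else if Even m then 1 else -1 : Lau n) *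
    yExpAdd ((if σ then 1 else -1 : R n) * c) m

open Classical in
/-- The polynomial representing an element of `ℚ(x_1,…,x_n)` lying in `ℚ[x_1,…,x_n]`
(junk value `0` otherwise). -/
def polyOf {n : ℕ} (f : K n) : R n :=
  if h : ∃ p : R n, algebraMap (R n) (K n) p = f then h.choose else 0

/-- `±y` as a Laurent series in `t = y⁻¹`. -/
def yLau (n : ℕ) (σ : Bool) : Lau n :=
  (if σ then 1 else -1 : Lau n) * HahnSeries.single (-1 : ℤ) (1 : R n)

/-- The expansion of `F_g(±y, x_I)` as a Laurent series in `t = y⁻¹` with coefficients in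
`ℚ[x_1,…,x_n]`: for `(g,|I|+1) = (0,1)` it is `(±y)^{-2} = y^{-2}`, for `(g,|I|+1) = (0,2)`
it is `1/(±y + x_i) = Σ_{k≥0} (−1)^k x_i^k (±y)^{−k−1}`, and otherwise it is obtained by
substituting `±y` and the variables of `I` into the polynomial `F_g`. -/
def FExp {n : ℕ} (σ : Bool) (g : ℕ) (I : Finset (Fin n)) : Lau n :=
  if g = 0 ∧ I.card = 0 then HahnSeries.single (2 : ℤ) (1 : R n)
  else if g = 0 ∧ I.card = 1 then LExp σ (∑ i ∈ I, X i) (-1)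
  else
    MvPolynomial.eval₂ ((HahnSeries.C).comp (algebraMap ℚ (R n)))
      (Fin.cons (yLau n σ)
        (fun i : Fin I.card => HahnSeries.C (X ((I.orderIsoOfFin rfl) i : Fin n))))
      (polyOf (Fnpt (I.card + 1) g))

/-- `L_g^{a,b}(y, x_1,…,x_n) = Σ_{g'=0}^{g} Σ_{I⊔J={1,…,n}} (y+Σ_I x)^a (−y+Σ_J x)^b
F_{g'}(y,x_I) F_{g−g'}(−y,x_J)` as a Laurent series in `t = y⁻¹`. -/
def LL (g n : ℕ) (a b : ℤ) : Lau n :=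
  ∑ gp ∈ Finset.range (g+1), ∑ I : Finset (Fin n),
    LExp true (∑ i ∈ I, X i) a * LExp false (∑ i ∈ Iᶜ, X i) b *
      FExp true gp I * FExp false (g - gp) Iᶜ

/-- The coefficient of `y^k Π_j x_j^{d_j}` in a Laurent series in `t = y⁻¹` with coefficients
in `ℚ[x_1,…,x_n]`. -/
def coeffL {n : ℕ} (f : Lau n) (k : ℤ) (d : Fin n → ℕ) : ℚ :=
  MvPolynomial.coeff (Finsupp.equivFunOnFinite.symm d) (f.coeff (-k))

/-- The index of the variable `z_i` among the `a + b + n` variables `z, w, x`. -/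
def zIdx (a b n : ℕ) (i : Fin a) : Fin (a+b+n) := ⟨i.1, by have := i.2; omega⟩

/-- The index of the variable `w_i` among the `a + b + n` variables `z, w, x`. -/
def wIdx (a b n : ℕ) (i : Fin b) : Fin (a+b+n) := ⟨a + i.1, by have := i.2; omega⟩

/-- The index of the variable `x_i` among the `a + b + n` variables `z, w, x`. -/
def xIdx (a b n : ℕ) (i : Fin n) : Fin (a+b+n) := ⟨a + b + i.1, by have := i.2; omega⟩

/-- `L_g(y; z_1,…,z_a; w_1,…,w_b; x_1,…,x_n)
 = Σ_{g'=0}^{g} Σ_{I⊔J={1,…,n}} F_{g'}(y, z, x_I) F_{g−g'}(−y, w, x_J)`,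
as a Laurent series in `t = y⁻¹` with coefficients in `ℚ[z,w,x]`. -/
def LLm (g n a b : ℕ) : Lau (a+b+n) :=
  ∑ gp ∈ Finset.range (g+1), ∑ I : Finset (Fin n),
    FExp true gp ((univ.image (zIdx a b n)) ∪ I.image (xIdx a b n)) *
    FExp false (g - gp) ((univ.image (wIdx a b n)) ∪ Iᶜ.image (xIdx a b n))

/-- The exponent vector of the monomial `Π z_j^{r_j} Π w_j^{s_j} Π x_j^{d_j}`. -/
def expVec (a b n : ℕ) (r : Fin a → ℕ) (s : Fin b → ℕ) (d : Fin n → ℕ) :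
    Fin (a+b+n) → ℕ :=
  fun v =>
    if h : v.1 < a then r ⟨v.1, h⟩
    else if h2 : v.1 < a + b then s ⟨v.1 - a, by omega⟩
    else d ⟨v.1 - (a+b), by have := v.2; omega⟩

namespace Faber

section
/-- Functions on finite subsets of `σ`, with the convolution product over disjoint unions. -/
structure SetFun (σ A : Type*) where
  /-- The underlying function. -/
  toFun : Finset σ → A

instance (σ A : Type*) : CoeFun (SetFun σ A) fun _ => Finset σ → A := ⟨SetFun.toFun⟩

theorem sum_powerset_powerset {σ A : Type*} [DecidableEq σ] [AddCommMonoid A]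
    (F : Finset σ → Finset σ → Finset σ → A) (s : Finset σ) :
    ∑ I ∈ s.powerset, ∑ H ∈ I.powerset, F H (I \ H) (s \ I) =
      ∑ K ∈ s.powerset, ∑ I ∈ (s \ K).powerset, F K I ((s \ K) \ I) := by
  rw [Finset.sum_sigma', Finset.sum_sigma']
  refine Finset.sum_bij' (fun p _ => ⟨p.2, p.1 \ p.2⟩) (fun p _ => ⟨p.1 ∪ p.2, p.1⟩) ?_ ?_ ?_ ?_ ?_
  · rintro ⟨I, H⟩ h
    simp only [mem_sigma, mem_powerset] at h ⊢
    exact ⟨h.2.trans h.1, sdiff_subset_sdiff h.1 subset_rfl⟩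
  · rintro ⟨K, I⟩ h
    simp only [mem_sigma, mem_powerset] at h ⊢
    exact ⟨union_subset h.1 (h.2.trans sdiff_subset), subset_union_left⟩
  · rintro ⟨I, H⟩ h
    simp only [mem_sigma, mem_powerset] at h
    simp [union_sdiff_of_subset h.2]
  · rintro ⟨K, I⟩ h
    simp only [mem_sigma, mem_powerset] at h
    have : Disjoint K I := disjoint_of_subset_right h.2 disjoint_sdiff
    simp [union_sdiff_cancel_left this]
  · rintro ⟨I, H⟩ h
    simp only [mem_sigma, mem_powerset] at h
    simp only
    congr 1
    ext a
    simp only [mem_sdiff]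
    have := @h.2 a
    tauto

namespace SetFun
variable {σ A : Type*}

@[ext] theorem ext {f g : SetFun σ A} (h : ∀ s, f s = g s) : f = g := by
  cases f; cases g; congr; exact funext h

@[simp] theorem mk_apply (f : Finset σ → A) (s : Finset σ) : (⟨f⟩ : SetFun σ A) s = f s := rfl

section
variable [AddCommGroup A]

instance : Zero (SetFun σ A) := ⟨⟨0⟩⟩
instance : Add (SetFun σ A) := ⟨fun f g => ⟨fun s => f s + g s⟩⟩
instance : Neg (SetFun σ A) := ⟨fun f => ⟨fun s => -f s⟩⟩
instance : Sub (SetFun σ A) := ⟨fun f g => ⟨fun s => f s - g s⟩⟩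

@[simp] theorem add_apply (f g : SetFun σ A) (s : Finset σ) : (f + g) s = f s + g s := rfl
@[simp] theorem zero_apply (s : Finset σ) : (0 : SetFun σ A) s = 0 := rfl
@[simp] theorem sub_apply (f g : SetFun σ A) (s : Finset σ) : (f - g) s = f s - g s := rfl
@[simp] theorem neg_apply (f : SetFun σ A) (s : Finset σ) : (-f) s = -f s := rfl

instance : AddCommGroup (SetFun σ A) where
  add_assoc f g h := by ext s; simp [add_assoc]
  add_comm f g := by ext s; simp [add_comm]
  zero_add f := by ext s; simp
  add_zero f := by ext s; simp
  neg_add_cancel f := by ext s; simp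
  sub_eq_add_neg f g := by ext s; simp [sub_eq_add_neg]
  nsmul := nsmulRec
  zsmul := zsmulRec

end

variable [CommRing A] [DecidableEq σ]

instance : Mul (SetFun σ A) := ⟨fun f g => ⟨fun s => ∑ I ∈ s.powerset, f I * g (s \ I)⟩⟩
instance : One (SetFun σ A) := ⟨⟨fun s => if s = ∅ then 1 else 0⟩⟩

theorem mul_apply (f g : SetFun σ A) (s : Finset σ) :
    (f * g) s = ∑ I ∈ s.powerset, f I * g (s \ I) := rfl
theorem one_apply (s : Finset σ) : (1 : SetFun σ A) s = if s = ∅ then 1 else 0 := rfl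

theorem sum_powerset_compl {B : Type*} [AddCommMonoid B] (F : Finset σ → Finset σ → B)
    (s : Finset σ) :
    ∑ I ∈ s.powerset, F I (s \ I) = ∑ I ∈ s.powerset, F (s \ I) I := by
  refine Finset.sum_bij' (fun I _ => s \ I) (fun I _ => s \ I) ?_ ?_ ?_ ?_ ?_ <;>
    simp +contextual [sdiff_subset]

protected theorem mul_comm' (f g : SetFun σ A) : f * g = g * f := by
  ext s
  rw [mul_apply, mul_apply, sum_powerset_compl fun I J => f I * g J]
  simp only [mul_comm]

protected theorem mul_assoc' (f g h : SetFun σ A) : f * g * h = f * (g * h) := by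
  ext s
  simp only [mul_apply, sum_mul, mul_sum]
  rw [sum_powerset_powerset fun H I J => f H * g I * h J]
  simp only [mul_assoc]

protected theorem one_mul' (f : SetFun σ A) : 1 * f = f := by
  ext s
  rw [mul_apply, Finset.sum_eq_single ∅]
  · simp [one_apply]
  · intro b _ hb
    simp [one_apply, hb]
  · simp

instance : CommRing (SetFun σ A) :=
  { (inferInstance : AddCommGroup (SetFun σ A)) with
    left_distrib := fun f g h => by ext s; simp [mul_apply, mul_add, sum_add_distrib]
    right_distrib := fun f g h => by ext s; simp [mul_apply, add_mul, sum_add_distrib]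
    zero_mul := fun f => by ext s; simp [mul_apply]
    mul_zero := fun f => by ext s; simp [mul_apply]
    mul_assoc := SetFun.mul_assoc'
    mul_comm := SetFun.mul_comm'
    one_mul := SetFun.one_mul'
    mul_one := fun f => by rw [SetFun.mul_comm', SetFun.one_mul'] }

/-- Pointwise multiplication by a function. -/
def scale (h : Finset σ → A) (f : SetFun σ A) : SetFun σ A :=
  ⟨fun s => h s * f s⟩

theorem scale_mul {h : Finset σ → A} (hh : ∀ s, ∀ I ⊆ s, h s = h I + h (s \ I))
    (f g : SetFun σ A) : scale h (f * g) = scale h f * g + f * scale h g := by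
  ext s
  simp only [scale, mul_apply, add_apply, mul_sum, ← sum_add_distrib]
  refine sum_congr rfl fun I hI => ?_
  rw [hh s I (mem_powerset.1 hI)]
  ring

theorem mul_insert (f g : SetFun σ A) {j : σ} {s : Finset σ} (hj : j ∉ s) :
    (f * g) (insert j s) = ∑ I ∈ s.powerset, f (insert j I) * g (s \ I) +
      ∑ I ∈ s.powerset, f I * g (insert j (s \ I)) := by
  rw [mul_apply, sum_powerset_insert hj, add_comm]
  congr 1
  · refine sum_congr rfl fun I hI => ?_
    congr 2
    ext a
    simp only [mem_sdiff, mem_insert]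
    by_cases h : a = j <;> simp [h, hj]
  · refine sum_congr rfl fun I hI => ?_
    congr 2
    rw [insert_sdiff_of_notMem]
    exact fun h => hj (mem_powerset.1 hI h)

end SetFun

section powerSeries
variable {A : Type*} [CommRing A]

/-- The operator `2t d/dt`. -/
def theta (f : PowerSeries A) : PowerSeries A := PowerSeries.mk fun g => 2 * (g : A) * PowerSeries.coeff g f

@[simp] theorem coeff_theta (f : PowerSeries A) (g : ℕ) :
    PowerSeries.coeff g (theta f) = 2 * (g : A) * PowerSeries.coeff g f := by simp [theta]

theorem theta_add (f h : PowerSeries A) : theta (f + h) = theta f + theta h := by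
  ext g; simp [mul_add]

theorem theta_sum {ι : Type*} (s : Finset ι) (f : ι → PowerSeries A) :
    theta (∑ i ∈ s, f i) = ∑ i ∈ s, theta (f i) := by
  ext g; simp [mul_sum]

theorem theta_mul (f h : PowerSeries A) : theta (f * h) = theta f * h + f * theta h := by
  ext g
  simp only [coeff_theta, map_add, PowerSeries.coeff_mul, mul_sum, ← sum_add_distrib]
  refine sum_congr rfl fun p hp => ?_
  rw [← mem_antidiagonal.1 hp]
  push_cast
  ring

@[simp] theorem theta_C (a : A) : theta (PowerSeries.C a) = 0 := by
  ext g
  rcases g with _ | g <;> simp [PowerSeries.coeff_C]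

@[simp] theorem theta_X : theta (PowerSeries.X : PowerSeries A) = 2 * PowerSeries.X := by
  ext g
  rw [two_mul, map_add]
  simp only [coeff_theta, PowerSeries.coeff_X]
  split_ifs with h <;> simp [h, one_add_one_eq_two]

@[simp] theorem theta_natCast (n : ℕ) : theta (n : PowerSeries A) = 0 := by
  rw [← map_natCast (PowerSeries.C (R := A)), theta_C]

@[simp] theorem theta_ofNat (n : ℕ) [n.AtLeastTwo] :
    theta (ofNat(n) : PowerSeries A) = 0 := by
  rw [← Nat.cast_ofNat, theta_natCast]

theorem map_theta {B : Type*} [CommRing B] (φ : A →+* B) (f : PowerSeries A) :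
    PowerSeries.map φ (theta f) = theta (PowerSeries.map φ f) := by
  ext g; simp [map_ofNat]

end powerSeries

end

section
variable {σ A : Type*} [CommRing A]

theorem smul_inv_cancel' [Algebra ℚ A] {q : ℚ} (hq : q ≠ 0) (a : A) :
    algebraMap ℚ A q * (q⁻¹ • a) = a := by
  rw [← Algebra.smul_def, smul_smul, mul_inv_cancel₀ hq, one_smul]

theorem eq_of_rat_mul_eq [Algebra ℚ A] {q : ℚ} (hq : q ≠ 0) {a b : A}
    (h : algebraMap ℚ A q * a = algebraMap ℚ A q * b) : a = b := by
  have := congrArg (fun z => q⁻¹ • z) h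
  simpa [← Algebra.smul_def, smul_smul, inv_mul_cancel₀ hq] using this

/-- Cancellation of a nonzero rational which is the image of an integer expression. -/
theorem rat_cancel [Algebra ℚ A] (q : ℚ) (hq : q ≠ 0) {a b r : A}
    (hr : r = algebraMap ℚ A q) (h : r * a = r * b) : a = b :=
  eq_of_rat_mul_eq hq (by rw [← hr, h])

/-- The sum of the variables indexed by `s`. -/
def S (x : σ → A) (s : Finset σ) : A := ∑ i ∈ s, x i

@[simp] theorem S_empty (x : σ → A) : S x ∅ = 0 := rfl
@[simp] theorem S_singleton (x : σ → A) (i : σ) : S x {i} = x i := by simp [S]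

theorem S_add [DecidableEq σ] (x : σ → A) {s I : Finset σ} (h : I ⊆ s) :
    S x s = S x I + S x (s \ I) := by
  rw [S, S, S, add_comm, sum_sdiff h]

theorem S_insert [DecidableEq σ] (x : σ → A) {s : Finset σ} {j : σ} (h : j ∉ s) :
    S x (insert j s) = x j + S x s := by
  rw [S, S, sum_insert h]

variable [DecidableEq σ]

/-- The defining recursion of the functions `(Σ x)² F_g(x)`. -/
structure IsU (x : σ → A) (u : SetFun σ (PowerSeries A)) : Prop where
  eqn : ∀ s, 12 * (theta (u s) + ((s.card : PowerSeries A) - 1) * u s) =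
    6 * PowerSeries.C (S x s) * (u * u) s + PowerSeries.X * PowerSeries.C (S x s) ^ 3 * u s
  const_singleton : ∀ i, PowerSeries.constantCoeff (u {i}) = 1

/-- The quadratic part of the recursion which only involves proper subsets. -/
def properSq (s : Finset σ) (u : ∀ I, I ⊂ s → PowerSeries A) : PowerSeries A :=
  ∑ I ∈ s.powerset, if h : I ⊂ s ∧ s \ I ⊂ s then u I h.1 * u (s \ I) h.2 else 0

variable [Algebra ℚ A]

/-- One step of the construction of the functions `(Σ x)² F_g(x)`. -/
def stepU (x : σ → A) (s : Finset σ) (u : ∀ I, I ⊂ s → PowerSeries A) : PowerSeries A :=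
  if s = ∅ then 0 else PowerSeries.mk fun g => Nat.rec
    (if s.card = 1 then 1 else
      (12 * ((s.card : ℚ) - 1))⁻¹ • (6 * S x s * PowerSeries.coeff 0 (properSq s u)))
    (fun g v => (12 * (2 * ((g : ℚ) + 1) + s.card - 1))⁻¹ •
      (6 * S x s * PowerSeries.coeff (g + 1) (properSq s u) + S x s ^ 3 * v)) g

/-- The functions `(Σ x)² F_g(x)`, as power series in the genus variable. -/
def preU (x : σ → A) (s : Finset σ) : PowerSeries A := stepU x s fun I _ => preU x I
termination_by s.card
decreasing_by exact card_lt_card (by assumption)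

/-- The functions `(Σ x)² F_g(x)`, as power series in the genus variable. -/
def U (x : σ → A) : SetFun σ (PowerSeries A) := ⟨preU x⟩

theorem U_eq (x : σ → A) (s : Finset σ) : U x s = stepU x s fun I _ => U x I := by
  change preU x s = _
  rw [preU]
  rfl

@[simp] theorem U_empty (x : σ → A) : U x ∅ = 0 := by
  rw [U_eq, stepU, if_pos rfl]

omit [Algebra ℚ A] in
theorem mul_self_eq_properSq {u : SetFun σ (PowerSeries A)} (h0 : u ∅ = 0) (s : Finset σ) :
    (u * u) s = properSq s fun I _ => u I := by
  rw [SetFun.mul_apply, properSq]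
  refine sum_congr rfl fun I hI => ?_
  have hI := mem_powerset.1 hI
  split_ifs with h
  · rfl
  · by_cases h1 : I = s
    · simp [h1, h0]
    · have : s \ I = s := by
        by_contra h2
        exact h ⟨hI.ssubset_of_ne h1, sdiff_subset.ssubset_of_ne h2⟩
      rw [Finset.sdiff_eq_self_iff_disjoint] at this
      have : I = ∅ := by
        simpa using this.symm.mono_right hI
      simp [this, h0]

omit [Algebra ℚ A] in
theorem eqn_coeff_zero {x : σ → A} {u : SetFun σ (PowerSeries A)} (h : IsU x u) (s : Finset σ) :
    12 * ((s.card : A) - 1) * PowerSeries.coeff 0 (u s) = 6 * S x s * PowerSeries.coeff 0 ((u * u) s) := by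
  have := congrArg (PowerSeries.coeff 0) (h.eqn s)
  have ht := coeff_theta (u s) 0
  simp only [PowerSeries.coeff_zero_eq_constantCoeff] at ht
  simp [map_ofNat, ht] at this
  simp only [PowerSeries.coeff_zero_eq_constantCoeff]
  linear_combination this

omit [Algebra ℚ A] in
theorem coeff_natCast_mul (n g : ℕ) (f : PowerSeries A) :
    PowerSeries.coeff g ((n : PowerSeries A) * f) = n * PowerSeries.coeff g f := by
  rw [← map_natCast (PowerSeries.C (R := A)), PowerSeries.coeff_C_mul]

omit [Algebra ℚ A] in
theorem coeff_ofNat_mul (n g : ℕ) [n.AtLeastTwo] (f : PowerSeries A) :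
    PowerSeries.coeff g ((ofNat(n) : PowerSeries A) * f) = ofNat(n) * PowerSeries.coeff g f := by
  rw [← Nat.cast_ofNat, coeff_natCast_mul, Nat.cast_ofNat]

omit [Algebra ℚ A] in
theorem IsU.coeff_succ {x : σ → A} {u : SetFun σ (PowerSeries A)} (h : IsU x u) (s : Finset σ)
    (g : ℕ) :
    12 * (2 * ((g : A) + 1) + s.card - 1) * PowerSeries.coeff (g + 1) (u s) =
      6 * S x s * PowerSeries.coeff (g + 1) ((u * u) s) + S x s ^ 3 * PowerSeries.coeff g (u s) := by
  have := congrArg (PowerSeries.coeff (g + 1)) (h.eqn s)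
  simp only [map_add, coeff_ofNat_mul, sub_mul, mul_assoc, map_sub, coeff_natCast_mul, one_mul,
    coeff_theta, ← map_pow, PowerSeries.coeff_succ_X_mul, PowerSeries.coeff_C_mul] at this
  push_cast at this
  linear_combination this

theorem isU_U (x : σ → A) : IsU x (U x) where
  const_singleton i := by
    rw [U_eq, stepU, if_neg (singleton_ne_empty i)]
    simp
  eqn s := by
    rcases s.eq_empty_or_nonempty with rfl | hs
    · rw [U_empty, show theta (0 : PowerSeries A) = 0 by ext; simp]; simp
    have hc : 1 ≤ s.card := card_pos.2 hs
    have hc' : (1 : ℚ) ≤ s.card := by exact_mod_cast hc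
    have hU := U_eq x s
    rw [stepU, if_neg hs.ne_empty, ← mul_self_eq_properSq (U_empty x)] at hU
    ext g
    simp only [map_add, coeff_ofNat_mul, sub_mul, mul_assoc, map_sub, coeff_natCast_mul, one_mul,
      coeff_theta, ← map_pow, PowerSeries.coeff_C_mul]
    rcases g with _ | g
    · have h0 := congrArg (PowerSeries.coeff 0) hU
      simp only [PowerSeries.coeff_mk, Nat.rec_zero] at h0
      rw [PowerSeries.coeff_zero_X_mul, add_zero]
      by_cases h1 : s.card = 1
      · obtain ⟨i, rfl⟩ := card_eq_one.1 h1
        have : (U x * U x) {i} = 0 := by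
          rw [SetFun.mul_apply]
          have : ({i} : Finset σ).powerset = {∅, {i}} := by
            rw [← insert_empty_eq, powerset_insert]; rfl
          rw [this, sum_pair (by simp)]
          simp
        simp [this]
      · rw [if_neg h1] at h0
        have hne : (12 * ((s.card : ℚ) - 1)) ≠ 0 := by
          have : (s.card : ℚ) ≠ 1 := by exact_mod_cast h1
          simpa [sub_eq_zero] using this
        have := smul_inv_cancel' hne (6 * S x s * PowerSeries.coeff 0 ((U x * U x) s))
        rw [← h0] at this
        simp only [map_mul, map_sub, map_natCast, map_ofNat, map_one] at this
        push_cast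
        linear_combination this
    · have h0 := congrArg (PowerSeries.coeff (g + 1)) hU
      have h0' := congrArg (PowerSeries.coeff g) hU
      simp only [PowerSeries.coeff_mk] at h0 h0'
      rw [← h0'] at h0
      rw [PowerSeries.coeff_succ_X_mul, PowerSeries.coeff_C_mul]
      have hne : (12 * (2 * ((g : ℚ) + 1) + s.card - 1)) ≠ 0 := by
        have : (0 : ℚ) ≤ g := g.cast_nonneg
        have : 0 < (12 * (2 * ((g : ℚ) + 1) + s.card - 1)) := by linarith
        exact this.ne'
      have := smul_inv_cancel' hne
        (6 * S x s * PowerSeries.coeff (g + 1) ((U x * U x) s) + S x s ^ 3 * PowerSeries.coeff g (U x s))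
      rw [← h0] at this
      simp only [map_mul, map_sub, map_natCast, map_ofNat, map_one, map_add] at this
      push_cast
      linear_combination this

theorem IsU.empty {x : σ → A} {u : SetFun σ (PowerSeries A)} (h : IsU x u) : u ∅ = 0 := by
  ext g
  rcases g with _ | g
  · have := eqn_coeff_zero h ∅
    refine rat_cancel (-12) (by norm_num) rfl ?_
    simp at this ⊢
    simp [map_ofNat, this]
  · have := h.coeff_succ ∅ g
    refine rat_cancel (12 * (2 * ((g : ℚ) + 1) - 1)) ?_ rfl ?_
    · have : (0 : ℚ) ≤ g := g.cast_nonneg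
      exact (show 0 < (12 * (2 * ((g : ℚ) + 1) - 1)) by linarith).ne'
    · simp only [map_mul, map_sub, map_natCast, map_ofNat, map_one, map_add]
      simpa using this

theorem IsU.eq_U {x : σ → A} {u : SetFun σ (PowerSeries A)} (h : IsU x u) : u = U x := by
  ext s : 1
  induction s using Finset.strongInduction with
  | H s ih =>
    have hU := isU_U x
    have hsq : (u * u) s = (U x * U x) s := by
      rw [mul_self_eq_properSq h.empty, mul_self_eq_properSq hU.empty, properSq, properSq]
      refine sum_congr rfl fun I _ => ?_
      split_ifs with h
      · rw [ih _ h.1, ih _ h.2]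
      · rfl
    rcases s.eq_empty_or_nonempty with rfl | hs
    · rw [h.empty, hU.empty]
    have hc : 1 ≤ s.card := card_pos.2 hs
    have hc' : (1 : ℚ) ≤ s.card := by exact_mod_cast hc
    ext g
    induction g with
    | zero =>
      by_cases h1 : s.card = 1
      · obtain ⟨i, rfl⟩ := card_eq_one.1 h1
        simp [h.const_singleton, hU.const_singleton]
      · refine rat_cancel (12 * ((s.card : ℚ) - 1)) ?_ rfl ?_
        · have : (s.card : ℚ) ≠ 1 := by exact_mod_cast h1
          simpa [sub_eq_zero] using this
        · simp only [map_mul, map_sub, map_natCast, map_ofNat, map_one]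
          rw [eqn_coeff_zero h, eqn_coeff_zero hU, hsq]
    | succ g ihg =>
      refine rat_cancel (12 * (2 * ((g : ℚ) + 1) + s.card - 1)) ?_ rfl ?_
      · have : (0 : ℚ) ≤ g := g.cast_nonneg
        exact (show 0 < (12 * (2 * ((g : ℚ) + 1) + s.card - 1)) by linarith).ne'
      · simp only [map_mul, map_sub, map_natCast, map_ofNat, map_one, map_add]
        rw [h.coeff_succ, hU.coeff_succ, hsq, ihg]

omit [DecidableEq σ] [Algebra ℚ A] in
theorem S_map {B : Type*} [CommRing B] (φ : A →+* B) (x : σ → A) (s : Finset σ) :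
    S (φ ∘ x) s = φ (S x s) := by simp [S]

/-- Naturality of `U` in the ring. -/
theorem U_map {B : Type*} [CommRing B] [Algebra ℚ B] (φ : A →+* B) (x : σ → A) (s : Finset σ) :
    U (φ ∘ x) s = PowerSeries.map φ (U x s) := by
  have h : IsU (φ ∘ x) ⟨fun s => PowerSeries.map φ (U x s)⟩ := by
    refine ⟨fun s => ?_, fun i => ?_⟩
    · have := congrArg (PowerSeries.map φ) ((isU_U x).eqn s)
      simp only [map_mul, map_add, map_theta, map_sub, map_natCast, map_ofNat, map_one,
        PowerSeries.map_C, PowerSeries.map_X, map_pow] at this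
      rw [S_map, this, SetFun.mul_apply, SetFun.mul_apply, map_sum]
      simp only [map_mul]
    · have := (isU_U x).const_singleton i
      simp [← PowerSeries.coeff_zero_eq_constantCoeff, PowerSeries.coeff_map] at this ⊢
      simp [this]
  rw [← h.eq_U]

/-- Naturality of `U` in the index set. -/
theorem U_comp {τ : Type*} [DecidableEq τ] (x : σ → A) (f : τ ↪ σ) (s : Finset τ) :
    U (x ∘ f) s = U x (s.map f) := by
  have hS : ∀ s, S x (s.map f) = S (x ∘ f) s := fun s => by simp [S]
  have h : IsU (x ∘ f) ⟨fun s => U x (s.map f)⟩ := by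
    refine ⟨fun s => ?_, fun i => ?_⟩
    · have := (isU_U x).eqn (s.map f)
      rw [card_map, hS] at this
      rw [this, SetFun.mul_apply, SetFun.mul_apply]
      congr 2
      symm
      refine sum_bij (fun I _ => I.map f) ?_ ?_ ?_ ?_
      · intro I hI
        simpa using hI
      · intro I _ J _ h
        exact map_injective f h
      · intro J hJ
        obtain ⟨I, hI, rfl⟩ := subset_map_iff.1 (mem_powerset.1 hJ)
        exact ⟨I, mem_powerset.2 hI, rfl⟩
      · intro I _
        simp only [Finset.map_sdiff]
    · simpa using (isU_U x).const_singleton (f i)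
  rw [← h.eq_U]

end

section
variable {A : Type*} [CommRing A] [Algebra ℚ A]

theorem eq_zero_of_theta {f b : PowerSeries A} {k : ℕ} (h0 : k = 0 → PowerSeries.coeff 0 f = 0)
    (h : 12 * (theta f + (k : PowerSeries A) * f) = PowerSeries.X * (b * f)) : f = 0 := by
  ext g
  induction g using Nat.strong_induction_on with
  | _ g ih =>
    by_cases hk : 2 * g + k = 0
    · have : g = 0 := by omega
      subst this
      rw [h0 (by omega), map_zero]
    · have h1 := congrArg (PowerSeries.coeff g) h
      have h2 : PowerSeries.coeff g (PowerSeries.X * (b * f)) = 0 := by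
        rcases g with _ | g
        · rw [PowerSeries.coeff_zero_X_mul]
        · rw [PowerSeries.coeff_succ_X_mul, PowerSeries.coeff_mul]
          refine sum_eq_zero fun p hp => ?_
          have := mem_antidiagonal.1 hp
          rw [ih p.2 (by omega)]
          simp
      rw [h2] at h1
      simp only [map_add, coeff_ofNat_mul, coeff_natCast_mul, coeff_theta] at h1
      refine rat_cancel (12 * ((2 * g + k : ℕ) : ℚ)) ?_ rfl ?_
      · exact mul_ne_zero (by norm_num) (by exact_mod_cast hk)
      · simp only [map_mul, map_natCast, map_ofNat]
        push_cast
        rw [map_zero, mul_zero, ← h1]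
        ring

/-- The series `exp (c t)`. -/
def expS (c : A) : PowerSeries A :=
  PowerSeries.mk fun d => algebraMap ℚ A (1 / (d.factorial : ℚ)) * c ^ d

theorem expS_eq (c : A) : expS c = PowerSeries.rescale c (PowerSeries.exp A) := by
  ext d
  simp [expS, PowerSeries.coeff_exp, mul_comm]

theorem expS_add (a b : A) : expS (a + b) = expS a * expS b := by
  rw [expS_eq, expS_eq, expS_eq, PowerSeries.exp_mul_exp_eq_exp_add]

theorem map_expS {B : Type*} [CommRing B] [Algebra ℚ B] (φ : A →+* B) (c : A) :
    PowerSeries.map φ (expS c) = expS (φ c) := by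
  ext d
  have : φ (algebraMap ℚ A (1 / (d.factorial : ℚ))) = algebraMap ℚ B (1 / (d.factorial : ℚ)) :=
    congrArg (fun f : ℚ →+* B => f _) (Subsingleton.elim (φ.comp (algebraMap ℚ A)) (algebraMap ℚ B))
  simp only [expS, PowerSeries.coeff_map, PowerSeries.coeff_mk, map_mul, map_pow, this]

theorem theta_expS (c : A) : theta (expS c) = 2 * PowerSeries.C c * PowerSeries.X * expS c := by
  ext d
  rw [show 2 * PowerSeries.C c * PowerSeries.X * expS c =
    2 * (PowerSeries.C c * (PowerSeries.X * expS c)) by ring, coeff_ofNat_mul,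
    PowerSeries.coeff_C_mul, coeff_theta]
  rcases d with _ | d
  · simp
  · rw [PowerSeries.coeff_succ_X_mul, expS, PowerSeries.coeff_mk, PowerSeries.coeff_mk]
    have : algebraMap ℚ A (1 / (d.factorial : ℚ)) =
        ((d + 1 : ℕ) : A) * algebraMap ℚ A (1 / ((d + 1).factorial : ℚ)) := by
      rw [← map_natCast (algebraMap ℚ A), ← map_mul]
      congr 1
      have := Nat.factorial_ne_zero d
      rw [Nat.factorial_succ]
      push_cast
      field_simp
    rw [this]
    ring

@[simp] theorem coeff_zero_expS (c : A) : PowerSeries.coeff 0 (expS c) = 1 := by simp [expS]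

end

/-- The variables as elements of the field of rational functions. -/
def xK (n : ℕ) : Fin n → K n := fun i => algebraMap (R n) (K n) (MvPolynomial.X i)

theorem SX_eq (n : ℕ) : SX n = S (xK n) univ := by simp [SX, S, xK]

theorem SX3_eq (n : ℕ) : SX3 n = S (fun i => xK n i ^ 3) univ := by simp [SX3, S, xK]

theorem algebraMap_sum_X {n : ℕ} (I : Finset (Fin n)) :
    algebraMap (R n) (K n) (∑ i ∈ I, MvPolynomial.X i) = S (xK n) I := by simp [S, xK]

/-- The increasing enumeration of a finite set. -/
def enum {n : ℕ} (I : Finset (Fin n)) : Fin I.card ↪ Fin n := (I.orderEmbOfFin rfl).toEmbedding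

theorem map_enum {n : ℕ} (I : Finset (Fin n)) : univ.map (enum I) = I := by
  simp [enum]

theorem enum_apply {n : ℕ} (I : Finset (Fin n)) (i : Fin I.card) :
    enum I i = ((I.orderIsoOfFin rfl) i : Fin n) := rfl

theorem emb_comp_xK {n : ℕ} (I : Finset (Fin n)) : emb I ∘ xK I.card = xK n ∘ enum I := by
  funext i
  simp [emb, xK, embRH, IsFractionRing.lift_algebraMap, enum_apply]

theorem emb_SX3 {n : ℕ} (I : Finset (Fin n)) :
    emb I (SX3 I.card) = S (fun i => xK n i ^ 3) I := by
  have h := fun i => congrFun (emb_comp_xK I) i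
  simp only [Function.comp_apply] at h
  rw [SX3_eq, S, map_sum]
  conv_rhs => rw [← map_enum I, S, sum_map]
  simp [h]

theorem Gf_eq : ∀ (n fuel g : ℕ), n ≤ fuel → Gf fuel n g = Gf n n g := by
  intro n
  induction n using Nat.strong_induction_on with
  | _ n ih =>
    intro fuel g hf
    match n, fuel, hf with
    | 0, _, _ => simp [Gf]
    | 1, _, _ => cases g <;> simp [Gf]
    | n + 2, f + 1, hf =>
      rw [Gf, Gf]
      refine sum_congr rfl fun s _ => ?_
      refine congrArg (fun z => _ * (_ * z) * _) (sum_congr rfl fun I _ => ?_)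
      split_ifs with h
      · have hI : I.card < n + 2 := by
          simpa using card_lt_card (ssubset_univ_iff.2 h.2)
        have hJ : Iᶜ.card < n + 2 := by
          have : Iᶜ ≠ univ := by simpa using h.1
          simpa only [card_univ, Fintype.card_fin] using card_lt_card (ssubset_univ_iff.2 this)
        refine congrArg (fun z => _ * z) (sum_congr rfl fun r _ => ?_)
        rw [ih _ hI f r (by omega), ih _ hJ f _ (by omega), ih _ hI (n + 1) r (by omega),
          ih _ hJ (n + 1) _ (by omega)]
      · rfl

theorem Gnpt_eq (n g : ℕ) : Gnpt (n + 2) g = ∑ s ∈ range (g + 1),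
    (((Nat.doubleFactorial (2 * (g - s) + (n + 2) - 3) : ℚ) /
      (4 ^ s * (Nat.doubleFactorial (2 * g + (n + 2) - 1) : ℚ))) : K (n + 2)) *
      Ppoly (n + 2) (g - s) * Dlt (n + 2) ^ s := by
  rw [Gnpt, Gf]
  simp only [Ppoly]
  refine sum_congr rfl fun s _ => ?_
  refine congrArg (fun z => _ * (_ * z) * _) (sum_congr rfl fun I _ => ?_)
  split_ifs with h
  · have hI : I.card < n + 2 := by
      simpa using card_lt_card (ssubset_univ_iff.2 h.2)
    have hJ : Iᶜ.card < n + 2 := by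
      have : Iᶜ ≠ univ := by simpa using h.1
      simpa only [card_univ, Fintype.card_fin] using card_lt_card (ssubset_univ_iff.2 this)
    refine congrArg (fun z => _ * z) (sum_congr rfl fun r _ => ?_)
    rw [Gnpt, Gnpt, Gf_eq _ (n + 1) _ (by omega), Gf_eq _ (n + 1) _ (by omega)]
  · rfl

/-- The generating series of `G_g` over all `g`. -/
def Gs (n : ℕ) : PowerSeries (K n) := PowerSeries.mk (Gnpt n)
/-- The generating series of `P_g` over all `g`. -/
def Ps (n : ℕ) : PowerSeries (K n) := PowerSeries.mk (Ppoly n)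
/-- The generating series of `F_g` over all `g`. -/
def Fs (n : ℕ) : PowerSeries (K n) := PowerSeries.mk (Fnpt n)

theorem Fs_eq (n : ℕ) : Fs n = expS (SX3 n / 24) * Gs n := by
  ext g
  rw [PowerSeries.coeff_mul, Nat.sum_antidiagonal_eq_sum_range_succ_mk, Fs, PowerSeries.coeff_mk,
    Fnpt]
  refine sum_congr rfl fun d _ => ?_
  simp [expS, Gs]

theorem doubleFactorial_rec (m : ℕ) :
    (Nat.doubleFactorial (m + 1) : ℚ) = (m + 1) * Nat.doubleFactorial (m - 1) := by
  rcases m with _ | m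
  · simp
  · rw [Nat.doubleFactorial_add_two]; push_cast; ring

theorem Gs_eqn (n : ℕ) : theta (Gs (n + 2)) + ((n + 1 : ℕ) : PowerSeries (K (n + 2))) * Gs (n + 2) =
    Ps (n + 2) + PowerSeries.X * (PowerSeries.C (Dlt (n + 2) / 4) * Gs (n + 2)) := by
  ext g
  rw [map_add, map_add, coeff_theta, coeff_natCast_mul]
  have key : (2 * (g : K (n + 2)) + ((n + 1 : ℕ) : K (n + 2))) =
      (((2 * g + n : ℕ) + 1 : ℚ) : K (n + 2)) := by push_cast; ring
  rw [← add_mul, key, Gs, PowerSeries.coeff_mk, Gnpt_eq, Ps, PowerSeries.coeff_mk,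
    sum_range_succ', mul_add, add_comm (_ * ∑ s ∈ _, _)]
  have hcast : ∀ (a b : ℚ) (c : ℕ), (a : K (n + 2)) / (4 ^ c * (b : K (n + 2))) =
      ((a / (4 ^ c * b) : ℚ) : K (n + 2)) := by intros; push_cast; rfl
  simp only [hcast]
  have hdf := doubleFactorial_rec (2 * g + n)
  have hpos : (Nat.doubleFactorial (2 * g + n - 1) : ℚ) ≠ 0 := by
    exact_mod_cast (Nat.doubleFactorial_pos _).ne'
  have hpos' : ((2 * g + n : ℕ) : ℚ) + 1 ≠ 0 := by positivity
  congr 1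
  · simp only [pow_zero, mul_one, Nat.sub_zero, one_mul]
    rw [show 2 * g + (n + 2) - 3 = 2 * g + n - 1 by omega,
      show 2 * g + (n + 2) - 1 = 2 * g + n + 1 by omega, hdf, ← mul_assoc, ← Rat.cast_mul]
    rw [show (((2 * g + n : ℕ) : ℚ) + 1) * (((2 * g + n - 1).doubleFactorial : ℚ) /
      ((((2 * g + n : ℕ) : ℚ) + 1) * ((2 * g + n - 1).doubleFactorial : ℚ))) = 1 by field_simp]
    simp
  · rcases g with _ | g
    · simp
    · rw [PowerSeries.coeff_succ_X_mul, PowerSeries.coeff_C_mul, PowerSeries.coeff_mk, Gnpt_eq,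
        mul_sum, mul_sum]
      refine sum_congr rfl fun s _ => ?_
      rw [hcast, show g + 1 - (s + 1) = g - s by omega,
        show 2 * (g + 1) + (n + 2) - 1 = 2 * (g + 1) + n + 1 by omega,
        show 2 * g + (n + 2) - 1 = 2 * (g + 1) + n - 1 by omega, hdf]
      rw [show ((2 * (g - s) + (n + 2) - 3).doubleFactorial : ℚ) / (4 ^ (s + 1) *
        ((((2 * (g + 1) + n : ℕ) : ℚ) + 1) * ((2 * (g + 1) + n - 1).doubleFactorial : ℚ))) =
        (((2 * (g + 1) + n : ℕ) : ℚ) + 1)⁻¹ * 4⁻¹ *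
          (((2 * (g - s) + (n + 2) - 3).doubleFactorial : ℚ) / (4 ^ s *
          ((2 * (g + 1) + n - 1).doubleFactorial : ℚ))) by field_simp; ring]
      have h2 : ((((2 * (g + 1) + n : ℕ) : ℚ) + 1 : ℚ) : K (n + 2)) ≠ 0 := by
        exact_mod_cast hpos'
      rw [Rat.cast_mul (_ * _), Rat.cast_mul _ 4⁻¹, Rat.cast_inv, Rat.cast_inv, Rat.cast_ofNat]
      rw [pow_succ]
      generalize (((_ / _ : ℚ)) : K (n + 2)) = c
      field_simp

theorem coeff_Ps_subset {n : ℕ} (I : Finset (Fin n)) (r : ℕ) :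
    ∑ r' ∈ range (r + 1), emb I (Gnpt I.card r') * emb Iᶜ (Gnpt Iᶜ.card (r - r')) =
      PowerSeries.coeff r (PowerSeries.map (emb I) (Gs I.card) * PowerSeries.map (emb Iᶜ) (Gs Iᶜ.card)) := by
  rw [PowerSeries.coeff_mul, Nat.sum_antidiagonal_eq_sum_range_succ_mk]
  refine sum_congr rfl fun d _ => ?_
  simp [Gs]

theorem expS_mul_Ps {n : ℕ} :
    expS (SX3 n / 24) * Ps n = PowerSeries.C (2 * SX n)⁻¹ * ∑ I : Finset (Fin n),
      if I ≠ ∅ ∧ I ≠ univ then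
        (PowerSeries.C (S (xK n) I ^ 2) * PowerSeries.map (emb I) (Fs I.card)) *
        (PowerSeries.C (S (xK n) Iᶜ ^ 2) * PowerSeries.map (emb Iᶜ) (Fs Iᶜ.card)) else 0 := by
  have : Ps n = PowerSeries.C (2 * SX n)⁻¹ * ∑ I : Finset (Fin n),
      if I ≠ ∅ ∧ I ≠ univ then PowerSeries.C (S (xK n) I ^ 2) * PowerSeries.C (S (xK n) Iᶜ ^ 2) *
        (PowerSeries.map (emb I) (Gs I.card) * PowerSeries.map (emb Iᶜ) (Gs Iᶜ.card)) else 0 := by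
    ext r
    rw [PowerSeries.coeff_C_mul, Ps, PowerSeries.coeff_mk, Ppoly, map_sum]
    congr 1
    refine sum_congr rfl fun I _ => ?_
    split_ifs with h
    · rw [← map_mul, PowerSeries.coeff_C_mul, coeff_Ps_subset, algebraMap_sum_X, algebraMap_sum_X]
    · simp
  rw [this, mul_left_comm, mul_sum]
  congr 1
  refine sum_congr rfl fun I _ => ?_
  split_ifs with h
  · have hE : expS (SX3 n / 24) = PowerSeries.map (emb I) (expS (SX3 I.card / 24)) *
        PowerSeries.map (emb Iᶜ) (expS (SX3 Iᶜ.card / 24)) := by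
      rw [map_expS, map_expS, ← expS_add, map_div₀, map_div₀, emb_SX3, emb_SX3, SX3_eq,
        S_add _ (subset_univ I), map_ofNat, map_ofNat, add_div, compl_eq_univ_sdiff]
    rw [hE, Fs_eq, Fs_eq, map_mul, map_mul]
    ring
  · simp

theorem SX_ne_zero (n : ℕ) : SX (n + 1) ≠ 0 := by
  rw [SX, Ne, FaithfulSMul.algebraMap_eq_zero_iff]
  intro h
  have := congrArg (MvPolynomial.eval (fun i : Fin (n + 1) => if i = 0 then (1 : ℚ) else 0)) h
  simp at this

theorem Fs_eq_U (n : ℕ) (hn : n ≠ 0) : PowerSeries.C (SX n ^ 2) * Fs n = U (xK n) univ := by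
  induction n using Nat.strong_induction_on with
  | _ n ih =>
    match n, hn with
    | 1, _ =>
      have hU := (isU_U (xK 1)).eqn univ
      have h1 := (isU_U (xK 1)).const_singleton 0
      have hu : (univ : Finset (Fin 1)) = {0} := rfl
      have hsq : (U (xK 1) * U (xK 1)) univ = 0 := by
        rw [SetFun.mul_apply, hu]
        refine sum_eq_zero fun I hI => ?_
        rcases subset_singleton_iff.1 (mem_powerset.1 hI) with rfl | rfl <;> simp
      have hF : PowerSeries.C (SX 1 ^ 2) * Fs 1 = expS (SX3 1 / 24) := by
        rw [Fs_eq, mul_left_comm]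
        have : PowerSeries.C (SX 1 ^ 2) * Gs 1 = 1 := by
          ext g
          rw [PowerSeries.coeff_C_mul, Gs, PowerSeries.coeff_mk]
          rcases g with _ | g
          · have : (algebraMap (R 1) (K 1) (MvPolynomial.X 0)) ≠ 0 := by
              rw [Ne, FaithfulSMul.algebraMap_eq_zero_iff]
              exact MvPolynomial.X_ne_zero _
            rw [Gnpt, Gf, SX]
            simp only [univ_unique, Fin.default_eq_zero, sum_singleton, PowerSeries.coeff_zero_one]
            rw [← zpow_natCast, ← zpow_add₀ this]
            simp
          · simp [Gnpt, Gf, PowerSeries.coeff_one]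
        rw [this, mul_one]
      rw [hF, ← sub_eq_zero]
      refine eq_zero_of_theta (b := PowerSeries.C (S (xK 1) univ) ^ 3) (k := 0) ?_ ?_
      · intro _
        rw [map_sub, coeff_zero_expS, PowerSeries.coeff_zero_eq_constantCoeff_apply, hu, h1,
          sub_self]
      · have h3 : PowerSeries.C (SX3 1) = PowerSeries.C (S (xK 1) univ) ^ 3 := by
          rw [← map_pow, SX3_eq]; simp [S]
        have h4 : (24 : PowerSeries (K 1)) * PowerSeries.C (SX3 1 / 24) =
            PowerSeries.C (SX3 1) := by
          rw [← map_ofNat (PowerSeries.C (R := K 1)), ← map_mul]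
          congr 1
          field_simp
        rw [show theta (expS (SX3 1 / 24) - U (xK 1) univ) =
          theta (expS (SX3 1 / 24)) - theta (U (xK 1) univ) by ext; simp [mul_sub], theta_expS]
        rw [hsq] at hU
        simp only [card_univ, Fintype.card_fin, Nat.cast_one, sub_self, zero_mul, add_zero, mul_zero,
          zero_add] at hU
        rw [← h3] at hU ⊢
        push_cast
        linear_combination PowerSeries.X * expS (SX3 1 / 24) * h4 - hU
    | n + 2, _ =>
      have hU := (isU_U (xK (n + 2))).eqn univ
      have hS := SX_ne_zero (n + 1)
      have hG := Gs_eqn n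
      have hFI : ∀ I : Finset (Fin (n + 2)), I ≠ ∅ → I ≠ univ →
          PowerSeries.C (S (xK (n + 2)) I ^ 2) * PowerSeries.map (emb I) (Fs I.card) =
            U (xK (n + 2)) I := by
        intro I h1 h2
        have hI : I.card < n + 2 := by
          simpa using card_lt_card (ssubset_univ_iff.2 h2)
        have := congrArg (PowerSeries.map (emb I)) (ih _ hI (card_ne_zero.2
          (nonempty_iff_ne_empty.2 h1)))
        rw [← U_map, emb_comp_xK, U_comp, map_enum, map_mul, PowerSeries.map_C, map_pow] at this
        have hSI : S (xK (n + 2)) I = S (xK (n + 2) ∘ enum I) univ := by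
          conv_lhs => rw [← map_enum I, S, sum_map]
          rfl
        rw [← this, SX_eq, ← S_map, emb_comp_xK, hSI]
      have hP : PowerSeries.C (2 * SX (n + 2)) * (expS (SX3 (n + 2) / 24) * Ps (n + 2)) =
          (U (xK (n + 2)) * U (xK (n + 2))) univ := by
        rw [expS_mul_Ps, ← mul_assoc, ← map_mul, mul_inv_cancel₀ (mul_ne_zero two_ne_zero hS),
          map_one, one_mul, SetFun.mul_apply, powerset_univ]
        refine sum_congr rfl fun I _ => ?_
        rw [← compl_eq_univ_sdiff]
        split_ifs with h
        · rw [hFI I h.1 h.2, hFI Iᶜ (by simpa using h.2) (by simpa using h.1)]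
        · by_cases h1 : I = ∅
          · simp [h1]
          · have : I = univ := by tauto
            simp [this]
      have hF : 12 * (theta (PowerSeries.C (SX (n + 2) ^ 2) * Fs (n + 2)) +
          ((n + 1 : ℕ) : PowerSeries (K (n + 2))) * (PowerSeries.C (SX (n + 2) ^ 2) * Fs (n + 2))) =
          6 * PowerSeries.C (SX (n + 2)) * (U (xK (n + 2)) * U (xK (n + 2))) univ +
          PowerSeries.X * PowerSeries.C (SX (n + 2)) ^ 3 *
            (PowerSeries.C (SX (n + 2) ^ 2) * Fs (n + 2)) := by
        rw [← hP, Fs_eq, theta_mul, theta_mul, theta_C, theta_expS]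
        have hD : 12 * (PowerSeries.C (Dlt (n + 2) / 4) + 2 * PowerSeries.C (SX3 (n + 2) / 24)) =
            PowerSeries.C (SX (n + 2)) ^ 3 := by
          rw [← map_ofNat (PowerSeries.C (R := K (n + 2))), ← map_ofNat (PowerSeries.C (R := K (n + 2))), ← map_mul, ← map_add, ← map_mul,
            ← map_pow, Dlt]
          congr 1
          field_simp
          ring
        rw [← hD]
        simp only [map_pow, map_mul, map_ofNat]
        linear_combination 12 * PowerSeries.C (SX (n + 2)) ^ 2 * expS (SX3 (n + 2) / 24) * hG
      rw [← sub_eq_zero]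
      refine eq_zero_of_theta (b := PowerSeries.C (SX (n + 2)) ^ 3) (k := n + 1) (by simp) ?_
      rw [show theta (PowerSeries.C (SX (n + 2) ^ 2) * Fs (n + 2) - U (xK (n + 2)) univ) =
          theta (PowerSeries.C (SX (n + 2) ^ 2) * Fs (n + 2)) - theta (U (xK (n + 2)) univ) by
          ext; simp [mul_sub]]
      rw [← SX_eq, card_univ, Fintype.card_fin] at hU
      push_cast at hU hF ⊢
      linear_combination hF - hU

section
variable {σ A : Type*} [CommRing A] [DecidableEq σ]

namespace SetFun

/-- Evaluation at a finite set. -/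
def evalHom (s : Finset σ) : SetFun σ A →+ A where
  toFun f := f s
  map_zero' := rfl
  map_add' _ _ := rfl

theorem ofNat_mul_apply (n : ℕ) [n.AtLeastTwo] (f : SetFun σ A) (s : Finset σ) :
    ((ofNat(n) : SetFun σ A) * f) s = ofNat(n) * f s := by
  rw [← Nat.cast_ofNat, ← nsmul_eq_mul]
  change evalHom s _ = _
  rw [map_nsmul, nsmul_eq_mul, Nat.cast_ofNat]
  rfl

end SetFun

/-- Multiplication by the sum of the variables, as a derivation of the convolution product. -/
def dS (x : σ → A) : Derivation ℤ (SetFun σ (PowerSeries A)) (SetFun σ (PowerSeries A)) :=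
  Derivation.mk' (AddMonoidHom.toIntLinearMap
    { toFun := fun f => SetFun.scale (fun s => PowerSeries.C (S x s)) f
      map_zero' := by ext; simp [SetFun.scale]
      map_add' := fun f g => by ext; simp [SetFun.scale, mul_add] }) fun f g => by
    simp only [AddMonoidHom.coe_toIntLinearMap, AddMonoidHom.coe_mk, ZeroHom.coe_mk, smul_eq_mul]
    rw [SetFun.scale_mul]
    · ring
    · intro s I hI
      rw [S_add x hI, map_add]

theorem dS_apply (x : σ → A) (f : SetFun σ (PowerSeries A)) (s : Finset σ) :
    dS x f s = PowerSeries.C (S x s) * f s := rfl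

/-- The Euler derivation `2t d/dt + |s|` of the convolution product. -/
def dE : Derivation ℤ (SetFun σ (PowerSeries A)) (SetFun σ (PowerSeries A)) :=
  Derivation.mk' (AddMonoidHom.toIntLinearMap
    { toFun := fun f => ⟨fun s => theta (f s) + (s.card : PowerSeries A) * f s⟩
      map_zero' := by ext; simp
      map_add' := fun f g => by
        ext s : 1
        simp only [SetFun.add_apply, theta_add]
        ring }) fun f g => by
    simp only [AddMonoidHom.coe_toIntLinearMap, AddMonoidHom.coe_mk, ZeroHom.coe_mk, smul_eq_mul]
    ext s : 1
    rw [mul_comm g]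
    simp only [SetFun.mul_apply, theta_sum, theta_mul, mul_sum, SetFun.add_apply,
      ← sum_add_distrib]
    refine sum_congr rfl fun I hI => ?_
    rw [← card_sdiff_add_card_eq_card (mem_powerset.1 hI)]
    push_cast
    ring

theorem dE_apply (f : SetFun σ (PowerSeries A)) (s : Finset σ) :
    dE f s = theta (f s) + (s.card : PowerSeries A) * f s := rfl

/-- The genus variable as an element of the convolution ring. -/
def tau : SetFun σ (PowerSeries A) := ⟨fun s => if s = ∅ then PowerSeries.X else 0⟩

theorem tau_mul_apply (f : SetFun σ (PowerSeries A)) (s : Finset σ) :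
    (tau * f : SetFun σ (PowerSeries A)) s = PowerSeries.X * f s := by
  rw [SetFun.mul_apply, Finset.sum_eq_single ∅]
  · simp [tau]
  · intro b _ hb
    simp [tau, hb]
  · simp

theorem dE_tau_mul (f : SetFun σ (PowerSeries A)) :
    dE (tau * f) = 2 * (tau * f) + tau * dE f := by
  ext s : 1
  rw [dE_apply, SetFun.add_apply, SetFun.ofNat_mul_apply, tau_mul_apply, tau_mul_apply, dE_apply,
    theta_mul, theta_X]
  ring

theorem isU_iff (x : σ → A) (u : SetFun σ (PowerSeries A)) :
    IsU x u ↔ (12 * dE u = 12 * u + 6 * dS x (u * u) + tau * dS x (dS x (dS x u))) ∧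
      ∀ i, PowerSeries.constantCoeff (u {i}) = 1 := by
  have key : ∀ s, (12 * dE u) s = (12 * u + 6 * dS x (u * u) +
      tau * dS x (dS x (dS x u)) : SetFun σ (PowerSeries A)) s ↔
      12 * (theta (u s) + ((s.card : PowerSeries A) - 1) * u s) =
      6 * PowerSeries.C (S x s) * (u * u) s + PowerSeries.X * PowerSeries.C (S x s) ^ 3 * u s := by
    intro s
    simp only [SetFun.add_apply, SetFun.ofNat_mul_apply, tau_mul_apply, dS_apply, dE_apply]
    constructor <;> intro h <;> linear_combination h
  constructor
  · intro h
    exact ⟨by ext s : 1; exact (key s).2 (h.eqn s), h.const_singleton⟩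
  · intro h
    exact ⟨fun s => (key s).1 (by rw [h.1]), h.2⟩

theorem IsU.sq_eqn {x : σ → A} {u : SetFun σ (PowerSeries A)} (h : IsU x u) :
    12 * dE (u * u) = 24 * (u * u) + 8 * dS x (u * u * u) +
      tau * (dS x (dS x (dS x (u * u))) - 3 * dS x (dS x u * dS x u)) := by
  have h1 := ((isU_iff x u).1 h).1
  simp only [Derivation.leibniz, smul_eq_mul, map_add] at h1 ⊢
  linear_combination 2 * u * h1

end

section
variable {σ A : Type*} [CommRing A] [DecidableEq σ] [Algebra ℚ A]

theorem S_dvd_sq (x : σ → A) (s : Finset σ) (g : ℕ) (h : 2 * g + s.card ≠ 2) :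
    S x s ∣ PowerSeries.coeff g ((U x * U x) s) := by
  set u := U x
  have h1 := congrArg (fun f => PowerSeries.coeff g (f s)) (isU_U x).sq_eqn
  simp only [SetFun.add_apply, SetFun.ofNat_mul_apply, SetFun.sub_apply, tau_mul_apply, dS_apply,
    dE_apply, map_add, coeff_ofNat_mul, coeff_theta, coeff_natCast_mul,
    PowerSeries.coeff_C_mul] at h1
  have h2 : S x s ∣ PowerSeries.coeff g (PowerSeries.X * (PowerSeries.C (S x s) * (PowerSeries.C (S x s) *
      (PowerSeries.C (S x s) * (u * u) s)) -
      3 * (PowerSeries.C (S x s) * (dS x u * dS x u) s))) := by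
    rcases g with _ | g
    · simp
    · rw [PowerSeries.coeff_succ_X_mul, mul_left_comm 3, ← mul_sub, PowerSeries.coeff_C_mul]
      exact dvd_mul_right _ _
  obtain ⟨w, hw⟩ := h2
  rw [hw] at h1
  have hq : (12 * ((2 * g + s.card : ℕ) - 2 : ℚ)) ≠ 0 := by
    rw [mul_ne_zero_iff, sub_ne_zero]
    exact ⟨by norm_num, by exact_mod_cast h⟩
  refine ⟨(12 * ((2 * g + s.card : ℕ) - 2 : ℚ))⁻¹ •
    (8 * PowerSeries.coeff g ((u * u * u) s) + w), ?_⟩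
  refine eq_of_rat_mul_eq hq ?_
  rw [mul_left_comm, smul_inv_cancel' hq]
  simp only [map_mul, map_natCast, map_ofNat, map_sub]
  push_cast
  linear_combination h1

theorem S_sq_dvd (x : σ → A) (s : Finset σ) (g : ℕ) (hs : s.Nonempty)
    (h : ¬ (g = 0 ∧ s.card ≤ 2)) : S x s ^ 2 ∣ PowerSeries.coeff g (U x s) := by
  have hc := card_pos.2 hs
  have hq : (12 * ((2 * g + s.card : ℕ) - 1 : ℚ)) ≠ 0 := by
    rw [mul_ne_zero_iff, sub_ne_zero]
    refine ⟨by norm_num, ?_⟩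
    have : 2 * g + s.card ≠ 1 := by
      rintro h'
      exact h ⟨by omega, by omega⟩
    exact_mod_cast this
  obtain ⟨w, hw⟩ := S_dvd_sq x s g (fun h' => h ⟨by omega, by omega⟩)
  have key : ∃ v, 12 * (2 * (g : A) + s.card - 1) * PowerSeries.coeff g (U x s) = S x s ^ 2 * v := by
    rcases g with _ | g
    · refine ⟨6 * w, ?_⟩
      have := eqn_coeff_zero (isU_U x) s
      rw [hw] at this
      push_cast
      linear_combination this
    · refine ⟨6 * w + S x s * PowerSeries.coeff g (U x s), ?_⟩
      have := (isU_U x).coeff_succ s g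
      rw [hw] at this
      push_cast
      linear_combination this
  obtain ⟨v, hv⟩ := key
  refine ⟨(12 * ((2 * g + s.card : ℕ) - 1 : ℚ))⁻¹ • v, ?_⟩
  refine eq_of_rat_mul_eq hq ?_
  rw [mul_left_comm, smul_inv_cancel' hq, ← hv]
  simp only [map_mul, map_natCast, map_ofNat, map_sub, map_one]
  push_cast
  ring

end

section
variable {σ : Type*} [DecidableEq σ]

/-- The polynomial `F_g` in the variables indexed by `s`. -/
def Fp (s : Finset σ) (g : ℕ) : MvPolynomial σ ℚ :=
  if h : s.Nonempty ∧ ¬ (g = 0 ∧ s.card ≤ 2) then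
    (S_sq_dvd (X : σ → MvPolynomial σ ℚ) s g h.1 h.2).choose else 0

theorem Fp_spec {s : Finset σ} {g : ℕ} (hs : s.Nonempty) (h : ¬ (g = 0 ∧ s.card ≤ 2)) :
    PowerSeries.coeff g (U (X : σ → MvPolynomial σ ℚ) s) = S X s ^ 2 * Fp s g := by
  rw [Fp, dif_pos ⟨hs, h⟩]
  exact (S_sq_dvd (X : σ → MvPolynomial σ ℚ) s g hs h).choose_spec

theorem S_X_ne_zero {s : Finset σ} (hs : s.Nonempty) : S (X : σ → MvPolynomial σ ℚ) s ≠ 0 := by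
  obtain ⟨i, hi⟩ := hs
  intro h
  have := congrArg (MvPolynomial.eval (fun j => if j = i then (1 : ℚ) else 0)) h
  simp [S, hi] at this

theorem rename_Fp {τ : Type*} [DecidableEq τ] (e : τ ↪ σ) (s : Finset τ) (g : ℕ) :
    MvPolynomial.rename e (Fp s g) = Fp (s.map e) g := by
  by_cases h : s.Nonempty ∧ ¬ (g = 0 ∧ s.card ≤ 2)
  · have h2 := congrArg (MvPolynomial.rename e) (Fp_spec h.1 h.2)
    have h3 : MvPolynomial.rename e (PowerSeries.coeff g (U (X : τ → MvPolynomial τ ℚ) s)) =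
        PowerSeries.coeff g (U (X : σ → MvPolynomial σ ℚ) (s.map e)) := by
      have h4 := U_map (MvPolynomial.rename e : MvPolynomial τ ℚ →ₐ[ℚ] MvPolynomial σ ℚ).toRingHom
        (X : τ → MvPolynomial τ ℚ) s
      have h5 : (MvPolynomial.rename e : MvPolynomial τ ℚ →ₐ[ℚ] MvPolynomial σ ℚ).toRingHom ∘
        (X : τ → MvPolynomial τ ℚ) = X ∘ e := by funext i; simp
      rw [h5, U_comp] at h4
      rw [h4, PowerSeries.coeff_map]
      rfl
    have hS : MvPolynomial.rename e (S (X : τ → MvPolynomial τ ℚ) s) =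
        S (X : σ → MvPolynomial σ ℚ) (s.map e) := by simp [S]
    have hne : (s.map e).Nonempty := by simpa using h.1
    rw [h3, Fp_spec hne (by simpa using h.2), map_mul, map_pow, hS] at h2
    exact (mul_left_cancel₀ (pow_ne_zero 2 (S_X_ne_zero hne)) h2).symm
  · rw [Fp, dif_neg h, Fp, dif_neg (by simpa using h), map_zero]

theorem xK_eq (n : ℕ) : xK n = ⇑(algebraMap (R n) (K n)) ∘ X := rfl

theorem Fnpt_eq {n g : ℕ} (hn : n ≠ 0) (h : ¬ (g = 0 ∧ n ≤ 2)) :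
    Fnpt n g = algebraMap (R n) (K n) (Fp univ g) := by
  obtain ⟨m, rfl⟩ := Nat.exists_eq_succ_of_ne_zero hn
  have h1 : PowerSeries.coeff g (PowerSeries.C (SX (m + 1) ^ 2) * Fs (m + 1)) =
      PowerSeries.coeff g (U (xK (m + 1)) univ) := by rw [Fs_eq_U _ hn]
  have h2 := xK_eq (m + 1)
  rw [PowerSeries.coeff_C_mul, Fs, PowerSeries.coeff_mk, h2, U_map, PowerSeries.coeff_map,
    Fp_spec univ_nonempty (by simpa using h), map_mul, map_pow, ← S_map, ← h2, ← SX_eq] at h1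
  exact mul_left_cancel₀ (pow_ne_zero 2 (SX_ne_zero m)) h1

theorem bracket_eq {m g : ℕ} (hm : m ≠ 0) (h : ¬ (g = 0 ∧ m ≤ 2)) (d : Fin m → ℕ)
    (e : Fin m ↪ σ) :
    bracket g d = MvPolynomial.coeff
      (Finsupp.mapDomain e (Finsupp.equivFunOnFinite.symm d)) (Fp (univ.map e) g) := by
  rw [bracket, if_neg h, ← rename_Fp, MvPolynomial.coeff_rename_mapDomain _ e.injective, coeffK]
  have hex : ∃ p : R m, algebraMap (R m) (K m) p = Fnpt m g := ⟨_, (Fnpt_eq hm h).symm⟩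
  rw [dif_pos hex]
  congr 1
  exact IsFractionRing.injective (R m) (K m) (hex.choose_spec.trans (Fnpt_eq hm h))

end

namespace SetFun
variable {σ A : Type*} [CommRing A] [DecidableEq σ]

/-- Adding the extra element `none` to the argument. -/
def mark (f : SetFun (Option σ) A) : SetFun σ A := ⟨fun s => f (insertNone s)⟩

/-- Restriction to the sets not containing `none`. -/
def unmark (f : SetFun (Option σ) A) : SetFun σ A := ⟨fun s => f (s.map Function.Embedding.some)⟩

omit [CommRing A] [DecidableEq σ] in
theorem mark_apply (f : SetFun (Option σ) A) (s : Finset σ) : f.mark s = f (insertNone s) := rfl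
omit [CommRing A] [DecidableEq σ] in
theorem unmark_apply (f : SetFun (Option σ) A) (s : Finset σ) :
    f.unmark s = f (s.map Function.Embedding.some) := rfl

theorem insertNone_eq (s : Finset σ) :
    insertNone s = insert none (s.map Function.Embedding.some) := by
  ext a; cases a <;> simp

omit [DecidableEq σ] in
theorem sum_powerset_map {τ : Type*} [DecidableEq τ] (e : σ ↪ τ) (F : Finset τ → A)
    (s : Finset σ) : ∑ I ∈ (s.map e).powerset, F I = ∑ I ∈ s.powerset, F (I.map e) := by
  symm
  refine sum_bij (fun I _ => I.map e) ?_ ?_ ?_ ?_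
  · intro I hI
    simpa using hI
  · intro I _ J _ h
    exact map_injective e h
  · intro J hJ
    obtain ⟨I, hI, rfl⟩ := subset_map_iff.1 (mem_powerset.1 hJ)
    exact ⟨I, mem_powerset.2 hI, rfl⟩
  · intro I _
    rfl

theorem mark_mul (f g : SetFun (Option σ) A) :
    (f * g).mark = f.mark * g.unmark + f.unmark * g.mark := by
  ext s
  rw [mark_apply, insertNone_eq, mul_insert _ _ (by simp), sum_powerset_map, sum_powerset_map,
    add_apply, mul_apply, mul_apply]
  simp only [mark_apply, unmark_apply, insertNone_eq, Finset.map_sdiff]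

end SetFun

section
variable {σ A : Type*} [CommRing A] [DecidableEq σ] [Algebra ℚ A]

/-- The variables `x` together with an extra variable `y`. -/
def addVar (y : A) (x : σ → A) : Option σ → A := fun o => o.elim y x

omit [CommRing A] [DecidableEq σ] [Algebra ℚ A] in
theorem addVar_comp_some (y : A) (x : σ → A) :
    addVar y x ∘ (Function.Embedding.some : σ ↪ Option σ) = x := rfl

omit [DecidableEq σ] [Algebra ℚ A] in
theorem S_addVar (y : A) (x : σ → A) (s : Finset σ) :
    S (addVar y x) (insertNone s) = y + S x s := by
  classical
  rw [SetFun.insertNone_eq, S_insert _ (by simp)]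
  simp [S, addVar]

/-- The functions `(y + Σ x)² F_g(y, x)`. -/
def marked (y : A) (x : σ → A) : SetFun σ (PowerSeries A) := (U (addVar y x)).mark

theorem unmark_U (y : A) (x : σ → A) : (U (addVar y x)).unmark = U x := by
  ext s : 1
  rw [SetFun.unmark_apply, ← U_comp, addVar_comp_some]

theorem marked_eqn (y : A) (x : σ → A) (s : Finset σ) :
    12 * (theta (marked y x s) + (s.card : PowerSeries A) * marked y x s) =
      12 * PowerSeries.C (y + S x s) * (marked y x * U x) s +
        PowerSeries.X * PowerSeries.C (y + S x s) ^ 3 * marked y x s := by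
  have h := (isU_U (addVar y x)).eqn (insertNone s)
  have h2 : (U (addVar y x) * U (addVar y x)) (insertNone s) = 2 * (marked y x * U x) s := by
    rw [← SetFun.mark_apply, SetFun.mark_mul, unmark_U, ← marked, SetFun.add_apply,
      mul_comm (U x)]
    ring
  rw [card_insertNone, S_addVar, h2, ← SetFun.mark_apply, ← marked] at h
  push_cast at h
  linear_combination h

theorem marked_empty (y : A) (x : σ → A) : PowerSeries.coeff 0 (marked y x ∅) = 1 := by
  have h := (isU_U (addVar y x)).const_singleton none
  rw [PowerSeries.coeff_zero_eq_constantCoeff_apply]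
  exact h

theorem marked_map {B : Type*} [CommRing B] [Algebra ℚ B] (f : A →+* B) (y : A) (x : σ → A)
    (s : Finset σ) : marked (f y) (f ∘ x) s = PowerSeries.map f (marked y x s) := by
  rw [marked, marked, SetFun.mark_apply, SetFun.mark_apply, ← U_map]
  congr 2
  funext o
  cases o <;> rfl

end

section
variable {k : Type*} [CommRing k]

/-- Laurent series in `y⁻¹` of degree at most `d` in `y`. -/
def Fil (d : ℤ) (f : LaurentSeries k) : Prop := ∀ i, i < -d → f.coeff i = 0

theorem Fil.zero (d : ℤ) : Fil d (0 : LaurentSeries k) := fun _ _ => rfl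

theorem Fil.add {d : ℤ} {f g : LaurentSeries k} (hf : Fil d f) (hg : Fil d g) : Fil d (f + g) :=
  fun i hi => by rw [HahnSeries.coeff_add, hf i hi, hg i hi, add_zero]

theorem Fil.neg {d : ℤ} {f : LaurentSeries k} (hf : Fil d f) : Fil d (-f) :=
  fun i hi => by rw [HahnSeries.coeff_neg, hf i hi, neg_zero]

theorem Fil.sub {d : ℤ} {f g : LaurentSeries k} (hf : Fil d f) (hg : Fil d g) : Fil d (f - g) := by
  rw [sub_eq_add_neg]; exact hf.add hg.neg

theorem Fil.sum {ι : Type*} {d : ℤ} {s : Finset ι} {f : ι → LaurentSeries k}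
    (h : ∀ i ∈ s, Fil d (f i)) : Fil d (∑ i ∈ s, f i) :=
  Finset.sum_induction f (Fil d) (fun _ _ => Fil.add) (Fil.zero d) h

theorem Fil.mono {d e : ℤ} {f : LaurentSeries k} (hf : Fil d f) (h : d ≤ e) : Fil e f :=
  fun i hi => hf i (by omega)

theorem Fil.mul {d e : ℤ} {f g : LaurentSeries k} (hf : Fil d f) (hg : Fil e g) :
    Fil (d + e) (f * g) := by
  intro n hn
  rw [HahnSeries.coeff_mul]
  refine sum_eq_zero fun p hp => ?_
  obtain ⟨_, _, h3⟩ := mem_antidiagonal.1 hp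
  by_cases h : p.1 < -d
  · rw [hf _ h, zero_mul]
  · rw [hg p.2 (by omega), mul_zero]

theorem Fil.C (a : k) : Fil 0 (HahnSeries.C a : LaurentSeries k) := by
  intro i hi
  rw [HahnSeries.C_apply, HahnSeries.coeff_single_of_ne (by omega)]

theorem Fil.C_mul {d : ℤ} {f : LaurentSeries k} (a : k) (hf : Fil d f) :
    Fil d (HahnSeries.C a * f) := by
  simpa using (Fil.C a).mul hf

theorem exists_fil (f : LaurentSeries k) : ∃ d, Fil d f :=
  ⟨-f.order, fun i hi => HahnSeries.coeff_eq_zero_of_lt_order (by omega)⟩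

theorem Fil.single (d : ℤ) (a : k) : Fil d (HahnSeries.single (-d) a : LaurentSeries k) :=
  fun i hi => HahnSeries.coeff_single_of_ne (by omega)

theorem Fil.ofPowerSeries (f : PowerSeries k) :
    Fil 0 (HahnSeries.ofPowerSeries ℤ k f) := by
  intro i hi
  rw [HahnSeries.ofPowerSeries_apply]
  refine HahnSeries.embDomain_of_notMem_range ?_
  rintro ⟨n, rfl⟩
  have : (0 : ℤ) ≤ n := n.cast_nonneg
  simp at hi
  omega

theorem Fil.pow {d : ℤ} {f : LaurentSeries k} (hf : Fil d f) (n : ℕ) : Fil (d * n) (f ^ n) := by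
  induction n with
  | zero => simpa using Fil.C (1 : k)
  | succ n ih =>
    rw [pow_succ]
    convert ih.mul hf using 1
    push_cast
    ring

theorem Fil.zpow {d : ℤ} {u : (LaurentSeries k)ˣ} (hu : Fil d (u : LaurentSeries k))
    (hu' : Fil (-d) (u⁻¹).val) (n : ℤ) :
    Fil (d * n) (u ^ n).val := by
  rcases n with n | n
  · rw [Int.ofNat_eq_natCast, zpow_natCast, Units.val_pow_eq_pow_val]
    exact hu.pow n
  · rw [zpow_negSucc, ← inv_pow, Units.val_pow_eq_pow_val]
    convert hu'.pow (n + 1) using 1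
    rw [Int.negSucc_eq]
    push_cast
    ring

/-- The Laurent series variable `y`. -/
def yy : LaurentSeries k := HahnSeries.single (-1) 1

/-- The unit `y + a`. -/
def unitAdd (a : k) : (LaurentSeries k)ˣ where
  val := yy + HahnSeries.C a
  inv := HahnSeries.single 1 1 * HahnSeries.ofPowerSeries ℤ k
    (PowerSeries.invOfUnit (1 + PowerSeries.C a * PowerSeries.X) 1)
  val_inv := by
    have h1 : (yy + HahnSeries.C a : LaurentSeries k) * HahnSeries.single 1 1 =
        HahnSeries.ofPowerSeries ℤ k (1 + PowerSeries.C a * PowerSeries.X) := by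
      simp [yy, add_mul, HahnSeries.ofPowerSeries_X]
    rw [← mul_assoc, h1, ← map_mul, PowerSeries.mul_invOfUnit _ _ (by simp), map_one]
  inv_val := by
    have h1 : (yy + HahnSeries.C a : LaurentSeries k) * HahnSeries.single 1 1 =
        HahnSeries.ofPowerSeries ℤ k (1 + PowerSeries.C a * PowerSeries.X) := by
      simp [yy, add_mul, HahnSeries.ofPowerSeries_X]
    rw [mul_comm, ← mul_assoc, h1, ← map_mul, PowerSeries.mul_invOfUnit _ _ (by simp), map_one]

/-- The unit `-y + a`. -/
def unitSub (a : k) : (LaurentSeries k)ˣ := -unitAdd (-a)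

theorem val_unitAdd (a : k) : (unitAdd a : LaurentSeries k) = yy + HahnSeries.C a := rfl

theorem val_unitSub (a : k) : (unitSub a : LaurentSeries k) = -yy + HahnSeries.C a := by
  rw [unitSub, Units.val_neg, val_unitAdd, map_neg]
  ring

theorem fil_yy : Fil 1 (yy : LaurentSeries k) := Fil.single 1 1

theorem fil_unitAdd (a : k) : Fil 1 (unitAdd a : LaurentSeries k) :=
  fil_yy.add ((Fil.C a).mono (by norm_num))

theorem fil_unitAdd_inv (a : k) :
    Fil (-1) ((unitAdd a)⁻¹).val := by
  have := (Fil.single (-1) (1 : k)).mul (Fil.ofPowerSeries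
    (PowerSeries.invOfUnit (1 + PowerSeries.C a * PowerSeries.X) 1))
  rw [add_zero] at this
  exact this

theorem fil_unitSub (a : k) : Fil 1 (unitSub a : LaurentSeries k) := by
  rw [unitSub, Units.val_neg]
  exact (fil_unitAdd _).neg

theorem fil_unitSub_inv (a : k) :
    Fil (-1) ((unitSub a)⁻¹).val := by
  rw [unitSub, inv_neg, Units.val_neg]
  exact (fil_unitAdd_inv _).neg

end

section good
variable {k : Type*} [CommRing k] {ι : Type*} (P : Finset ι) (V : ι → LaurentSeries k)
  (w : ι → (LaurentSeries k)ˣ) (N : ℤ)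

/-- The weighted sums `Σ h w^i V` have `y`-degree at most `N + 2d + 2i`. -/
def Good (d : ℤ) (h : ι → LaurentSeries k) : Prop :=
  ∀ i : ℤ, Fil (N + 2 * d + 2 * i)
    (∑ p ∈ P, h p * (w p ^ i).val * V p)

variable {P V w N}

theorem Good.add {d : ℤ} {h h' : ι → LaurentSeries k} (H : Good P V w N d h)
    (H' : Good P V w N d h') : Good P V w N d (h + h') := fun i => by
  simpa only [Pi.add_apply, add_mul, sum_add_distrib] using (H i).add (H' i)

theorem Good.C_mul {d : ℤ} {h : ι → LaurentSeries k} (a : k) (H : Good P V w N d h) :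
    Good P V w N d (fun p => HahnSeries.C a * h p) := fun i => by
  simpa only [mul_sum, mul_assoc] using (H i).C_mul a

theorem Good.mono {d e : ℤ} {h : ι → LaurentSeries k} (H : Good P V w N d h) (hde : d ≤ e) :
    Good P V w N e h := fun i => (H i).mono (by omega)

theorem Good.shift {d : ℤ} {h : ι → LaurentSeries k} (j : ℤ) (H : Good P V w N d h) :
    Good P V w N (d + j) (fun p => h p * (w p ^ j).val) :=
  fun i => by
    have := H (j + i)
    simp only [zpow_add, Units.val_mul] at this
    convert this using 1
    · ring
    · simp only [mul_assoc]

theorem Good.congr {d : ℤ} {h h' : ι → LaurentSeries k} (H : Good P V w N d h)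
    (hh : ∀ p, h p = h' p) : Good P V w N d h' := by
  rwa [← funext hh]

theorem Good.div {d : ℤ} {h : ι → LaurentSeries k} (H : Good P V w N d h)
    (hw : ∀ p, Fil 2 (w p).val)
    (hw' : ∀ p, Fil (-2) ((w p)⁻¹).val)
    (w' : ι → (LaurentSeries k)ˣ) (e : k)
    (he : ∀ p, (w' p).val = (w p).val + HahnSeries.C e) :
    Good P V w N (d - 1) (fun p => h p * ((w' p)⁻¹).val) := by
  have crude : ∃ D : ℤ, ∀ p ∈ P, Fil D (h p *
      ((w' p)⁻¹).val * V p) := by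
    choose D hD using fun p => exists_fil (h p *
      ((w' p)⁻¹).val * V p)
    refine ⟨∑ p ∈ P, |D p|, fun p hp => (hD p).mono ?_⟩
    exact (le_abs_self _).trans (single_le_sum (f := fun p => |D p|) (fun _ _ => abs_nonneg _) hp)
  obtain ⟨D, hD⟩ := crude
  set Y : ℤ → LaurentSeries k := fun i => ∑ p ∈ P, h p *
    ((w' p)⁻¹).val *
    (w p ^ i).val * V p with hY
  have hrecY : ∀ i, Y i = ∑ p ∈ P, h p * (w p ^ (i - 1)).val *
      V p - HahnSeries.C e * Y (i - 1) := by
    intro i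
    rw [hY, mul_sum, ← sum_sub_distrib]
    refine sum_congr rfl fun p _ => ?_
    have h1 : (w p ^ i).val =
        (w p ^ (i - 1)).val * (w p).val := by
      rw [← Units.val_mul, ← zpow_add_one, sub_add_cancel]
    have h2 : ((w' p)⁻¹).val * ((w p).val + HahnSeries.C e) = 1 := by
      rw [← he, Units.inv_mul]
    rw [h1]
    linear_combination h p * (w p ^ (i - 1)).val * V p * h2
  have claim : ∀ t : ℕ, ∀ i, Fil (max (N + 2 * d - 2) (D - 2 * t) + 2 * i) (Y i) := by
    intro t
    induction t with
    | zero =>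
      intro i
      refine Fil.sum fun p hp => ?_
      have := (hD p hp).mul (Fil.zpow (hw p) (hw' p) i)
      refine Fil.mono (d := D + 2 * i) ?_ (by simp)
      convert this using 1
      ring
    | succ t ih =>
      intro i
      rw [hrecY]
      refine ((H (i - 1)).mono ?_).sub (((ih (i - 1)).C_mul e).mono ?_)
      · push_cast; omega
      · push_cast; omega
  intro i
  refine (claim (D - (N + 2 * d - 2)).toNat i).mono ?_
  omega

variable {A B A' B' : ι → (LaurentSeries k)ˣ} {a κ : k}

/-- The function `T_c` which arises from the recursion of the weighted sums. -/
def TT (A B A' B' : ι → (LaurentSeries k)ˣ) (c : ℤ) (p : ι) : LaurentSeries k :=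
  (A' p ^ (c + 1) * B p ^ c).val +
    (A p ^ c * B' p ^ (c + 1)).val

theorem TT_rec (hAB : ∀ p, (A p).val + (B p).val = HahnSeries.C a)
    (hA' : ∀ p, (A' p).val = (A p).val + HahnSeries.C κ)
    (hB' : ∀ p, (B' p).val = (B p).val + HahnSeries.C κ) (c : ℤ) (p : ι) :
    TT A B A' B' (c + 1) p + ((A p).val * (B p).val) * ((A' p).val * (B' p).val) *
      TT A B A' B' (c - 1) p =
    (2 * ((A p).val * (B p).val) + HahnSeries.C (κ * a)) * TT A B A' B' c p := by
  have e1 : ∀ (u : (LaurentSeries k)ˣ) (n : ℤ), (u ^ (n + 1)).val = (u ^ n).val * u.val := by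
    intro u n; rw [zpow_add_one, Units.val_mul]
  have e2 : ∀ (u : (LaurentSeries k)ˣ), (u ^ c).val = (u ^ (c - 1)).val * u.val := by
    intro u; rw [← e1, sub_add_cancel]
  simp only [TT, Units.val_mul, sub_add_cancel, e1, e2]
  rw [map_mul, ← hAB p, hA', hB']
  ring

theorem Good.TT (H : Good P V (fun p => A p * B p) N 0 1)
    (hA : ∀ p, Fil 1 (A p).val)
    (hB : ∀ p, Fil 1 (B p).val)
    (hAi : ∀ p, Fil (-1) ((A p)⁻¹).val)
    (hBi : ∀ p, Fil (-1) ((B p)⁻¹).val)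
    (hAB : ∀ p, (A p).val + (B p).val = HahnSeries.C a)
    (hA' : ∀ p, (A' p).val = (A p).val + HahnSeries.C κ)
    (hB' : ∀ p, (B' p).val = (B p).val + HahnSeries.C κ) (c : ℤ) :
    Good P V (fun p => A p * B p) N (c - 1) (fun p => TT A B A' B' c p -
      HahnSeries.C (a + 2 * (c + 1) * κ) *
        ((A p * B p) ^ c).val) := by
  have hw : ∀ p, Fil 2 (A p * B p).val := fun p => by
    rw [Units.val_mul]; exact (hA p).mul (hB p)
  have hw' : ∀ p, Fil (-2) ((A p * B p)⁻¹).val := fun p => by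
    rw [mul_inv, Units.val_mul]; exact (hAi p).mul (hBi p)
  set w : ι → (LaurentSeries k)ˣ := fun p => A p * B p with hwdef
  set w' : ι → (LaurentSeries k)ˣ := fun p => A' p * B' p with hw'def
  set e : k := κ * a + κ ^ 2 with hedef
  have he : ∀ p, (w' p).val = (w p).val + HahnSeries.C e := fun p => by
    rw [hw'def, hwdef, hedef]
    simp only [Units.val_mul, map_add, map_mul, map_pow]
    rw [hA', hB', ← hAB p]
    ring
  set q : ℤ → k := fun c => a + 2 * (c + 1) * κ with hq
  set r : ℤ → ι → LaurentSeries k := fun c p => Faber.TT A B A' B' c p -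
    HahnSeries.C (q c) * (w p ^ c).val with hr
  have hwc : ∀ (c : ℤ) (p : ι), (w p ^ (c + 1)).val =
      (w p ^ c).val * (w p).val := fun c p => by
    rw [zpow_add_one, Units.val_mul]
  have hpow : ∀ c : ℤ, Good P V w N c
      (fun p => (w p ^ c).val) := fun c =>
    ((H.shift c).mono (by omega)).congr fun p => by simp [hwdef]
  have hrec : ∀ c p, r (c + 1) p = (HahnSeries.C 2 * (r c p * (w p ^ (1 : ℤ)).val) + HahnSeries.C (κ * a) * r c p) +
      (HahnSeries.C (-1) * (r (c - 1) p * (w p ^ (2 : ℤ)).val) + HahnSeries.C (-e) * (r (c - 1) p * (w p ^ (1 : ℤ)).val)) + (HahnSeries.C (κ * a * q c - e * q (c - 1)) *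
        (w p ^ c).val) := by
    intro c p
    have h1 := TT_rec hAB hA' hB' c p
    have h2 : (A p).val * (B p).val = (w p).val := by rw [hwdef, Units.val_mul]
    have h3 : (A' p).val * (B' p).val = (w p).val + HahnSeries.C e := by
      rw [← he, hw'def, Units.val_mul]
    rw [h2, h3] at h1
    have h4 : (w p ^ c).val =
        (w p ^ (c - 1)).val * (w p).val := by
      rw [← hwc, sub_add_cancel]
    have h5 : HahnSeries.C (q (c + 1)) + HahnSeries.C (q (c - 1)) =
        (2 : LaurentSeries k) * HahnSeries.C (q c) := by
      rw [← map_ofNat (HahnSeries.C (Γ := ℤ) (R := k)), ← map_mul, ← map_add, hq]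
      congr 1
      push_cast
      ring
    simp only [hr, hwc, h4, zpow_ofNat, Units.val_pow_eq_pow_val, map_sub, map_mul,
      map_neg, map_one, map_ofNat] at h1 ⊢
    linear_combination h1 - (w p ^ (c - 1)).val *
      (w p).val ^ 2 * h5
  have up : ∀ c, Good P V w N (c - 1) (r c) → Good P V w N (c - 1 - 1) (r (c - 1)) →
      Good P V w N (c + 1 - 1) (r (c + 1)) := by
    intro c h1 h2
    refine Good.congr ?_ fun p => (hrec c p).symm
    refine Good.add (Good.add (Good.add ?_ ?_) (Good.add ?_ ?_)) ?_
    · exact ((h1.shift 1).C_mul 2).mono (by omega)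
    · exact (h1.C_mul _).mono (by omega)
    · exact ((h2.shift 2).C_mul _).mono (by omega)
    · exact ((h2.shift 1).C_mul _).mono (by omega)
    · exact ((hpow c).C_mul _).mono (by omega)
  have down : ∀ c, Good P V w N (c - 1) (r c) → Good P V w N (c + 1 - 1) (r (c + 1)) →
      Good P V w N (c - 1 - 1) (r (c - 1)) := by
    intro c h1 h2
    have key : Good P V w N c (fun p => r (c - 1) p *
        (((w p).val) * (w' p).val)) := by
      refine Good.congr (h := fun p => (HahnSeries.C 2 * (r c p *
        (w p ^ (1 : ℤ)).val) +
        HahnSeries.C (κ * a) * r c p) + HahnSeries.C (-1) * r (c + 1) p +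
        (HahnSeries.C (κ * a * q c - e * q (c - 1)) *
        (w p ^ c).val)) ?_ fun p => ?_
      · refine Good.add (Good.add (Good.add ?_ ?_) ?_) ?_
        · exact ((h1.shift 1).C_mul 2).mono (by omega)
        · exact (h1.C_mul _).mono (by omega)
        · exact (h2.C_mul _).mono (by omega)
        · exact ((hpow c).C_mul _).mono (by omega)
      · rw [hrec c p, he]
        simp only [zpow_ofNat, Units.val_pow_eq_pow_val, map_neg, map_one]
        ring
    have h3 := (key.div hw hw' w' e he).shift (-1)
    refine (h3.mono (by omega)).congr fun p => ?_
    rw [zpow_neg_one]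
    have e1 := Units.mul_inv (w' p)
    have e2 := Units.mul_inv (w p)
    linear_combination r (c - 1) p * e2 + r (c - 1) p * (w p).val * ((w p)⁻¹).val * e1
  have h0 : ∀ p, r 0 p = 0 := fun p => by
    simp only [hr, hq, Faber.TT]
    simp only [zero_add, zpow_one, zpow_zero, mul_one, one_mul, Units.val_one, hA', hB',
      map_add, map_mul, Int.cast_zero, map_ofNat]
    rw [← hAB p]
    ring
  have h1 : ∀ p, r (-1) p = 0 := fun p => by
    have e1 := Units.mul_inv (A p)
    have e2 := Units.mul_inv (B p)
    simp only [hr, hq, Faber.TT]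
    simp only [neg_add_cancel, zpow_zero, one_mul, mul_one, zpow_neg_one, Int.cast_neg,
      Int.cast_one, mul_zero, zero_mul, add_zero, hwdef, mul_inv, Units.val_mul]
    rw [← hAB p]
    linear_combination -((A p)⁻¹).val * e2 -
      ((B p)⁻¹).val * e1
  have hz : ∀ d, Good P V w N d 0 := fun d i => by simpa using Fil.zero _
  have main : ∀ c : ℤ, Good P V w N (c - 1) (r c) ∧ Good P V w N (c - 1 - 1) (r (c - 1)) := by
    intro c
    induction c using Int.induction_on with
    | zero => exact ⟨(hz _).congr fun p => (h0 p).symm, (hz _).congr fun p => (h1 p).symm⟩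
    | succ n ih =>
      refine ⟨up _ ih.1 ih.2, ?_⟩
      rw [add_sub_cancel_right]
      exact ih.1
    | pred n ih =>
      refine ⟨ih.2, down _ ih.2 ?_⟩
      rw [sub_add_cancel]
      exact ih.1
  exact (main c).1

end good

section
variable {k : Type*} [CommRing k]

theorem coeff_natCast_mul_laurent (N : ℕ) (f : LaurentSeries k) (i : ℤ) :
    ((N : LaurentSeries k) * f).coeff i = (N : k) * f.coeff i := by
  rw [← map_natCast (HahnSeries.C (Γ := ℤ) (R := k)), HahnSeries.C_mul_eq_smul,
    HahnSeries.coeff_smul, smul_eq_mul]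

theorem natCast_mul_cancel [Algebra ℚ k] {N : ℕ} (hN : N ≠ 0) {a b : k}
    (h : (N : k) * a = N * b) : a = b :=
  rat_cancel (N : ℚ) (by exact_mod_cast hN) (map_natCast (algebraMap ℚ k) N).symm h

theorem Fil.of_natCast_mul [Algebra ℚ k] {d : ℤ} {N : ℕ} (hN : N ≠ 0) {f : LaurentSeries k}
    (h : Fil d ((N : LaurentSeries k) * f)) : Fil d f := fun i hi => by
  refine natCast_mul_cancel hN ?_
  rw [← coeff_natCast_mul_laurent, h i hi, mul_zero]

end

section
variable {σ k : Type*} [CommRing k] [DecidableEq σ] [Algebra ℚ k] (x : σ → k)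

/-- The variables, as constant Laurent series. -/
def lv (i : σ) : LaurentSeries k := HahnSeries.C (x i)

omit [DecidableEq σ] [Algebra ℚ k] in
theorem lv_eq : lv x = (HahnSeries.C : k →+* LaurentSeries k) ∘ x := rfl

omit [DecidableEq σ] [Algebra ℚ k] in
theorem S_lv (s : Finset σ) : S (lv x) s = HahnSeries.C (S x s) := by
  rw [lv_eq, S_map]

theorem U_lv (s : Finset σ) : U (lv x) s = PowerSeries.map HahnSeries.C (U x s) := by
  rw [lv_eq, U_map]

/-- The product of the functions marked by `y` on `I` and by `-y` on the complement. -/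
def pairVal (s I : Finset σ) : PowerSeries (LaurentSeries k) :=
  marked yy (lv x) I * marked (-yy) (lv x) (s \ I)

/-- The weight `(y + Σ_I x)(-y + Σ_{s \ I} x)`. -/
def weight (s I : Finset σ) : (LaurentSeries k)ˣ :=
  unitAdd (S x I) * unitSub (S x s - S x I)

/-- The weighted sum `M^c`. -/
def ML (c : ℤ) (s : Finset σ) : PowerSeries (LaurentSeries k) :=
  ∑ I ∈ s.powerset, PowerSeries.C (weight x s I ^ c).val * pairVal x s I

/-- The weighted sum of the functions `T_c`. -/
def MT (c : ℤ) (K s : Finset σ) : PowerSeries (LaurentSeries k) :=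
  ∑ I ∈ s.powerset, PowerSeries.C (TT (fun I => unitAdd (S x I))
    (fun I => unitSub (S x s - S x I)) (fun I => unitAdd (S x I + S x K))
    (fun I => unitSub (S x s - S x I + S x K)) c I) * pairVal x s I

theorem MT_eq (c : ℤ) (K s : Finset σ) : MT x c K s =
    ∑ I ∈ s.powerset, PowerSeries.C
      (unitAdd (S x I + S x K) ^ (c + 1) * unitSub (S x s - S x I) ^ c).val * pairVal x s I +
    ∑ I ∈ s.powerset, PowerSeries.C
      (unitAdd (S x I) ^ c * unitSub (S x s - S x I + S x K) ^ (c + 1)).val * pairVal x s I := by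
  simp only [MT, TT, map_add, add_mul, sum_add_distrib]

theorem ML_eqn (c : ℤ) (s : Finset σ) :
    12 * (theta (ML x c s) + (s.card : PowerSeries (LaurentSeries k)) * ML x c s) =
      12 * ∑ K ∈ s.powerset, U (lv x) K * MT x c K (s \ K) +
      PowerSeries.X * (PowerSeries.C (HahnSeries.C (S x s) ^ 3) * ML x c s -
        3 * PowerSeries.C (HahnSeries.C (S x s)) * ML x (c + 1) s) := by
  set φ := marked yy (lv x) with hφ
  set ψ := marked (-yy) (lv x) with hψ
  have hS : ∀ {I : Finset σ}, I ⊆ s → S x (s \ I) = S x s - S x I := fun {I} h => by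
    rw [S_add x h]; ring
  have key : ∀ I ∈ s.powerset,
      12 * (theta (PowerSeries.C (weight x s I ^ c).val * pairVal x s I) +
        (s.card : PowerSeries (LaurentSeries k)) *
          (PowerSeries.C (weight x s I ^ c).val * pairVal x s I)) =
      12 * (PowerSeries.C (unitAdd (S x I) ^ (c + 1) * unitSub (S x (s \ I)) ^ c).val *
        ((U (lv x) * φ) I * ψ (s \ I))) +
      12 * (PowerSeries.C (unitAdd (S x I) ^ c * unitSub (S x (s \ I)) ^ (c + 1)).val *
        (φ I * (U (lv x) * ψ) (s \ I))) +
      PowerSeries.X * (PowerSeries.C (HahnSeries.C (S x s) ^ 3) *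
        (PowerSeries.C (weight x s I ^ c).val * pairVal x s I) -
        3 * PowerSeries.C (HahnSeries.C (S x s)) *
        (PowerSeries.C (weight x s I ^ (c + 1)).val * pairVal x s I)) := by
    intro I hI
    have hI := mem_powerset.1 hI
    have h1 := marked_eqn yy (lv x) I
    have h2 := marked_eqn (-yy) (lv x) (s \ I)
    rw [S_lv, ← val_unitAdd, ← hφ, mul_comm φ] at h1
    rw [S_lv, ← val_unitSub, ← hψ, mul_comm ψ] at h2
    have hc : (s.card : PowerSeries (LaurentSeries k)) = I.card + (s \ I).card := by
      rw [← Nat.cast_add, add_comm, card_sdiff_add_card_eq_card hI]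
    have h3 : HahnSeries.C (S x s) = (unitAdd (S x I)).val + (unitSub (S x (s \ I))).val := by
      rw [val_unitAdd, val_unitSub, S_add x hI, map_add]
      ring
    rw [weight, pairVal, ← hφ, ← hψ, ← hS hI, hc, h3, mul_zpow, mul_zpow, zpow_add_one, zpow_add_one,
      theta_mul, theta_C, theta_mul]
    simp only [Units.val_mul, map_mul, map_pow, map_add]
    linear_combination PowerSeries.C (unitAdd (S x I) ^ c).val *
      PowerSeries.C (unitSub (S x (s \ I)) ^ c).val * (h1 * ψ (s \ I) + h2 * φ I)
  have e1 : ∑ I ∈ s.powerset, PowerSeries.C (unitAdd (S x I) ^ (c + 1) *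
      unitSub (S x (s \ I)) ^ c).val * ((U (lv x) * φ) I * ψ (s \ I)) =
      ∑ K ∈ s.powerset, U (lv x) K * ∑ I ∈ (s \ K).powerset, PowerSeries.C
        (unitAdd (S x I + S x K) ^ (c + 1) * unitSub (S x (s \ K) - S x I) ^ c).val *
        pairVal x (s \ K) I := by
    have := sum_powerset_powerset (fun K I J => U (lv x) K * (PowerSeries.C
      (unitAdd (S x I + S x K) ^ (c + 1) * unitSub (S x J) ^ c).val * (φ I * ψ J))) s
    refine Eq.trans (Eq.trans ?_ this) ?_
    · refine sum_congr rfl fun I hI => ?_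
      rw [SetFun.mul_apply, sum_mul, mul_sum]
      refine sum_congr rfl fun H hH => ?_
      rw [S_add x (mem_powerset.1 hH), add_comm (S x H)]
      ring
    · refine sum_congr rfl fun K hK => ?_
      rw [mul_sum]
      refine sum_congr rfl fun I hI => ?_
      rw [S_add x (mem_powerset.1 hI), add_sub_cancel_left, pairVal]
  have e2 : ∑ I ∈ s.powerset, PowerSeries.C (unitAdd (S x I) ^ c *
      unitSub (S x (s \ I)) ^ (c + 1)).val * (φ I * (U (lv x) * ψ) (s \ I)) =
      ∑ K ∈ s.powerset, U (lv x) K * ∑ I ∈ (s \ K).powerset, PowerSeries.C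
        (unitAdd (S x I) ^ c * unitSub (S x (s \ K) - S x I + S x K) ^ (c + 1)).val *
        pairVal x (s \ K) I := by
    have := sum_powerset_powerset (fun K I J => U (lv x) K * (PowerSeries.C
      (unitAdd (S x J) ^ c * unitSub (S x I + S x K) ^ (c + 1)).val * (φ J * ψ I))) s
    refine Eq.trans (Eq.trans ?_ this) ?_
    · rw [SetFun.sum_powerset_compl (fun I J => PowerSeries.C (unitAdd (S x I) ^ c *
        unitSub (S x J) ^ (c + 1)).val * (φ I * (U (lv x) * ψ) J))]
      refine sum_congr rfl fun I hI => ?_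
      rw [SetFun.mul_apply, mul_sum, mul_sum]
      refine sum_congr rfl fun H hH => ?_
      rw [S_add x (mem_powerset.1 hH), add_comm (S x H)]
      ring
    · refine sum_congr rfl fun K hK => ?_
      rw [mul_sum, SetFun.sum_powerset_compl (fun I J => U (lv x) K * (PowerSeries.C
        (unitAdd (S x J) ^ c * unitSub (S x I + S x K) ^ (c + 1)).val * (φ J * ψ I)))]
      refine sum_congr rfl fun I hI => ?_
      rw [S_add x (mem_powerset.1 hI), add_sub_cancel_left, pairVal]
  have e3 : ∑ K ∈ s.powerset, U (lv x) K * MT x c K (s \ K) =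
      ∑ K ∈ s.powerset, U (lv x) K * ∑ I ∈ (s \ K).powerset, PowerSeries.C
        (unitAdd (S x I + S x K) ^ (c + 1) * unitSub (S x (s \ K) - S x I) ^ c).val *
        pairVal x (s \ K) I +
      ∑ K ∈ s.powerset, U (lv x) K * ∑ I ∈ (s \ K).powerset, PowerSeries.C
        (unitAdd (S x I) ^ c * unitSub (S x (s \ K) - S x I + S x K) ^ (c + 1)).val *
        pairVal x (s \ K) I := by
    rw [← sum_add_distrib]
    refine sum_congr rfl fun K _ => ?_
    rw [← mul_add, MT_eq]
  rw [e3, ← e1, ← e2]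
  have := sum_congr (rfl : s.powerset = s.powerset) key
  simp only [← mul_sum, sum_add_distrib, sum_sub_distrib, ← theta_sum] at this
  rw [ML, ML]
  linear_combination this

/-- The coefficient form of `ML_eqn`. -/
theorem coeff_ML (c : ℤ) (s : Finset σ) (g : ℕ) :
    ((12 * (2 * g + s.card) : ℕ) : LaurentSeries k) * PowerSeries.coeff g (ML x c s) =
      12 * ∑ K ∈ s.powerset, ∑ p ∈ antidiagonal g,
        HahnSeries.C (PowerSeries.coeff p.1 (U x K)) * PowerSeries.coeff p.2 (MT x c K (s \ K)) +
      PowerSeries.coeff g (PowerSeries.X *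
        (PowerSeries.C (HahnSeries.C (S x s) ^ 3) * ML x c s -
        3 * PowerSeries.C (HahnSeries.C (S x s)) * ML x (c + 1) s)) := by
  have h := congrArg (PowerSeries.coeff g) (ML_eqn x c s)
  rw [map_add, coeff_ofNat_mul, coeff_ofNat_mul, map_add, coeff_theta, coeff_natCast_mul,
    map_sum] at h
  simp only [U_lv, PowerSeries.coeff_mul g (PowerSeries.map _ _), PowerSeries.coeff_map] at h
  rw [← h]
  push_cast
  ring

variable {x}

theorem MT_sub_fil {s : Finset σ} {g : ℕ}
    (H : ∀ c : ℤ, Fil (2 * g + 2 * c) (PowerSeries.coeff g (ML x c s))) (c : ℤ) (K : Finset σ) :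
    Fil (2 * g + 2 * (c - 1)) (PowerSeries.coeff g (MT x c K s) -
      HahnSeries.C (S x s + 2 * (c + 1) * S x K) * PowerSeries.coeff g (ML x c s)) := by
  have hcoef : ∀ F : Finset σ → LaurentSeries k, PowerSeries.coeff g (∑ I ∈ s.powerset,
      PowerSeries.C (F I) * pairVal x s I) =
      ∑ I ∈ s.powerset, F I * PowerSeries.coeff g (pairVal x s I) := by
    intro F
    rw [map_sum]
    exact sum_congr rfl fun I _ => by rw [PowerSeries.coeff_C_mul]
  have H1 : Good s.powerset (fun I => PowerSeries.coeff g (pairVal x s I))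
      (fun I => unitAdd (S x I) * unitSub (S x s - S x I)) (2 * g) 0 1 := by
    intro i
    have := H i
    rw [ML, hcoef] at this
    simp only [Pi.one_apply, one_mul, mul_zero, add_zero]
    exact this
  have H2 := H1.TT (A' := fun I => unitAdd (S x I + S x K))
    (B' := fun I => unitSub (S x s - S x I + S x K)) (a := S x s) (κ := S x K)
    (fun I => fil_unitAdd _) (fun I => fil_unitSub _)
    (fun I => fil_unitAdd_inv _) (fun I => fil_unitSub_inv _)
    (fun I => by rw [val_unitAdd, val_unitSub, map_sub]; ring)
    (fun I => by rw [val_unitAdd, val_unitAdd, map_add]; ring)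
    (fun I => by rw [val_unitSub, val_unitSub, map_add]; ring) c 0
  rw [MT, ML, hcoef, hcoef, mul_sum, ← sum_sub_distrib]
  simp only [zpow_zero, Units.val_one, mul_one, mul_zero, add_zero, sub_mul, mul_assoc] at H2
  simp only [mul_assoc]
  exact H2

theorem ML_empty_zero (c : ℤ) : PowerSeries.coeff 0 (ML x c ∅) = (weight x ∅ ∅ ^ c).val := by
  rw [ML, powerset_empty, sum_singleton, PowerSeries.coeff_C_mul, pairVal, PowerSeries.coeff_mul]
  simp [marked_empty]

theorem MT_fil {s : Finset σ} {g : ℕ}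
    (H : ∀ c : ℤ, Fil (2 * g + 2 * c) (PowerSeries.coeff g (ML x c s))) (c : ℤ) (K : Finset σ) :
    Fil (2 * g + 2 * c) (PowerSeries.coeff g (MT x c K s)) := by
  have h := ((MT_sub_fil H c K).mono (e := 2 * g + 2 * c) (by omega)).add
    ((H c).C_mul (S x s + 2 * (c + 1) * S x K))
  rwa [sub_add_cancel] at h

theorem ML_fil_step {s : Finset σ} (ih : ∀ t, t ⊂ s → ∀ (g : ℕ) (c : ℤ),
    Fil (2 * g + 2 * c) (PowerSeries.coeff g (ML x c t))) (g : ℕ) (c : ℤ)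
    (hpos : 2 * g + s.card ≠ 0)
    (hX : Fil (2 * g + 2 * c) (PowerSeries.coeff g (PowerSeries.X *
        (PowerSeries.C (HahnSeries.C (S x s) ^ 3) * ML x c s -
        3 * PowerSeries.C (HahnSeries.C (S x s)) * ML x (c + 1) s)))) :
    Fil (2 * g + 2 * c) (PowerSeries.coeff g (ML x c s)) := by
  refine Fil.of_natCast_mul (N := 12 * (2 * g + s.card)) (by omega) ?_
  rw [coeff_ML, ← map_ofNat (HahnSeries.C (Γ := ℤ) (R := k)) 12]
  refine Fil.add (Fil.C_mul _ (Fil.sum fun K hK => Fil.sum fun p hp => ?_)) hX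
  rcases K.eq_empty_or_nonempty with rfl | hK'
  · rw [U_empty, map_zero, map_zero, zero_mul]
    exact Fil.zero _
  · have hp := mem_antidiagonal.1 hp
    refine Fil.C_mul _ ((MT_fil (ih _ ?_ p.2) c K).mono (by omega))
    exact sdiff_ssubset (mem_powerset.1 hK) hK'

/-- The coefficients of `M^c` have smaller degree in `y` than expected. -/
theorem ML_fil (s : Finset σ) : ∀ (g : ℕ) (c : ℤ),
    Fil (2 * g + 2 * c) (PowerSeries.coeff g (ML x c s)) := by
  induction s using Finset.strongInduction with
  | H s ih =>
  intro g
  induction g with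
  | zero =>
    intro c
    rcases s.eq_empty_or_nonempty with rfl | hs
    · rw [ML_empty_zero]
      have h := Fil.zpow (u := weight x ∅ ∅) (d := 2)
        (by rw [weight, Units.val_mul]; exact (fil_unitAdd _).mul (fil_unitSub _))
        (by rw [weight, mul_inv, Units.val_mul]
            exact (fil_unitAdd_inv _).mul (fil_unitSub_inv _)) c
      exact h.mono (by simp)
    · refine ML_fil_step ih 0 c (by simpa using hs.ne_empty) ?_
      rw [PowerSeries.coeff_zero_X_mul]
      exact Fil.zero _
  | succ g ihg =>
    intro c
    refine ML_fil_step ih (g + 1) c (by omega) ?_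
    rw [PowerSeries.coeff_succ_X_mul, map_sub, PowerSeries.coeff_C_mul, mul_assoc,
      coeff_ofNat_mul, PowerSeries.coeff_C_mul, ← map_pow,
      ← map_ofNat (HahnSeries.C (Γ := ℤ) (R := k)) 3]
    refine Fil.sub (Fil.C_mul _ ((ihg c).mono ?_))
      (Fil.C_mul _ (Fil.C_mul _ ((ihg (c + 1)).mono ?_))) <;>
    · push_cast
      omega

end

section
variable {σ k : Type*} [CommRing k] [DecidableEq σ] [Algebra ℚ k] (x : σ → k)

/-- The leading coefficient of the genus `g` part of `M^c(s)`. -/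
def mlead (c : ℤ) (g : ℕ) (s : Finset σ) : k :=
  (PowerSeries.coeff g (ML x c s)).coeff (-(2 * g + 2 * c))

omit [DecidableEq σ] [Algebra ℚ k] in
theorem coeff_C_mul_laurent (a : k) (f : LaurentSeries k) (i : ℤ) :
    (HahnSeries.C a * f).coeff i = a * f.coeff i := by
  rw [HahnSeries.C_mul_eq_smul, HahnSeries.coeff_smul, smul_eq_mul]

omit [DecidableEq σ] [Algebra ℚ k] in
theorem coeff_sum_laurent {ι : Type*} (s : Finset ι) (f : ι → LaurentSeries k) (i : ℤ) :
    (∑ j ∈ s, f j).coeff i = ∑ j ∈ s, (f j).coeff i :=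
  map_sum (HahnSeries.coeff.addMonoidHom i) f s

theorem mlead_of_X (c : ℤ) (g : ℕ) (s : Finset σ) (r : k)
    (hr : (PowerSeries.coeff g (PowerSeries.X *
        (PowerSeries.C (HahnSeries.C (S x s) ^ 3) * ML x c s -
        3 * PowerSeries.C (HahnSeries.C (S x s)) * ML x (c + 1) s))).coeff (-(2 * g + 2 * c)) = r) :
    ((12 * (2 * g + s.card) : ℕ) : k) * mlead x c g s =
      12 * ∑ K ∈ s.powerset, PowerSeries.coeff 0 (U x K) *
        ((S x (s \ K) + 2 * (c + 1) * S x K) * mlead x c g (s \ K)) + r := by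
  have h := congrArg (fun f => f.coeff (-(2 * g + 2 * c))) (coeff_ML x c s g)
  simp only [coeff_natCast_mul_laurent, HahnSeries.coeff_add, hr] at h
  rw [mlead, h, ← map_ofNat (HahnSeries.C (Γ := ℤ) (R := k)) 12, coeff_C_mul_laurent,
    coeff_sum_laurent]
  congr 2
  refine sum_congr rfl fun K _ => ?_
  rw [coeff_sum_laurent, sum_eq_single (0, g)]
  · rw [coeff_C_mul_laurent]
    congr 1
    have := MT_sub_fil (x := x) (ML_fil (s \ K) g) c K (-(2 * g + 2 * c)) (by omega)
    rw [HahnSeries.coeff_sub, coeff_C_mul_laurent, sub_eq_zero] at this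
    exact this
  · rintro ⟨a, b⟩ hp hne
    have hp := mem_antidiagonal.1 hp
    have hb : b ≠ g := by
      rintro rfl
      exact hne (by rw [Prod.mk.injEq]; exact ⟨by simpa using hp, rfl⟩)
    rw [coeff_C_mul_laurent, MT_fil (ML_fil (s \ K) b) c K _ (by simp only at hp; omega), mul_zero]
  · intro h
    simp at h

theorem mlead_zero_rec (c : ℤ) (s : Finset σ) :
    ((12 * s.card : ℕ) : k) * mlead x c 0 s =
      12 * ∑ K ∈ s.powerset, PowerSeries.coeff 0 (U x K) *
        ((S x (s \ K) + 2 * (c + 1) * S x K) * mlead x c 0 (s \ K)) := by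
  have := mlead_of_X x c 0 s 0 (by rw [PowerSeries.coeff_zero_X_mul]; rfl)
  simpa only [mul_zero, zero_add, add_zero] using this

theorem mlead_succ_rec (c : ℤ) (g : ℕ) (s : Finset σ) :
    ((12 * (2 * (g + 1) + s.card) : ℕ) : k) * mlead x c (g + 1) s =
      12 * ∑ K ∈ s.powerset, PowerSeries.coeff 0 (U x K) *
        ((S x (s \ K) + 2 * (c + 1) * S x K) * mlead x c (g + 1) (s \ K)) -
      3 * (S x s * mlead x (c + 1) g s) := by
  rw [sub_eq_add_neg]
  refine mlead_of_X x c (g + 1) s _ ?_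
  rw [PowerSeries.coeff_succ_X_mul, map_sub, PowerSeries.coeff_C_mul, mul_assoc,
    coeff_ofNat_mul, PowerSeries.coeff_C_mul, ← map_pow,
    ← map_ofNat (HahnSeries.C (Γ := ℤ) (R := k)) 3, HahnSeries.coeff_sub, coeff_C_mul_laurent,
    coeff_C_mul_laurent, coeff_C_mul_laurent, ML_fil s g c _ (by push_cast; omega), mul_zero,
    zero_sub, mlead]
  congr 5
  push_cast
  ring

theorem mlead_empty (c : ℕ) : mlead x c 0 ∅ = (-1) ^ c := by
  have h : (weight x ∅ ∅).val = HahnSeries.single (-2) (-1) := by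
    rw [weight, Units.val_mul, val_unitAdd, val_unitSub]
    simp [yy]
  rw [mlead, ML_empty_zero, zpow_natCast, Units.val_pow_eq_pow_val, h, HahnSeries.single_pow]
  have : c • (-2 : ℤ) = -(2 * ((0 : ℕ) : ℤ) + 2 * (c : ℤ)) := by simp; ring
  rw [this, HahnSeries.coeff_single_same]

end

section
variable {σ : Type*}

/-- The total degree in the variables in `T` is at most `n`. -/
def Deg (T : Finset σ) (n : ℕ) (f : MvPolynomial σ ℚ) : Prop :=
  ∀ d, MvPolynomial.coeff d f ≠ 0 → ∑ i ∈ T, d i ≤ n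

variable {T : Finset σ} {m n : ℕ} {f g : MvPolynomial σ ℚ}

theorem Deg.mono (hf : Deg T m f) (h : m ≤ n) : Deg T n f := fun d hd => (hf d hd).trans h

theorem Deg.zero : Deg T n 0 := fun d hd => absurd (MvPolynomial.coeff_zero d) hd

theorem Deg.add (hf : Deg T n f) (hg : Deg T n g) : Deg T n (f + g) := fun d hd => by
  rw [MvPolynomial.coeff_add] at hd
  by_cases h : MvPolynomial.coeff d f = 0
  · exact hg d (by rwa [h, zero_add] at hd)
  · exact hf d h

theorem Deg.neg (hf : Deg T n f) : Deg T n (-f) := fun d hd =>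
  hf d (by rwa [MvPolynomial.coeff_neg, neg_ne_zero] at hd)

theorem Deg.sub (hf : Deg T n f) (hg : Deg T n g) : Deg T n (f - g) := by
  rw [sub_eq_add_neg]
  exact hf.add hg.neg

theorem Deg.sum {ι : Type*} {s : Finset ι} {f : ι → MvPolynomial σ ℚ}
    (h : ∀ i ∈ s, Deg T n (f i)) : Deg T n (∑ i ∈ s, f i) :=
  Finset.sum_induction f (Deg T n) (fun _ _ => Deg.add) Deg.zero h

theorem Deg.mul (hf : Deg T m f) (hg : Deg T n g) : Deg T (m + n) (f * g) := fun d hd => by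
  classical
  rw [MvPolynomial.coeff_mul] at hd
  obtain ⟨p, hp, h⟩ := exists_ne_zero_of_sum_ne_zero hd
  have := mem_antidiagonal.1 hp
  rw [← this]
  simp only [Finsupp.add_apply, sum_add_distrib]
  exact add_le_add (hf _ (left_ne_zero_of_mul h)) (hg _ (right_ne_zero_of_mul h))

theorem Deg.C (a : ℚ) : Deg T 0 (MvPolynomial.C a : MvPolynomial σ ℚ) := fun d hd => by
  classical
  rw [MvPolynomial.coeff_C] at hd
  have : d = 0 := by
    by_contra h
    rw [if_neg (Ne.symm h)] at hd
    exact hd rfl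
  simp [this]

theorem Deg.intCast (a : ℤ) : Deg T 0 (a : MvPolynomial σ ℚ) := by
  rw [← map_intCast (MvPolynomial.C (R := ℚ) (σ := σ))]
  exact Deg.C _

theorem Deg.natCast_mul (N : ℕ) (h : Deg T n f) : Deg T n ((N : MvPolynomial σ ℚ) * f) := by
  simpa using (Deg.intCast (T := T) N).mul h

theorem Deg.of_natCast_mul {N : ℕ} (hN : N ≠ 0) (h : Deg T n ((N : MvPolynomial σ ℚ) * f)) :
    Deg T n f := fun d hd => h d <| by
  rw [← map_natCast (MvPolynomial.C (R := ℚ) (σ := σ)), MvPolynomial.coeff_C_mul]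
  exact mul_ne_zero (by exact_mod_cast hN) hd

theorem Deg.X_of_notMem {i : σ} (hi : i ∉ T) : Deg T 0 (MvPolynomial.X i : MvPolynomial σ ℚ) :=
  fun d hd => by
    classical
    rw [MvPolynomial.coeff_X] at hd
    have : d = Finsupp.single i 1 := by
      by_contra h
      rw [if_neg (Ne.symm h)] at hd
      exact hd rfl
    rw [this, Nat.le_zero, sum_eq_zero_iff]
    intro j hj
    rw [Finsupp.single_apply, if_neg]
    rintro rfl
    exact hi hj

theorem Deg.X (i : σ) : Deg T 1 (MvPolynomial.X i : MvPolynomial σ ℚ) := fun d hd => by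
  classical
  rw [MvPolynomial.coeff_X] at hd
  have : d = Finsupp.single i 1 := by
    by_contra h
    rw [if_neg (Ne.symm h)] at hd
    exact hd rfl
  rw [this]
  simp only [Finsupp.single_apply]
  rw [sum_ite_eq]
  split_ifs <;> omega

theorem Deg.S (J : Finset σ) : Deg T 1 (S (MvPolynomial.X : σ → MvPolynomial σ ℚ) J) :=
  Deg.sum fun i _ => Deg.X i

theorem Deg.S_of_disjoint {J : Finset σ} (h : Disjoint J T) :
    Deg T 0 (Faber.S (MvPolynomial.X : σ → MvPolynomial σ ℚ) J) :=
  Deg.sum fun _ hi => Deg.X_of_notMem (disjoint_left.1 h hi)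

variable [DecidableEq σ]

theorem deg_U_zero (T K : Finset σ) :
    (Disjoint K T → Deg T 0 (PowerSeries.coeff 0 (U (MvPolynomial.X : σ → MvPolynomial σ ℚ) K))) ∧
    Deg T (K.card - 1) (PowerSeries.coeff 0 (U (MvPolynomial.X : σ → MvPolynomial σ ℚ) K)) := by
  induction K using Finset.strongInduction with
  | H K ih =>
  rcases Nat.lt_trichotomy K.card 1 with h | h | h
  · rw [Nat.lt_one_iff, card_eq_zero] at h
    subst h
    simp [Deg.zero]
  · obtain ⟨i, rfl⟩ := card_eq_one.1 h
    have := (isU_U (MvPolynomial.X : σ → MvPolynomial σ ℚ)).const_singleton i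
    rw [PowerSeries.coeff_zero_eq_constantCoeff_apply, this]
    have h1 := Deg.intCast (T := T) 1
    rw [Int.cast_one] at h1
    exact ⟨fun _ => h1, h1.mono (by simp)⟩
  · have h1 := eqn_coeff_zero (isU_U (MvPolynomial.X : σ → MvPolynomial σ ℚ)) K
    have h2 : ((12 * (K.card - 1) : ℕ) : MvPolynomial σ ℚ) * PowerSeries.coeff 0
        (U (MvPolynomial.X : σ → MvPolynomial σ ℚ) K) =
        ((6 : ℕ) : MvPolynomial σ ℚ) * (Faber.S MvPolynomial.X K * PowerSeries.coeff 0
          ((U (MvPolynomial.X : σ → MvPolynomial σ ℚ) *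
            U (MvPolynomial.X : σ → MvPolynomial σ ℚ) : SetFun σ _) K)) := by
      rw [← mul_assoc]
      push_cast [Nat.cast_sub h.le]
      exact h1
    have h3 : PowerSeries.coeff 0
          ((U (MvPolynomial.X : σ → MvPolynomial σ ℚ) *
            U (MvPolynomial.X : σ → MvPolynomial σ ℚ) : SetFun σ _) K) =
        ∑ I ∈ K.powerset, PowerSeries.coeff 0 (U (MvPolynomial.X : σ → MvPolynomial σ ℚ) I) *
          PowerSeries.coeff 0 (U (MvPolynomial.X : σ → MvPolynomial σ ℚ) (K \ I)) := by
      rw [SetFun.mul_apply, map_sum]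
      refine sum_congr rfl fun I _ => ?_
      rw [PowerSeries.coeff_mul]
      simp
    have hI : ∀ I ∈ K.powerset, (I = ∅ ∨ K \ I = ∅) ∨ (I ⊂ K ∧ K \ I ⊂ K ∧ I ≠ ∅ ∧ K \ I ≠ ∅) := by
      intro I hI
      have hI := mem_powerset.1 hI
      by_cases h1 : I = ∅
      · exact Or.inl (Or.inl h1)
      by_cases h2 : K \ I = ∅
      · exact Or.inl (Or.inr h2)
      refine Or.inr ⟨⟨hI, fun h => h2 (sdiff_eq_empty_iff_subset.2 h)⟩, ?_, h1, h2⟩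
      exact sdiff_ssubset hI (nonempty_iff_ne_empty.2 h1)
    constructor
    · intro hd
      refine Deg.of_natCast_mul (N := 12 * (K.card - 1)) (by omega) ?_
      rw [h2, h3]
      refine Deg.natCast_mul _ (Deg.mul (m := 0) (n := 0) (Deg.S_of_disjoint hd)
        (Deg.sum fun I hIK => ?_))
      rcases hI I hIK with (h | h) | ⟨h1, h2, -, -⟩
      · simp [h, Deg.zero]
      · simp [h, Deg.zero]
      · exact Deg.mul (m := 0) (n := 0) ((ih I h1).1 (disjoint_of_subset_left h1.1 hd))
          ((ih _ h2).1 (disjoint_of_subset_left h2.1 hd))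
    · refine Deg.of_natCast_mul (N := 12 * (K.card - 1)) (by omega) ?_
      rw [h2, h3]
      refine Deg.natCast_mul _ (Deg.mono (m := 1 + (K.card - 2)) (Deg.mul (Deg.S K)
        (Deg.sum fun I hIK => ?_)) (by omega))
      rcases hI I hIK with (h | h) | ⟨h1, h2, h3, h4⟩
      · simp [h, Deg.zero]
      · simp [h, Deg.zero]
      · refine ((ih I h1).2.mul (ih _ h2).2).mono ?_
        have := card_sdiff_add_card_eq_card h1.1
        have := card_pos.2 (nonempty_iff_ne_empty.2 h3)
        have := card_pos.2 (nonempty_iff_ne_empty.2 h4)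
        omega

theorem deg_mlead {T s : Finset σ} (h : Disjoint s T) : ∀ (g : ℕ) (c : ℕ),
    Deg T 0 (mlead (MvPolynomial.X : σ → MvPolynomial σ ℚ) c g s) := by
  induction s using Finset.strongInduction with
  | H s ih =>
  have hK : ∀ (c g : ℕ), ∀ K ∈ s.powerset, Deg T 0 (PowerSeries.coeff 0 (U (MvPolynomial.X : σ → MvPolynomial σ ℚ) K) *
      ((Faber.S MvPolynomial.X (s \ K) + 2 * (((c : ℤ) : MvPolynomial σ ℚ) + 1) *
      Faber.S MvPolynomial.X K) *
      mlead (MvPolynomial.X : σ → MvPolynomial σ ℚ) c g (s \ K))) := by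
    intro c g K hK
    rcases K.eq_empty_or_nonempty with rfl | hKne
    · simp [Deg.zero]
    have hK := mem_powerset.1 hK
    have hd := disjoint_of_subset_left hK h
    have hd' := disjoint_of_subset_left (sdiff_subset (s := s) (t := K)) h
    refine Deg.mul (m := 0) (n := 0) ((deg_U_zero T K).1 hd) (Deg.mul (m := 0) (n := 0)
      (Deg.add (Deg.S_of_disjoint hd') (Deg.mul (m := 0) (n := 0) ?_ (Deg.S_of_disjoint hd)))
      (ih _ (sdiff_ssubset hK hKne) hd' g c))
    have := Deg.intCast (T := T) (2 * ((c : ℤ) + 1))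
    push_cast at this ⊢
    exact this
  intro g
  induction g with
  | zero =>
    intro c
    rcases s.eq_empty_or_nonempty with rfl | hs
    · rw [mlead_empty]
      have := Deg.intCast (T := T) ((-1) ^ c)
      push_cast at this
      exact this
    · refine Deg.of_natCast_mul (N := 12 * s.card) (by simpa using hs.ne_empty) ?_
      rw [mlead_zero_rec]
      exact Deg.natCast_mul 12 (Deg.sum (hK c 0))
  | succ g ihg =>
    intro c
    refine Deg.of_natCast_mul (N := 12 * (2 * (g + 1) + s.card)) (by omega) ?_
    rw [mlead_succ_rec]
    refine Deg.sub (Deg.natCast_mul 12 (Deg.sum (hK c (g + 1)))) (Deg.natCast_mul 3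
      (Deg.mul (m := 0) (n := 0) (Deg.S_of_disjoint h) ?_))
    exact_mod_cast ihg (c + 1)

end

section
variable {σ A : Type*} [CommRing A] [DecidableEq σ] [Algebra ℚ A]

omit [Algebra ℚ A] in
theorem dE_dS (x : σ → A) (f : SetFun σ (PowerSeries A)) : dE (dS x f) = dS x (dE f) := by
  ext s : 1
  rw [dE_apply, dS_apply, dS_apply, dE_apply, theta_mul, theta_C]
  ring

/-- Multiplication by a constant, as an element of the convolution ring. -/
def cst (a : PowerSeries A) : SetFun σ (PowerSeries A) := ⟨fun s => if s = ∅ then a else 0⟩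

omit [Algebra ℚ A] in
theorem cst_mul_apply (a : PowerSeries A) (f : SetFun σ (PowerSeries A)) (s : Finset σ) :
    (cst a * f : SetFun σ (PowerSeries A)) s = a * f s := by
  rw [SetFun.mul_apply, Finset.sum_eq_single ∅]
  · simp [cst]
  · intro b _ hb
    simp [cst, hb]
  · simp

omit [Algebra ℚ A] in
theorem dS_cst_mul (x : σ → A) (a : PowerSeries A) (f : SetFun σ (PowerSeries A)) :
    dS x (cst a * f) = cst a * dS x f := by
  ext s : 1
  rw [dS_apply, cst_mul_apply, cst_mul_apply, dS_apply]
  ring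

omit [Algebra ℚ A] in
theorem dE_cst_mul (a : A) (f : SetFun σ (PowerSeries A)) :
    dE (cst (PowerSeries.C a) * f) = cst (PowerSeries.C a) * dE f := by
  ext s : 1
  rw [dE_apply, cst_mul_apply, cst_mul_apply, dE_apply, theta_mul, theta_C]
  ring

omit [Algebra ℚ A] in
theorem dS_tau_mul (x : σ → A) (f : SetFun σ (PowerSeries A)) :
    dS x (tau * f) = tau * dS x f := by
  ext s : 1
  rw [dS_apply, tau_mul_apply, tau_mul_apply, dS_apply]
  ring

/-- The right hand side of the dilaton equation satisfies the equation of the left hand side. -/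
theorem dilaton_aux (x : σ → A) (ε : A) (hε : ε ^ 2 = 0) (W : SetFun σ (PowerSeries A))
    (hW : W = dS x (U x) + cst (PowerSeries.C ε) * dE (U x) + 1) :
    12 * dE W = 12 * (dS x (W * U x) + cst (PowerSeries.C ε) * (W * U x)) +
      tau * (dS x (dS x (dS x W)) + 3 * (cst (PowerSeries.C ε) * dS x (dS x W))) := by
  set u := U x
  set e : SetFun σ (PowerSeries A) := cst (PowerSeries.C ε)
  have h1 := ((isU_iff x u).1 (isU_U x)).1
  have he : e * e = 0 := by
    ext s : 1
    rw [cst_mul_apply, SetFun.zero_apply]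
    simp only [e, cst, SetFun.mk_apply]
    split_ifs
    · rw [← map_mul, ← pow_two, hε, map_zero]
    · rw [mul_zero]
  have h2 := congrArg (dS x) h1
  have h3 := congrArg dE h1
  have d1 : ∀ f, dS x (e * f) = e * dS x f := dS_cst_mul x _
  have d2 : ∀ f, dE (e * f) = e * dE f := dE_cst_mul ε
  have n12 : ∀ D : Derivation ℤ (SetFun σ (PowerSeries A)) (SetFun σ (PowerSeries A)), D 12 = 0 :=
    fun D => by simpa using D.map_natCast 12
  have n6 : ∀ D : Derivation ℤ (SetFun σ (PowerSeries A)) (SetFun σ (PowerSeries A)), D 6 = 0 :=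
    fun D => by simpa using D.map_natCast 6
  have s1 : dS x (u * u) = 2 * (u * dS x u) := by
    rw [Derivation.leibniz, smul_eq_mul]; ring
  have s2 : dE (u * u) = 2 * (u * dE u) := by
    rw [Derivation.leibniz, smul_eq_mul]; ring
  have m12 : ∀ (D : Derivation ℤ (SetFun σ (PowerSeries A)) (SetFun σ (PowerSeries A))) f,
      D (12 * f) = 12 * D f := fun D f => by
    rw [Derivation.leibniz, n12, smul_zero, add_zero, smul_eq_mul]
  have m6 : ∀ (D : Derivation ℤ (SetFun σ (PowerSeries A)) (SetFun σ (PowerSeries A))) f,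
      D (6 * f) = 6 * D f := fun D f => by
    rw [Derivation.leibniz, n6, smul_zero, add_zero, smul_eq_mul]
  have m2 : ∀ (D : Derivation ℤ (SetFun σ (PowerSeries A)) (SetFun σ (PowerSeries A))) f,
      D (2 * f) = 2 * D f := fun D f => by
    have : D 2 = 0 := by simpa using D.map_natCast 2
    rw [Derivation.leibniz, this, smul_zero, add_zero, smul_eq_mul]
  simp only [map_add, m12, m6, dS_tau_mul, dE_tau_mul, dE_dS, s2, m2] at h1 h2 h3
  rw [s1, m2] at h2
  rw [s1] at h1
  simp only [hW, map_add, Derivation.map_one_eq_zero, add_zero, dE_dS, d1, d2, add_mul, one_mul,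
    mul_assoc e]
  rw [mul_comm (dS x u) u, mul_comm (dE u) u]
  linear_combination h2 + e * h3 + e * h1 + (- 12 * (u * dE u) - 3 * tau * dS x (dS x (dE u))) * he

/-- The dilaton equation. -/
theorem U_dilaton (x : σ → A) {j : σ} (hj : x j ^ 2 = 0) {s : Finset σ} (hs : j ∉ s) :
    U x (insert j s) = PowerSeries.C (S x s) * U x s +
      PowerSeries.C (x j) * (theta (U x s) + (s.card : PowerSeries A) * U x s) +
      if s = ∅ then 1 else 0 := by
  set u := U x with hu
  set e : SetFun σ (PowerSeries A) := cst (PowerSeries.C (x j)) with he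
  set W := dS x u + e * dE u + 1 with hW
  have hWs : ∀ s, W s = PowerSeries.C (S x s) * u s +
      PowerSeries.C (x j) * (theta (u s) + (s.card : PowerSeries A) * u s) +
      if s = ∅ then 1 else 0 := fun s => by
    rw [hW, SetFun.add_apply, SetFun.add_apply, cst_mul_apply, dS_apply, dE_apply,
      SetFun.one_apply]
  rw [← hWs]
  have hc : PowerSeries.C (x j) ^ 2 = 0 := by rw [← map_pow, hj, map_zero]
  have hWe : ∀ s, 12 * (theta (W s) + (s.card : PowerSeries A) * W s) =
      12 * PowerSeries.C (x j + S x s) * (W * u) s +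
      PowerSeries.X * PowerSeries.C (x j + S x s) ^ 3 * W s := fun s => by
    have h := congrArg (fun f : SetFun σ (PowerSeries A) => f s) (dilaton_aux x (x j) hj W hW)
    simp only [SetFun.add_apply, SetFun.ofNat_mul_apply, tau_mul_apply, cst_mul_apply,
      dS_apply, dE_apply] at h
    rw [h, map_add]
    linear_combination (-PowerSeries.X * W s * (3 * PowerSeries.C (S x s) +
      PowerSeries.C (x j))) * hc
  induction s using Finset.strongInduction with
  | H s ih =>
  have hV := (isU_U x).eqn (insert j s)
  rw [card_insert_of_notMem hs, S_insert _ hs, SetFun.mul_insert _ _ hs, ← hu,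
    SetFun.sum_powerset_compl (fun I J => u I * u (insert j J))] at hV
  have hsum : ∀ F : Finset σ → PowerSeries A, (∀ I, I ⊂ s → F I = W I) →
      ∑ I ∈ s.powerset, F I * u (s \ I) = (W * u) s := fun F hF => by
    rw [SetFun.mul_apply]
    refine sum_congr rfl fun I hI => ?_
    rcases (mem_powerset.1 hI).eq_or_ssubset with rfl | h
    · rw [sdiff_self, bot_eq_empty, hu, U_empty, mul_zero, mul_zero]
    · rw [hF I h]
  rw [hsum (fun I => u (insert j I)) (fun I hI => ih I hI fun h => hs (hI.1 h))] at hV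
  rw [sum_congr rfl fun I _ => mul_comm (u (s \ I)) (u (insert j I)),
    hsum (fun I => u (insert j I)) (fun I hI => ih I hI fun h => hs (hI.1 h))] at hV
  have h3 := hWe s
  refine sub_eq_zero.1 (eq_zero_of_theta (k := s.card) (b := PowerSeries.C (x j + S x s) ^ 3)
    (fun h0 => ?_) ?_)
  · rw [card_eq_zero] at h0
    subst h0
    rw [hWs, map_sub, if_pos rfl, hu, U_empty, PowerSeries.coeff_zero_eq_constantCoeff_apply,
      insert_empty, (isU_U x).const_singleton]
    simp [theta]
  · have : theta (u (insert j s) - W s) = theta (u (insert j s)) - theta (W s) := by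
      rw [eq_sub_iff_add_eq, ← theta_add, sub_add_cancel]
    rw [this]
    push_cast at hV
    linear_combination hV - h3

theorem marked_dilaton (y : A) (x : σ → A) {j : σ} (hj : x j ^ 2 = 0) {s : Finset σ}
    (hs : j ∉ s) : marked y x (insert j s) = PowerSeries.C (y + S x s) * marked y x s +
      PowerSeries.C (x j) * (theta (marked y x s) + (s.card + 1 : PowerSeries A) * marked y x s) := by
  have h := U_dilaton (addVar y x) (j := some j) (s := insertNone s) hj (by simpa using hs)
  have h1 : insert (some j) (insertNone s) = insertNone (insert j s) := by
    ext a; cases a <;> simp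
  rw [h1, S_addVar, card_insertNone, if_neg (by simp [SetFun.insertNone_eq]), add_zero] at h
  push_cast at h
  exact h

/-- The functions `M^c` for natural exponents over a general ring. -/
def WS (y : A) (x : σ → A) (c : ℕ) (s : Finset σ) : PowerSeries A :=
  ∑ I ∈ s.powerset, PowerSeries.C ((y + S x I) ^ c * (-y + S x (s \ I)) ^ c) *
    (marked y x I * marked (-y) x (s \ I))

omit [Algebra ℚ A] in
theorem add_pow_mul_of_sq {ε : A} (hε : ε ^ 2 = 0) (a : A) (c : ℕ) :
    (ε + a) ^ c * ε = a ^ c * ε ∧ (ε + a) ^ c * a = a ^ c * (a + c * ε) := by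
  induction c with
  | zero => simp
  | succ c ih =>
    constructor
    · rw [pow_succ, pow_succ]
      linear_combination a * ih.1 + (ε + a) ^ c * hε
    · rw [pow_succ, pow_succ]
      push_cast
      linear_combination a * ih.2 + a * ih.1

theorem WS_dilaton (y : A) (x : σ → A) (c : ℕ) {j : σ} (hj : x j ^ 2 = 0) {s : Finset σ}
    (hs : j ∉ s) : WS y x c (insert j s) = PowerSeries.C (S x s) * WS y x c s +
      PowerSeries.C (x j) * (theta (WS y x c s) +
        (s.card + 2 + 2 * c : PowerSeries A) * WS y x c s) := by
  rw [WS, sum_powerset_insert hs, WS, mul_sum, theta_sum, mul_sum, ← sum_add_distrib,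
    ← sum_add_distrib, mul_sum, ← sum_add_distrib]
  refine sum_congr rfl fun I hI => ?_
  have hI := mem_powerset.1 hI
  have hjI : j ∉ I := fun h => hs (hI h)
  have hjJ : j ∉ s \ I := fun h => hs (sdiff_subset h)
  have hcard : (s.card : PowerSeries A) = I.card + (s \ I).card := by
    rw [← Nat.cast_add, add_comm, card_sdiff_add_card_eq_card hI]
  rw [insert_sdiff_of_notMem _ hjI, insert_sdiff_insert, sdiff_insert_of_notMem hs,
    marked_dilaton _ _ hj hjI, marked_dilaton _ _ hj hjJ, S_insert _ hjI, S_insert _ hjJ, hcard,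
    S_add x hI, theta_mul, theta_C, theta_mul, add_left_comm y, add_left_comm (-y)]
  have hε : PowerSeries.C (x j) ^ 2 = 0 := by rw [← map_pow, hj, map_zero]
  set φ := marked y x I
  set ψ := marked (-y) x (s \ I)
  have hS : PowerSeries.C (S x I + S x (s \ I)) =
      PowerSeries.C (y + S x I) + PowerSeries.C (-y + S x (s \ I)) := by
    rw [← map_add]
    congr 1
    ring
  rw [hS]
  simp only [map_mul, map_pow]
  rw [map_add PowerSeries.C (x j) (y + S x I), map_add PowerSeries.C (x j) (-y + S x (s \ I))]
  obtain ⟨p1, p2⟩ := add_pow_mul_of_sq hε (PowerSeries.C (y + S x I)) c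
  obtain ⟨q1, q2⟩ := add_pow_mul_of_sq hε (PowerSeries.C (-y + S x (s \ I))) c
  linear_combination PowerSeries.C (y + S x I) ^ c * φ * (ψ * q2 +
    (theta ψ + ((s \ I).card + 1 : PowerSeries A) * ψ) * q1) +
    PowerSeries.C (-y + S x (s \ I)) ^ c * ψ * (φ * p2 +
    (theta φ + (I.card + 1 : PowerSeries A) * φ) * p1)

end

section
variable {σ A : Type*} [CommRing A] [DecidableEq σ] [Algebra ℚ A]

theorem WS_map {B : Type*} [CommRing B] [Algebra ℚ B] (f : A →+* B) (y : A) (x : σ → A) (c : ℕ)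
    (s : Finset σ) : WS (f y) (f ∘ x) c s = PowerSeries.map f (WS y x c s) := by
  simp only [WS, map_sum, map_mul, PowerSeries.map_C, map_pow, map_add, map_neg, ← marked_map]
  simp only [S_map, ← map_neg]

theorem WS_dilaton_dvd (y : A) (x : σ → A) (c : ℕ) {j : σ} {s : Finset σ} (hs : j ∉ s) (g : ℕ) :
    x j ^ 2 ∣ PowerSeries.coeff g (WS y x c (insert j s)) -
      (S x s + ((2 * g + s.card + 2 + 2 * c : ℕ) : A) * x j) * PowerSeries.coeff g (WS y x c s) := by
  set q := Ideal.Quotient.mk (Ideal.span {x j ^ 2}) with hq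
  have hj : (q ∘ x) j ^ 2 = 0 := by
    rw [Function.comp_apply, ← map_pow]
    exact Ideal.Quotient.eq_zero_iff_mem.2 (Ideal.mem_span_singleton_self _)
  have h := congrArg (PowerSeries.coeff g) (WS_dilaton (q y) (q ∘ x) c hj hs)
  rw [WS_map, WS_map, S_map, PowerSeries.coeff_map, map_add, PowerSeries.coeff_C_mul,
    PowerSeries.coeff_C_mul, PowerSeries.coeff_map, map_add, coeff_theta, PowerSeries.coeff_map] at h
  have h2 : (s.card + 2 + 2 * c : PowerSeries (A ⧸ Ideal.span {x j ^ 2})) =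
    ((s.card + 2 + 2 * c : ℕ) : PowerSeries _) := by push_cast; rfl
  rw [h2, coeff_natCast_mul, PowerSeries.coeff_map] at h
  rw [← Ideal.mem_span_singleton, ← Ideal.Quotient.eq_zero_iff_mem, ← hq, map_sub, h]
  simp only [map_mul, map_add, map_natCast, Function.comp_apply]
  push_cast
  ring

end

section
variable {σ k : Type*} [CommRing k] [DecidableEq σ] [Algebra ℚ k] (x : σ → k)

theorem ML_eq_WS (c : ℕ) (s : Finset σ) : ML x c s = WS yy (lv x) c s := by
  rw [ML, WS]
  refine sum_congr rfl fun I hI => ?_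
  rw [pairVal]
  congr 2
  rw [S_lv, S_lv, weight, zpow_natCast, Units.val_pow_eq_pow_val, Units.val_mul, mul_pow,
    val_unitAdd, val_unitSub, S_add x (mem_powerset.1 hI), add_sub_cancel_left]

theorem mlead_dilaton_dvd (c : ℕ) {j : σ} {s : Finset σ} (hs : j ∉ s) (g : ℕ) :
    x j ^ 2 ∣ mlead x c g (insert j s) -
      (S x s + ((2 * g + s.card + 2 + 2 * c : ℕ) : k) * x j) * mlead x c g s := by
  obtain ⟨r, hr⟩ := WS_dilaton_dvd yy (lv x) c hs g
  rw [← ML_eq_WS, ← ML_eq_WS, S_lv, lv, ← map_natCast (HahnSeries.C (Γ := ℤ) (R := k)), ← map_mul,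
    ← map_add, ← map_pow] at hr
  have := congrArg (fun f => f.coeff (-(2 * g + 2 * (c : ℤ)))) hr
  rw [HahnSeries.coeff_sub, coeff_C_mul_laurent, coeff_C_mul_laurent] at this
  exact ⟨_, this⟩

end

section
variable {σ : Type*} [DecidableEq σ]

omit [DecidableEq σ] in
theorem coeff_of_sq_dvd {j : σ} {N : ℕ} {a f h : MvPolynomial σ ℚ}
    (hf : MvPolynomial.X j ^ 2 ∣ f - (a + (N : MvPolynomial σ ℚ) * MvPolynomial.X j) * h)
    (ha : Deg {j} 0 a) (hh : Deg {j} 0 h) {d : σ →₀ ℕ} (hd : d j = 0) :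
    MvPolynomial.coeff (d + Finsupp.single j 1) f = N * MvPolynomial.coeff d h := by
  obtain ⟨r, hr⟩ := hf
  have h1 := congrArg (MvPolynomial.coeff (d + Finsupp.single j 1)) hr
  rw [add_mul, MvPolynomial.coeff_sub, MvPolynomial.coeff_add, mul_assoc, mul_comm (MvPolynomial.X j) h,
    ← map_natCast (MvPolynomial.C (R := ℚ) (σ := σ)), MvPolynomial.coeff_C_mul,
    MvPolynomial.coeff_mul_X] at h1
  have h2 : MvPolynomial.coeff (d + Finsupp.single j 1) (a * h) = 0 := by
    by_contra h0
    have := ha.mul hh _ h0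
    simp [hd] at this
  have h3 : MvPolynomial.coeff (d + Finsupp.single j 1) (MvPolynomial.X j ^ 2 * r) = 0 := by
    rw [← pow_one (MvPolynomial.X j), ← pow_mul, MvPolynomial.X_pow_eq_monomial,
      MvPolynomial.coeff_monomial_mul', if_neg]
    intro hle
    have := hle j
    simp [hd] at this
  rw [h2, h3, zero_add] at h1
  linear_combination h1

/-- The product of the double factorials `(2 d_i - 1)!!`. -/
def dfp (s : Finset σ) (d : σ →₀ ℕ) : ℚ := ∏ i ∈ s, ((2 * d i - 1).doubleFactorial : ℚ)

theorem dfp_add_single {s : Finset σ} {j : σ} (hj : j ∈ s) (d : σ →₀ ℕ) (hd : 1 ≤ d j) :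
    dfp s (d + Finsupp.single j 1) = (2 * d j + 1) * dfp s d := by
  rw [dfp, dfp, ← mul_prod_erase _ _ hj, ← mul_prod_erase _ _ hj, ← mul_assoc]
  congr 1
  · have : 2 * (d + Finsupp.single j 1 : σ →₀ ℕ) j - 1 = (2 * d j - 1) + 2 := by simp; omega
    rw [this, Nat.doubleFactorial_add_two]
    push_cast [Nat.cast_sub (show 1 ≤ 2 * d j by omega)]
    ring
  · refine prod_congr rfl fun i hi => ?_
    simp [(ne_of_mem_erase hi).symm]

theorem dfp_insert_one {s : Finset σ} {j : σ} (hj : j ∉ s) (d : σ →₀ ℕ) (hd : d j = 0) :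
    dfp (insert j s) (d + Finsupp.single j 1) = dfp s d := by
  rw [dfp, prod_insert hj, dfp]
  simp only [Finsupp.add_apply, hd, Finsupp.single_eq_same]
  simp only [zero_add, mul_one, Nat.add_one_sub_one, Nat.doubleFactorial, Nat.cast_one, one_mul]
  refine prod_congr rfl fun i hi => ?_
  rw [Finsupp.single_eq_of_ne (ne_of_mem_of_not_mem hi hj), add_zero]

theorem sum_add_single {s : Finset σ} {j : σ} (hj : j ∈ s) (d : σ →₀ ℕ) :
    ∑ i ∈ s, (d + Finsupp.single j 1 : σ →₀ ℕ) i = ∑ i ∈ s, d i + 1 := by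
  simp [sum_add_distrib, Finsupp.single_apply, hj]

theorem sum_add_single_of_notMem {s : Finset σ} {j : σ} (hj : j ∉ s) (d : σ →₀ ℕ) :
    ∑ i ∈ s, (d + Finsupp.single j 1 : σ →₀ ℕ) i = ∑ i ∈ s, d i := by
  simp [sum_add_distrib, Finsupp.single_apply, hj]

omit [DecidableEq σ] in
theorem exists_add_single {d : σ →₀ ℕ} {j : σ} (h : 1 ≤ d j) :
    ∃ e : σ →₀ ℕ, d = e + Finsupp.single j 1 :=
  ⟨d - Finsupp.single j 1, (tsub_add_cancel_of_le (Finsupp.single_le_iff.2 h)).symm⟩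

theorem coeff_S_mul {s : Finset σ} (f : MvPolynomial σ ℚ) (d : σ →₀ ℕ) :
    MvPolynomial.coeff d (S MvPolynomial.X s * f) =
      ∑ j ∈ s, if d j = 0 then 0 else MvPolynomial.coeff (d - Finsupp.single j 1) f := by
  rw [S, sum_mul, MvPolynomial.coeff_sum]
  refine sum_congr rfl fun j _ => ?_
  rw [MvPolynomial.coeff_X_mul']
  by_cases h : d j = 0 <;> simp [h]

theorem mlead_dilaton (c g : ℕ) {j : σ} {s : Finset σ} (hs : j ∉ s) {d : σ →₀ ℕ} (hd : d j = 0) :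
    MvPolynomial.coeff (d + Finsupp.single j 1) (mlead MvPolynomial.X c g (insert j s)) =
      ((2 * g + s.card + 2 + 2 * c : ℕ) : ℚ) * MvPolynomial.coeff d (mlead MvPolynomial.X c g s) :=
  coeff_of_sq_dvd (mlead_dilaton_dvd _ c hs g)
    (Deg.S_of_disjoint (disjoint_singleton_right.2 hs)) (deg_mlead (disjoint_singleton_right.2 hs) g c) hd

theorem coeff_U_mul_eq_zero {K : Finset σ} (hK : K.Nonempty) {f : MvPolynomial σ ℚ} {d : σ →₀ ℕ} {m : ℕ}
    (hf : Deg K m f) (hd : K.card + m ≤ ∑ i ∈ K, d i) :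
    MvPolynomial.coeff d (PowerSeries.coeff 0 (U MvPolynomial.X K) * f) = 0 := by
  by_contra h
  have h1 := ((deg_U_zero K K).2.mul hf) d h
  have h2 := card_pos.2 hK
  omega

theorem coeff_mlead_of_two_le (g c : ℕ) (s : Finset σ) (d : σ →₀ ℕ) (h1 : ∀ i ∈ s, 2 ≤ d i) :
    ((12 * (2 * (g + 1) + s.card) : ℕ) : ℚ) * MvPolynomial.coeff d (mlead MvPolynomial.X c (g + 1) s) =
      -3 * ∑ j ∈ s, MvPolynomial.coeff (d - Finsupp.single j 1)
        (mlead MvPolynomial.X (c + 1 : ℕ) g s) := by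
  have h := congrArg (MvPolynomial.coeff d)
    (mlead_succ_rec (MvPolynomial.X : σ → MvPolynomial σ ℚ) c g s)
  have h12 : (12 : MvPolynomial σ ℚ) = MvPolynomial.C 12 := (map_ofNat MvPolynomial.C 12).symm
  have h3 : (3 : MvPolynomial σ ℚ) = MvPolynomial.C 3 := (map_ofNat MvPolynomial.C 3).symm
  rw [← map_natCast (MvPolynomial.C (R := ℚ) (σ := σ)), MvPolynomial.coeff_C_mul, h12, h3,
    MvPolynomial.coeff_sub, MvPolynomial.coeff_C_mul, MvPolynomial.coeff_C_mul,
    MvPolynomial.coeff_sum, coeff_S_mul, sum_eq_zero, mul_zero, zero_sub] at h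
  · rw [h, neg_mul]
    congr 2
    refine sum_congr rfl fun j hj => ?_
    have := h1 j hj
    rw [if_neg (by omega)]
    push_cast
    rfl
  · intro K hK
    rcases K.eq_empty_or_nonempty with rfl | hKne
    · simp
    refine coeff_U_mul_eq_zero (m := 1 + 0) hKne (Deg.mul (Deg.add (Deg.S _)
      (Deg.mul (m := 0) (n := 1) ?_ (Deg.S _))) (deg_mlead sdiff_disjoint _ _)) ?_
    · have := Deg.intCast (T := K) (2 * ((c : ℤ) + 1))
      push_cast at this ⊢
      exact this
    · have : K.card • 2 ≤ ∑ i ∈ K, d i :=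
        card_nsmul_le_sum K d 2 fun i hi => h1 i (mem_powerset.1 hK hi)
      have := card_pos.2 hKne
      rw [smul_eq_mul] at *
      omega

omit [DecidableEq σ] in
theorem sum_two_mul_sub_one {s : Finset σ} {d : σ →₀ ℕ} {N : ℕ} (h : ∑ i ∈ s, d i = N) :
    ∑ i ∈ s, (2 * d i - 1 : ℚ) = 2 * N - s.card := by
  rw [sum_sub_distrib, ← mul_sum, ← Nat.cast_sum, h]
  simp

theorem coeff_mlead_dilaton_step {g n : ℕ} (ih : ∀ (c : ℕ) (s : Finset σ) (d : σ →₀ ℕ), s.card = n →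
      (∀ i ∈ s, 1 ≤ d i) → (∀ i, i ∉ s → d i = 0) → ∑ i ∈ s, d i = g + n →
      MvPolynomial.coeff d (mlead MvPolynomial.X c g s) *
        (4 ^ g * ((2 * c + 2 * g + 1).factorial : ℚ) * dfp s d) =
        (-1) ^ c * ((2 * g + n + 1 + 2 * c).factorial : ℚ))
    (c : ℕ) (s : Finset σ) (d : σ →₀ ℕ) (hs : s.card = n + 1)
    (h1 : ∀ i ∈ s, 1 ≤ d i) (h0 : ∀ i, i ∉ s → d i = 0) (hsum : ∑ i ∈ s, d i = g + (n + 1))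
    (hone : ∃ j ∈ s, d j = 1) :
    MvPolynomial.coeff d (mlead MvPolynomial.X c g s) *
        (4 ^ g * ((2 * c + 2 * g + 1).factorial : ℚ) * dfp s d) =
        (-1) ^ c * ((2 * g + (n + 1) + 1 + 2 * c).factorial : ℚ) := by
  obtain ⟨j, hj, hdj⟩ := hone
  obtain ⟨t, hjt, rfl⟩ : ∃ t, j ∉ t ∧ s = insert j t :=
    ⟨s.erase j, notMem_erase j s, (insert_erase hj).symm⟩
  obtain ⟨e, rfl⟩ := exists_add_single hdj.ge
  have hej : e j = 0 := by simpa using hdj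
  rw [card_insert_of_notMem hjt, add_left_inj] at hs
  rw [sum_insert hjt, hdj, sum_add_single_of_notMem hjt] at hsum
  have := ih c t e hs (fun i hi => ?_) (fun i hi => ?_) (by omega)
  · rw [mlead_dilaton c g hjt hej, dfp_insert_one hjt e hej, hs,
      show 2 * g + (n + 1) + 1 + 2 * c = (2 * g + n + 1 + 2 * c) + 1 by ring,
      Nat.factorial_succ (2 * g + n + 1 + 2 * c)]
    push_cast
    linear_combination (2 * g + n + 2 + 2 * c : ℚ) * this
  · simpa [Finsupp.single_eq_of_ne (ne_of_mem_of_not_mem hi hjt)] using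
      h1 i (mem_insert_of_mem hi)
  · rcases eq_or_ne i j with rfl | hij
    · exact hej
    · simpa [Finsupp.single_eq_of_ne hij] using h0 i (by simp [hij, hi])

theorem coeff_mlead (g : ℕ) : ∀ (n : ℕ) (c : ℕ) (s : Finset σ) (d : σ →₀ ℕ), s.card = n →
    (∀ i ∈ s, 1 ≤ d i) → (∀ i, i ∉ s → d i = 0) → ∑ i ∈ s, d i = g + n →
    MvPolynomial.coeff d (mlead MvPolynomial.X c g s) *
      (4 ^ g * ((2 * c + 2 * g + 1).factorial : ℚ) * dfp s d) =
      (-1) ^ c * ((2 * g + n + 1 + 2 * c).factorial : ℚ) := by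
  induction g with
  | zero =>
    intro n
    induction n with
    | zero =>
      intro c s d hs h1 h0 hsum
      rw [card_eq_zero] at hs
      subst hs
      have : d = 0 := by ext i; simpa using h0 i
      subst this
      rw [mlead_empty, ← map_one (MvPolynomial.C (R := ℚ) (σ := σ)), ← map_neg, ← map_pow,
        MvPolynomial.coeff_C, if_pos rfl]
      simp [dfp, add_comm]
    | succ n ih =>
      intro c s d hs h1 h0 hsum
      exact coeff_mlead_dilaton_step ih c s d hs h1 h0 hsum (by
        by_contra! h
        have : s.card • 2 ≤ ∑ i ∈ s, d i := card_nsmul_le_sum s d 2 fun i hi => by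
          have := h1 i hi
          have := h i hi
          omega
        rw [smul_eq_mul] at this
        omega)
  | succ g ihg =>
    intro n
    induction n with
    | zero =>
      intro c s d hs h1 h0 hsum
      rw [card_eq_zero] at hs
      subst hs
      simp at hsum
    | succ n ih =>
      intro c s d hs h1 h0 hsum
      by_cases hone : ∃ j ∈ s, d j = 1
      · exact coeff_mlead_dilaton_step ih c s d hs h1 h0 hsum hone
      push Not at hone
      have h2 : ∀ i ∈ s, 2 ≤ d i := fun i hi => by
        have := h1 i hi
        have := hone i hi
        omega
      have hrec := coeff_mlead_of_two_le g c s d h2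
      have hterm : ∀ j ∈ s, MvPolynomial.coeff (d - Finsupp.single j 1)
          (mlead MvPolynomial.X (c + 1 : ℕ) g s) *
          (4 ^ g * ((2 * c + 2 * (g + 1) + 1).factorial : ℚ) * dfp s d) =
          (-1) ^ (c + 1) * ((2 * (g + 1) + (n + 1) + 1 + 2 * c).factorial : ℚ) * (2 * d j - 1) := by
        intro j hj
        obtain ⟨e, rfl⟩ := exists_add_single (h1 j hj)
        have hej : 1 ≤ e j := by simpa using h2 j hj
        rw [add_tsub_cancel_right, dfp_add_single hj e hej]
        rw [sum_add_single hj] at hsum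
        have := ihg (n + 1) (c + 1) s e hs (fun i hi => ?_) (fun i hi => ?_) (by omega)
        · rw [show 2 * c + 2 * (g + 1) + 1 = 2 * (c + 1) + 2 * g + 1 by ring,
            show 2 * (g + 1) + (n + 1) + 1 + 2 * c = 2 * g + (n + 1) + 1 + 2 * (c + 1) by ring]
          simp only [Finsupp.add_apply, Finsupp.single_eq_same]
          push_cast at this ⊢
          linear_combination (2 * (e j : ℚ) + 1) * this
        · rcases eq_or_ne i j with rfl | hij
          · exact hej
          · simpa [Finsupp.single_eq_of_ne hij] using h1 i hi
        · simpa using (Nat.add_eq_zero_iff.1 (h0 i hi)).1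
      have hsum' := sum_two_mul_sub_one hsum
      have h4 := sum_congr (f := fun j => _) rfl hterm
      rw [← sum_mul, ← mul_sum, hsum', hs] at h4
      have hpos : ((12 * (2 * (g + 1) + (n + 1)) : ℕ) : ℚ) ≠ 0 := by positivity
      rw [hs] at hrec
      refine mul_left_cancel₀ hpos ?_
      rw [← mul_assoc, hrec, pow_succ]
      rw [pow_succ] at h4
      push_cast at h4 ⊢
      linear_combination (-12) * h4

end

section
variable {σ A : Type*} [CommRing A] [DecidableEq σ] [Algebra ℚ A]

/-- The functions `(y + z + Σ x)² F_g(y, z, x)`. -/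
def bimarked (y z : A) (x : σ → A) : SetFun σ (PowerSeries A) := (marked y (addVar z x)).mark

theorem unmark_marked (y z : A) (x : σ → A) : (marked y (addVar z x)).unmark = marked y x := by
  ext s : 1
  have h : insertNone (s.map Function.Embedding.some) =
      (insertNone s).map (Function.Embedding.some : σ ↪ Option σ).optionMap := by
    ext a
    rcases a with _ | _ | a <;> simp
  have h2 : addVar y (addVar z x) ∘ (Function.Embedding.some : σ ↪ Option σ).optionMap =
      addVar y x := by
    funext o
    cases o <;> rfl
  rw [SetFun.unmark_apply, marked, SetFun.mark_apply, h, ← U_comp, h2, marked, SetFun.mark_apply]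

theorem bimarked_eqn (y z : A) (x : σ → A) (s : Finset σ) :
    12 * (theta (bimarked y z x s) + (s.card + 1 : PowerSeries A) * bimarked y z x s) =
      12 * PowerSeries.C (y + z + S x s) *
        ((bimarked y z x * U x) s + (marked y x * marked z x) s) +
        PowerSeries.X * PowerSeries.C (y + z + S x s) ^ 3 * bimarked y z x s := by
  have h := marked_eqn y (addVar z x) (insertNone s)
  rw [card_insertNone, S_addVar, ← SetFun.mark_apply, ← bimarked, ← SetFun.mark_apply,
    SetFun.mark_mul, unmark_U, unmark_marked, ← marked, ← bimarked, SetFun.add_apply,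
    ← add_assoc] at h
  push_cast at h
  exact h

theorem bimarked_map {B : Type*} [CommRing B] [Algebra ℚ B] (f : A →+* B) (y z : A) (x : σ → A)
    (s : Finset σ) : bimarked (f y) (f z) (f ∘ x) s = PowerSeries.map f (bimarked y z x s) := by
  have h : addVar (f z) (f ∘ x) = f ∘ addVar z x := by
    funext o
    cases o <;> rfl
  rw [bimarked, SetFun.mark_apply, h, marked_map]
  rfl

theorem bimarked_dilaton (y z : A) (x : σ → A) {j : σ} (hj : x j ^ 2 = 0) {s : Finset σ}
    (hs : j ∉ s) : bimarked y z x (insert j s) = PowerSeries.C (y + z + S x s) * bimarked y z x s +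
      PowerSeries.C (x j) * (theta (bimarked y z x s) +
        (s.card + 2 : PowerSeries A) * bimarked y z x s) := by
  have h := marked_dilaton y (addVar z x) (j := some j) (s := insertNone s) hj (by simpa using hs)
  have h1 : insert (some j) (insertNone s) = insertNone (insert j s) := by
    ext a; cases a <;> simp
  rw [h1, S_addVar, card_insertNone, ← add_assoc] at h
  push_cast at h
  rw [add_assoc (s.card : PowerSeries A), one_add_one_eq_two] at h
  exact h

theorem bimarked_dilaton_dvd (y z : A) (x : σ → A) {j : σ} {s : Finset σ} (hs : j ∉ s) (g : ℕ) :
    x j ^ 2 ∣ PowerSeries.coeff g (bimarked y z x (insert j s)) -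
      (y + z + S x s + ((2 * g + s.card + 2 : ℕ) : A) * x j) *
        PowerSeries.coeff g (bimarked y z x s) := by
  set q := Ideal.Quotient.mk (Ideal.span {x j ^ 2}) with hq
  have hj : (q ∘ x) j ^ 2 = 0 := by
    rw [Function.comp_apply, ← map_pow]
    exact Ideal.Quotient.eq_zero_iff_mem.2 (Ideal.mem_span_singleton_self _)
  have h := congrArg (PowerSeries.coeff g) (bimarked_dilaton (q y) (q z) (q ∘ x) hj hs)
  rw [bimarked_map, bimarked_map, S_map, PowerSeries.coeff_map, map_add, PowerSeries.coeff_C_mul,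
    PowerSeries.coeff_C_mul, PowerSeries.coeff_map, map_add, coeff_theta, PowerSeries.coeff_map] at h
  have h2 : (s.card + 2 : PowerSeries (A ⧸ Ideal.span {x j ^ 2})) =
    ((s.card + 2 : ℕ) : PowerSeries _) := by push_cast; rfl
  rw [h2, coeff_natCast_mul, PowerSeries.coeff_map] at h
  rw [← Ideal.mem_span_singleton, ← Ideal.Quotient.eq_zero_iff_mem, ← hq, map_sub, h]
  simp only [map_mul, map_add, map_natCast, Function.comp_apply]
  push_cast
  ring

end

section
variable {σ k : Type*} [CommRing k] [DecidableEq σ] [Algebra ℚ k] (x : σ → k)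

/-- The specialization of `bimarked` at `y`, `-y`. -/
def BL : SetFun σ (PowerSeries (LaurentSeries k)) := bimarked yy (-yy) (lv x)

theorem marked_mul_marked (s : Finset σ) :
    (marked yy (lv x) * marked (-yy) (lv x) : SetFun σ (PowerSeries (LaurentSeries k))) s = ML x 0 s := by
  rw [SetFun.mul_apply, ML]
  refine sum_congr rfl fun I _ => ?_
  rw [zpow_zero, Units.val_one, map_one, one_mul, pairVal]

theorem BL_eqn (s : Finset σ) :
    12 * (theta (BL x s) + ((s.card + 1 : ℕ) : PowerSeries (LaurentSeries k)) * BL x s) =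
      12 * (PowerSeries.C (HahnSeries.C (S x s)) *
        ((U (lv x) * BL x : SetFun σ (PowerSeries (LaurentSeries k))) s + ML x 0 s)) +
        PowerSeries.C (HahnSeries.C (S x s) ^ 3) * (PowerSeries.X * BL x s) := by
  have h := bimarked_eqn yy (-yy) (lv x) s
  rw [add_neg_cancel, zero_add, S_lv, marked_mul_marked, ← BL, mul_comm (BL x)] at h
  rw [map_pow]
  push_cast
  linear_combination h

theorem coeff_BL (s : Finset σ) (g : ℕ) :
    ((12 * (2 * g + s.card + 1) : ℕ) : LaurentSeries k) * PowerSeries.coeff g (BL x s) =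
      HahnSeries.C (12 * S x s) * (∑ K ∈ s.powerset, ∑ p ∈ antidiagonal g,
        HahnSeries.C (PowerSeries.coeff p.1 (U x K)) * PowerSeries.coeff p.2 (BL x (s \ K)) +
        PowerSeries.coeff g (ML x 0 s)) +
      HahnSeries.C (S x s ^ 3) * PowerSeries.coeff g (PowerSeries.X * BL x s) := by
  have h := congrArg (PowerSeries.coeff g) (BL_eqn x s)
  rw [map_add, coeff_ofNat_mul, coeff_ofNat_mul, map_add, coeff_theta, coeff_natCast_mul,
    PowerSeries.coeff_C_mul, PowerSeries.coeff_C_mul, map_add, SetFun.mul_apply, map_sum] at h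
  simp only [U_lv, PowerSeries.coeff_mul g (PowerSeries.map _ _), PowerSeries.coeff_map] at h
  rw [map_mul, map_ofNat, map_pow, mul_assoc, ← h]
  push_cast
  ring

theorem BL_fil_step {s : Finset σ} (ih : ∀ t, t ⊂ s → ∀ g : ℕ,
    Fil (2 * g) (PowerSeries.coeff g (BL x t))) (g : ℕ)
    (hX : Fil (2 * g) (PowerSeries.coeff g (PowerSeries.X * BL x s))) :
    Fil (2 * g) (PowerSeries.coeff g (BL x s)) := by
  refine Fil.of_natCast_mul (N := 12 * (2 * g + s.card + 1)) (by omega) ?_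
  rw [coeff_BL]
  refine Fil.add (Fil.C_mul _ (Fil.add (Fil.sum fun K hK => Fil.sum fun p hp => ?_)
    ((ML_fil s g 0).mono (by omega)))) (Fil.C_mul _ hX)
  rcases K.eq_empty_or_nonempty with rfl | hK'
  · rw [U_empty, map_zero, map_zero, zero_mul]
    exact Fil.zero _
  · have hp := mem_antidiagonal.1 hp
    exact Fil.C_mul _ ((ih _ (sdiff_ssubset (mem_powerset.1 hK) hK') p.2).mono (by omega))

theorem BL_fil (s : Finset σ) : ∀ g : ℕ, Fil (2 * g) (PowerSeries.coeff g (BL x s)) := by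
  induction s using Finset.strongInduction with
  | H s ih =>
  intro g
  induction g with
  | zero =>
    refine BL_fil_step x ih 0 ?_
    rw [PowerSeries.coeff_zero_X_mul]
    exact Fil.zero _
  | succ g ihg =>
    refine BL_fil_step x ih (g + 1) ?_
    rw [PowerSeries.coeff_succ_X_mul]
    exact ihg.mono (by push_cast; omega)

/-- The leading coefficient of the genus `g` part of `BL`. -/
def qlead (g : ℕ) (s : Finset σ) : k := (PowerSeries.coeff g (BL x s)).coeff (-(2 * g))

theorem qlead_rec (g : ℕ) (s : Finset σ) :
    ((2 * g + s.card + 1 : ℕ) : k) * qlead x g s =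
      S x s * (∑ K ∈ s.powerset, PowerSeries.coeff 0 (U x K) * qlead x g (s \ K) +
        mlead x 0 g s) := by
  have hX : (PowerSeries.coeff g (PowerSeries.X * BL x s)).coeff (-(2 * g)) = 0 := by
    rcases g with _ | g
    · rw [PowerSeries.coeff_zero_X_mul]
      rfl
    · rw [PowerSeries.coeff_succ_X_mul]
      exact BL_fil x s g _ (by push_cast; omega)
  have h := congrArg (fun f => f.coeff (-(2 * g))) (coeff_BL x s g)
  simp only [coeff_natCast_mul_laurent, HahnSeries.coeff_add, coeff_C_mul_laurent, hX,
    coeff_sum_laurent, mul_zero, add_zero] at h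
  refine natCast_mul_cancel (N := 12) (by norm_num) ?_
  rw [← mul_assoc, ← Nat.cast_mul, qlead, h, Nat.cast_ofNat, mul_assoc]
  congr 3
  · refine sum_congr rfl fun K _ => ?_
    rw [sum_eq_single (0, g)]
    · rfl
    · rintro ⟨a, b⟩ hp hne
      have hp := mem_antidiagonal.1 hp
      have hb : b ≠ g := by
        rintro rfl
        exact hne (by rw [Prod.mk.injEq]; exact ⟨by simpa using hp, rfl⟩)
      rw [BL_fil x (s \ K) b _ (by simp only at hp; omega), mul_zero]
    · intro h
      simp at h

theorem qlead_dilaton_dvd {j : σ} {s : Finset σ} (hs : j ∉ s) (g : ℕ) :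
    x j ^ 2 ∣ qlead x g (insert j s) -
      (S x s + ((2 * g + s.card + 2 : ℕ) : k) * x j) * qlead x g s := by
  obtain ⟨r, hr⟩ := bimarked_dilaton_dvd yy (-yy) (lv x) hs g
  rw [← BL, add_neg_cancel, zero_add, S_lv, lv, ← map_natCast (HahnSeries.C (Γ := ℤ) (R := k)),
    ← map_mul, ← map_add, ← map_pow] at hr
  have := congrArg (fun f => f.coeff (-(2 * g))) hr
  rw [HahnSeries.coeff_sub, coeff_C_mul_laurent, coeff_C_mul_laurent] at this
  exact ⟨_, this⟩

end

section
variable {σ : Type*} [DecidableEq σ]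

theorem deg_qlead {T s : Finset σ} (h : Disjoint s T) (g : ℕ) :
    Deg T 0 (qlead (MvPolynomial.X : σ → MvPolynomial σ ℚ) g s) := by
  induction s using Finset.strongInduction with
  | H s ih =>
  refine Deg.of_natCast_mul (N := 2 * g + s.card + 1) (by omega) ?_
  rw [qlead_rec]
  refine Deg.mul (m := 0) (n := 0) (Deg.S_of_disjoint h)
    (Deg.add (Deg.sum fun K hK => ?_) (by exact_mod_cast deg_mlead h g 0))
  rcases K.eq_empty_or_nonempty with rfl | hKne
  · simp [Deg.zero]
  have hK := mem_powerset.1 hK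
  exact Deg.mul (m := 0) (n := 0) ((deg_U_zero T K).1 (disjoint_of_subset_left hK h))
    (ih _ (sdiff_ssubset hK hKne) (disjoint_of_subset_left sdiff_subset h))

omit [DecidableEq σ] in
theorem deg_singleton_iff (j : σ) (f : MvPolynomial σ ℚ) :
    Deg {j} 0 f ↔ MvPolynomial.degreeOf j f = 0 := by
  rw [← Nat.le_zero, MvPolynomial.degreeOf_le_iff]
  simp [Deg, MvPolynomial.mem_support_iff]

theorem Deg.of_S_sq_mul {j : σ} {s : Finset σ} (hs : s.Nonempty) {f : MvPolynomial σ ℚ}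
    (h : Deg {j} 0 (Faber.S MvPolynomial.X s ^ 2 * f)) : Deg {j} 0 f := by
  rcases eq_or_ne f 0 with rfl | hf
  · exact Deg.zero
  rw [deg_singleton_iff] at h ⊢
  rw [MvPolynomial.degreeOf_mul_eq (pow_ne_zero 2 (S_X_ne_zero hs)) hf] at h
  omega

theorem X_sq_dvd_of_S_sq_mul {j : σ} {s : Finset σ} (hs : s.Nonempty) (hj : j ∉ s)
    {f : MvPolynomial σ ℚ}
    (h : MvPolynomial.X j ^ 2 ∣ S MvPolynomial.X (insert j s) ^ 2 * f) :
    MvPolynomial.X j ^ 2 ∣ f := by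
  refine Prime.pow_dvd_of_dvd_mul_left MvPolynomial.X_prime 2 (fun h' => ?_) h
  have h2 := (MvPolynomial.X_prime (R := ℚ) (i := j)).dvd_of_dvd_pow h'
  rw [S_insert _ hj, dvd_add_right (dvd_refl _)] at h2
  obtain ⟨i, hi⟩ := hs
  have h3 := map_dvd (MvPolynomial.eval (fun a => if a = j then (0 : ℚ) else if a = i then 1 else 0)) h2
  have hij : i ≠ j := ne_of_mem_of_not_mem hi hj
  rw [MvPolynomial.eval_X, if_pos rfl, zero_dvd_iff, S, map_sum,
    sum_eq_single i (by
      intro b _ hb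
      simp [hb]) (fun h => absurd hi h)] at h3
  simp [hij] at h3

/-- Substitution of `y`, `-y` and `x` for the variables. -/
def substPair : MvPolynomial (Option (Option σ)) ℚ →ₐ[ℚ] LaurentSeries (MvPolynomial σ ℚ) :=
  MvPolynomial.aeval (addVar yy (addVar (-yy) (lv MvPolynomial.X)))

theorem BL_eq_substPair {s : Finset σ} (hs : s.Nonempty) (g : ℕ) :
    PowerSeries.coeff g (BL MvPolynomial.X s) =
      HahnSeries.C (S MvPolynomial.X s ^ 2) * substPair (Fp (insertNone (insertNone s)) g) := by
  have h1 : addVar yy (addVar (-yy) (lv (MvPolynomial.X : σ → MvPolynomial σ ℚ))) =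
      (substPair (σ := σ)).toRingHom ∘ MvPolynomial.X := by
    funext o
    simp [substPair]
  have h2 : BL MvPolynomial.X s = PowerSeries.map (substPair (σ := σ)).toRingHom
      (U MvPolynomial.X (insertNone (insertNone s))) := by
    rw [← U_map, ← h1]
    rfl
  have hc := card_pos.2 hs
  rw [h2, PowerSeries.coeff_map, Fp_spec ⟨none, by simp⟩ (by simp only [card_insertNone]; omega),
    map_mul, map_pow, ← S_map, ← h1, S_addVar, S_addVar, add_neg_cancel_left, S_lv, ← map_pow]
  rfl

/-- The coefficient of the highest power of `y` in `F_g(y, -y, x)`. -/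
def plead (s : Finset σ) (g : ℕ) : MvPolynomial σ ℚ :=
  (substPair (Fp (insertNone (insertNone s)) g)).coeff (-(2 * g))

theorem qlead_eq {s : Finset σ} (hs : s.Nonempty) (g : ℕ) :
    qlead MvPolynomial.X g s = S MvPolynomial.X s ^ 2 * plead s g := by
  rw [qlead, BL_eq_substPair hs, coeff_C_mul_laurent, plead]

theorem deg_plead {s : Finset σ} (hs : s.Nonempty) {j : σ} (hj : j ∉ s) (g : ℕ) :
    Deg {j} 0 (plead s g) := by
  refine Deg.of_S_sq_mul hs ?_
  rw [← qlead_eq hs]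
  exact deg_qlead (disjoint_singleton_right.2 hj) g

theorem plead_dilaton {s : Finset σ} (hs : s.Nonempty) {j : σ} (hj : j ∉ s) (g : ℕ)
    {d : σ →₀ ℕ} (hd : d j = 0) :
    MvPolynomial.coeff (d + Finsupp.single j 1) (plead (insert j s) g) =
      ((2 * g + s.card : ℕ) : ℚ) * MvPolynomial.coeff d (plead s g) := by
  refine coeff_of_sq_dvd (a := S MvPolynomial.X s) (X_sq_dvd_of_S_sq_mul hs hj ?_)
    (Deg.S_of_disjoint (disjoint_singleton_right.2 hj)) (deg_plead hs hj g) hd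
  have h := qlead_dilaton_dvd (MvPolynomial.X : σ → MvPolynomial σ ℚ) hj g
  rw [qlead_eq (insert_nonempty j s), qlead_eq hs] at h
  rw [S_insert _ hj] at h ⊢
  refine (dvd_iff_dvd_of_dvd_sub (dvd_of_mul_right_eq
    (((2 * g + s.card : ℕ) : MvPolynomial σ ℚ) * MvPolynomial.X j * plead s g +
      (2 * ((2 * g + s.card : ℕ) : MvPolynomial σ ℚ) + 1) * S MvPolynomial.X s * plead s g) ?_)).1 h
  push_cast
  ring

theorem coeff_S_mul_plead {s : Finset σ} (hs : s.Nonempty) (g : ℕ) {d : σ →₀ ℕ}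
    (h1 : ∀ i ∈ s, 1 ≤ d i) :
    ((2 * g + s.card + 1 : ℕ) : ℚ) * MvPolynomial.coeff d (S MvPolynomial.X s * plead s g) =
      MvPolynomial.coeff d (mlead MvPolynomial.X 0 g s) := by
  have h := qlead_rec (MvPolynomial.X : σ → MvPolynomial σ ℚ) g s
  rw [qlead_eq hs] at h
  have h2 : ((2 * g + s.card + 1 : ℕ) : MvPolynomial σ ℚ) * (S MvPolynomial.X s * plead s g) =
      ∑ K ∈ s.powerset, PowerSeries.coeff 0 (U MvPolynomial.X K) * qlead MvPolynomial.X g (s \ K) +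
        mlead MvPolynomial.X 0 g s :=
    mul_left_cancel₀ (S_X_ne_zero hs) (by linear_combination h)
  have h3 := congrArg (MvPolynomial.coeff d) h2
  rw [← map_natCast (MvPolynomial.C (R := ℚ) (σ := σ)), MvPolynomial.coeff_C_mul,
    MvPolynomial.coeff_add, MvPolynomial.coeff_sum, sum_eq_zero, zero_add] at h3
  · exact h3
  intro K hK
  rcases K.eq_empty_or_nonempty with rfl | hKne
  · simp
  refine coeff_U_mul_eq_zero (m := 0) hKne (deg_qlead sdiff_disjoint g) ?_
  have : K.card • 1 ≤ ∑ i ∈ K, d i :=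
    card_nsmul_le_sum K d 1 fun i hi => h1 i (mem_powerset.1 hK hi)
  simpa using this

theorem coeff_S_mul_plead_eq {s : Finset σ} (hs : s.Nonempty) (g : ℕ) {d : σ →₀ ℕ}
    (h1 : ∀ i ∈ s, 1 ≤ d i) (h0 : ∀ i, i ∉ s → d i = 0) (hsum : ∑ i ∈ s, d i = g + s.card) :
    MvPolynomial.coeff d (S MvPolynomial.X s * plead s g) *
      (4 ^ g * ((2 * g + 1).factorial : ℚ) * dfp s d) = ((2 * g + s.card).factorial : ℚ) := by
  have h := coeff_mlead g s.card 0 s d rfl h1 h0 hsum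
  rw [Nat.cast_zero, ← coeff_S_mul_plead hs g h1, mul_zero, add_zero, pow_zero, one_mul,
    zero_add, Nat.factorial_succ (2 * g + s.card)] at h
  have hpos : ((2 * g + s.card + 1 : ℕ) : ℚ) ≠ 0 := by positivity
  refine mul_left_cancel₀ hpos ?_
  rw [Nat.cast_mul] at h
  linear_combination h

theorem coeff_plead (g : ℕ) {i₀ : σ} (N : ℕ) : ∀ (s : Finset σ) (d : σ →₀ ℕ), i₀ ∈ s →
    ∑ i ∈ s.erase i₀, d i = N → (∀ i ∈ s, 1 ≤ d i) → (∀ i, i ∉ s → d i = 0) →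
    ∑ i ∈ s, d i + 1 = g + s.card →
    MvPolynomial.coeff d (plead s g) *
      (4 ^ g * ((2 * g + 1).factorial : ℚ) * dfp s d) = ((2 * g + s.card - 1).factorial : ℚ) := by
  induction N using Nat.strong_induction_on with
  | _ N ih =>
  intro s d hi₀ hN h1 h0 hsum
  have hs : s.Nonempty := ⟨i₀, hi₀⟩
  by_cases hone : ∃ j ∈ s.erase i₀, d j = 1
  · obtain ⟨j, hj, hdj⟩ := hone
    obtain ⟨hji, hjs⟩ := mem_erase.1 hj
    obtain ⟨t, hjt, rfl⟩ : ∃ t, j ∉ t ∧ s = insert j t :=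
      ⟨s.erase j, notMem_erase j s, (insert_erase hjs).symm⟩
    have hit : i₀ ∈ t := (mem_insert.1 hi₀).resolve_left hji.symm
    obtain ⟨e, rfl⟩ := exists_add_single hdj.ge
    have hej : e j = 0 := by simpa using hdj
    rw [erase_insert_of_ne hji, sum_insert (fun h => hjt (mem_of_mem_erase h)), hdj,
      sum_add_single_of_notMem (fun h => hjt (mem_of_mem_erase h))] at hN
    rw [sum_insert hjt, hdj, sum_add_single_of_notMem hjt, card_insert_of_notMem hjt] at hsum
    have := ih _ (by omega) t e hit rfl (fun i hi => ?_) (fun i hi => ?_) (by omega)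
    · have hc := card_pos.2 ⟨i₀, hit⟩
      rw [plead_dilaton ⟨i₀, hit⟩ hjt g hej, dfp_insert_one hjt e hej, card_insert_of_notMem hjt,
        show 2 * g + (t.card + 1) - 1 = (2 * g + t.card - 1) + 1 by omega,
        Nat.factorial_succ (2 * g + t.card - 1), Nat.cast_mul (2 * g + t.card - 1 + 1), ← this,
        show 2 * g + t.card - 1 + 1 = 2 * g + t.card by omega]
      ring
    · simpa [Finsupp.single_eq_of_ne (ne_of_mem_of_not_mem hi hjt)] using
        h1 i (mem_insert_of_mem hi)
    · rcases eq_or_ne i j with rfl | hij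
      · exact hej
      · simpa [Finsupp.single_eq_of_ne hij] using h0 i (by simp [hij, hi])
  · push Not at hone
    have hD1 : ∀ i ∈ s, 1 ≤ (d + Finsupp.single i₀ 1 : σ →₀ ℕ) i := fun i hi => by
      have := h1 i hi
      rw [Finsupp.add_apply]
      omega
    have hD0 : ∀ i, i ∉ s → (d + Finsupp.single i₀ 1 : σ →₀ ℕ) i = 0 := fun i hi => by
      rw [Finsupp.add_apply, h0 i hi, Finsupp.single_eq_of_ne (ne_of_mem_of_not_mem hi₀ hi).symm, add_zero]
    have hDsum : ∑ i ∈ s, (d + Finsupp.single i₀ 1 : σ →₀ ℕ) i = g + s.card := by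
      rw [sum_add_single hi₀]
      exact hsum
    have hrec := coeff_S_mul_plead_eq hs g hD1 hD0 hDsum
    have hterm : ∀ j ∈ s.erase i₀, (if (d + Finsupp.single i₀ 1 : σ →₀ ℕ) j = 0 then 0 else
          MvPolynomial.coeff (d + Finsupp.single i₀ 1 - Finsupp.single j 1) (plead s g)) *
        (4 ^ g * ((2 * g + 1).factorial : ℚ) * dfp s (d + Finsupp.single i₀ 1)) =
        ((2 * g + s.card - 1).factorial : ℚ) *
          (2 * (d + Finsupp.single i₀ 1 : σ →₀ ℕ) j - 1) := by
      intro j hj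
      obtain ⟨hji, hjs⟩ := mem_erase.1 hj
      rw [if_neg (by have := hD1 j hjs; omega)]
      obtain ⟨e, rfl⟩ := exists_add_single (h1 j hjs)
      have hej : 1 ≤ e j := by
        have := h1 j hjs
        have := hone j hj
        rw [Finsupp.add_apply, Finsupp.single_eq_same] at *
        omega
      rw [sum_add_single hj] at hN
      rw [sum_add_single hjs] at hsum
      rw [add_right_comm, add_tsub_cancel_right]
      have := ih (∑ i ∈ s.erase i₀, e i) (by omega) s (e + Finsupp.single i₀ 1) hi₀
        (sum_add_single_of_notMem (notMem_erase _ _) _) (fun i hi => ?_) (fun i hi => ?_) (by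
          rw [sum_add_single hi₀]
          omega)
      · rw [dfp_add_single hjs _ (by rw [Finsupp.add_apply]; omega), ← this]
        simp only [Finsupp.add_apply, Finsupp.single_eq_same]
        push_cast
        ring
      · rw [Finsupp.add_apply]
        rcases eq_or_ne i j with rfl | hij
        · omega
        · have := h1 i hi
          rw [Finsupp.add_apply, Finsupp.single_eq_of_ne hij] at this
          omega
      · have := hD0 i hi
        simp only [Finsupp.add_apply] at this ⊢
        omega
    have hsum' := sum_two_mul_sub_one hDsum
    have h4 := sum_congr (f := fun j => _) rfl hterm
    rw [← sum_mul, ← mul_sum] at h4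
    rw [coeff_S_mul, ← add_sum_erase _ _ hi₀, if_neg (by have := hD1 i₀ hi₀; omega),
      add_tsub_cancel_right, add_mul, h4] at hrec
    rw [← add_sum_erase _ _ hi₀] at hsum'
    have hc := card_pos.2 hs
    have hfac : ((2 * g + s.card).factorial : ℚ) =
        (2 * g + s.card) * ((2 * g + s.card - 1).factorial : ℚ) := by
      rw [← Nat.mul_factorial_pred (by omega)]
      push_cast
      rfl
    rw [hfac, dfp_add_single hi₀ d (h1 _ hi₀)] at hrec
    have hne : (2 * d i₀ + 1 : ℚ) ≠ 0 := by positivity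
    refine mul_left_cancel₀ hne ?_
    simp only [Finsupp.add_apply, Finsupp.single_eq_same] at hsum' hrec
    push_cast at hsum' hrec
    linear_combination hrec - ((2 * g + s.card - 1).factorial : ℚ) * hsum'

end

section
variable {σ : Type*}

/-- The Laurent polynomial `ε y`. -/
def sy (ε : ℚ) : LaurentSeries (MvPolynomial σ ℚ) := HahnSeries.single (-1) (MvPolynomial.C ε)

theorem sy_one : sy (σ := σ) 1 = yy := by rw [sy, map_one, yy]

theorem sy_neg_one : sy (σ := σ) (-1) = -yy := by
  rw [sy, map_neg, map_one, yy, HahnSeries.single_neg]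

/-- Evaluation of a polynomial at `ε y`. -/
def polyEval (ε : ℚ) : Polynomial (MvPolynomial σ ℚ) →+* LaurentSeries (MvPolynomial σ ℚ) :=
  Polynomial.eval₂RingHom HahnSeries.C (sy ε)

theorem polyEval_monomial (ε : ℚ) (n : ℕ) (a : MvPolynomial σ ℚ) :
    polyEval ε (Polynomial.monomial n a) = HahnSeries.single (-(n : ℤ)) (MvPolynomial.C ε ^ n * a) := by
  rw [polyEval, Polynomial.coe_eval₂RingHom, Polynomial.eval₂_monomial, sy, HahnSeries.single_pow,
    mul_comm, HahnSeries.C_apply, HahnSeries.single_mul_single]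
  simp

theorem coeff_polyEval (ε : ℚ) (q : Polynomial (MvPolynomial σ ℚ)) (m : ℕ) :
    (polyEval ε q).coeff (-(m : ℤ)) = MvPolynomial.C ε ^ m * q.coeff m := by
  induction q using Polynomial.induction_on' with
  | add p q hp hq => rw [map_add, HahnSeries.coeff_add, hp, hq, Polynomial.coeff_add, mul_add]
  | monomial n a =>
    rw [polyEval_monomial, Polynomial.coeff_monomial]
    split_ifs with h
    · rw [h, HahnSeries.coeff_single_same]
    · rw [HahnSeries.coeff_single_of_ne (by omega), mul_zero]

theorem coeff_polyEval_of_pos (ε : ℚ) (q : Polynomial (MvPolynomial σ ℚ)) {i : ℤ} (hi : 0 < i) :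
    (polyEval ε q).coeff i = 0 := by
  induction q using Polynomial.induction_on' with
  | add p q hp hq => rw [map_add, HahnSeries.coeff_add, hp, hq, add_zero]
  | monomial n a => rw [polyEval_monomial, HahnSeries.coeff_single_of_ne (by omega)]

theorem polyEval_eq_comp (ε : ℚ) (q : Polynomial (MvPolynomial σ ℚ)) :
    polyEval ε q = polyEval 1 (q.comp (Polynomial.C (MvPolynomial.C ε) * Polynomial.X)) := by
  induction q using Polynomial.induction_on' with
  | add p q hp hq => rw [map_add, hp, hq, Polynomial.add_comp, map_add]
  | monomial n a =>
    rw [Polynomial.monomial_comp, mul_pow, ← Polynomial.C_pow, ← mul_assoc, ← Polynomial.C_mul,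
      Polynomial.C_mul_X_pow_eq_monomial, polyEval_monomial, polyEval_monomial, map_one, one_pow,
      one_mul, mul_comm]

theorem coeff_polyEval_mul (p q : Polynomial (MvPolynomial σ ℚ)) (N : ℕ) :
    (polyEval 1 p * polyEval (-1) q).coeff (-(N : ℤ)) =
      ∑ a ∈ antidiagonal N, (-1) ^ a.2 * (p.coeff a.1 * q.coeff a.2) := by
  rw [polyEval_eq_comp (-1), ← map_mul, coeff_polyEval, map_one, one_pow, one_mul,
    Polynomial.coeff_mul]
  refine sum_congr rfl fun a _ => ?_
  rw [Polynomial.comp_C_mul_X_coeff, map_neg, map_one]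
  ring

/-- Substitution of `ε y` and `x` for the variables. -/
def substOne (ε : ℚ) : MvPolynomial (Option σ) ℚ →ₐ[ℚ] LaurentSeries (MvPolynomial σ ℚ) :=
  MvPolynomial.aeval (addVar (sy ε) (lv MvPolynomial.X))

theorem substOne_eq (ε : ℚ) (p : MvPolynomial (Option σ) ℚ) :
    substOne ε p = polyEval ε (MvPolynomial.optionEquivLeft ℚ σ p) := by
  induction p using MvPolynomial.induction_on with
  | C a =>
    rw [substOne, MvPolynomial.aeval_C, MvPolynomial.optionEquivLeft_C, polyEval,
      Polynomial.coe_eval₂RingHom, Polynomial.eval₂_C]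
    exact RingHom.congr_fun (Subsingleton.elim (algebraMap ℚ (LaurentSeries (MvPolynomial σ ℚ)))
      (HahnSeries.C.comp MvPolynomial.C)) a
  | add p q hp hq => rw [map_add, hp, hq, map_add, map_add]
  | mul_X p o hp =>
    rw [map_mul, hp, map_mul, map_mul, substOne, MvPolynomial.aeval_X]
    congr 1
    cases o with
    | none =>
      rw [MvPolynomial.optionEquivLeft_X_none, polyEval, Polynomial.coe_eval₂RingHom,
        Polynomial.eval₂_X]
      rfl
    | some i =>
      rw [MvPolynomial.optionEquivLeft_X_some, polyEval, Polynomial.coe_eval₂RingHom,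
        Polynomial.eval₂_C]
      rfl

theorem coeff_substOne (ε : ℚ) (p : MvPolynomial (Option σ) ℚ) (m : ℕ) (d : σ →₀ ℕ) :
    MvPolynomial.coeff d ((substOne ε p).coeff (-(m : ℤ))) =
      ε ^ m * MvPolynomial.coeff (d.optionElim m) p := by
  rw [substOne_eq, coeff_polyEval, ← map_pow, MvPolynomial.coeff_C_mul,
    MvPolynomial.optionEquivLeft_coeff_coeff]

theorem coeff_substOne_mul (p q : MvPolynomial (Option σ) ℚ) (N : ℕ) (d : σ →₀ ℕ) :
    MvPolynomial.coeff d ((substOne 1 p * substOne (-1) q).coeff (-(N : ℤ))) =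
      ∑ a ∈ antidiagonal N, (-1) ^ a.2 * MvPolynomial.coeff d
        ((MvPolynomial.optionEquivLeft ℚ σ p).coeff a.1 *
          (MvPolynomial.optionEquivLeft ℚ σ q).coeff a.2) := by
  rw [substOne_eq, substOne_eq, coeff_polyEval_mul, MvPolynomial.coeff_sum]
  refine sum_congr rfl fun a _ => ?_
  rw [← map_one (MvPolynomial.C (R := ℚ) (σ := σ)), ← map_neg, ← map_pow, MvPolynomial.coeff_C_mul]

theorem substPair_eq (P : MvPolynomial (Option (Option σ)) ℚ) :
    substPair P = Polynomial.eval₂ (substOne (σ := σ) (-1)).toRingHom yy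
      (MvPolynomial.optionEquivLeft ℚ (Option σ) P) := by
  induction P using MvPolynomial.induction_on with
  | C a =>
    rw [substPair, MvPolynomial.aeval_C, MvPolynomial.optionEquivLeft_C, Polynomial.eval₂_C]
    simp
  | add p q hp hq => rw [map_add, hp, hq, map_add, Polynomial.eval₂_add]
  | mul_X p o hp =>
    rw [map_mul, hp, map_mul, Polynomial.eval₂_mul, substPair, MvPolynomial.aeval_X]
    congr 1
    cases o with
    | none =>
      rw [MvPolynomial.optionEquivLeft_X_none, Polynomial.eval₂_X]
      rfl
    | some i =>
      rw [MvPolynomial.optionEquivLeft_X_some, Polynomial.eval₂_C, ← sy_neg_one]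
      simp only [substOne, AlgHom.toRingHom_eq_coe, RingHom.coe_coe, MvPolynomial.aeval_X]
      rfl

theorem coeff_substPair (P : MvPolynomial (Option (Option σ)) ℚ) (N : ℕ) (d : σ →₀ ℕ) :
    MvPolynomial.coeff d ((substPair P).coeff (-(N : ℤ))) =
      ∑ a ∈ antidiagonal N, (-1) ^ a.2 *
        MvPolynomial.coeff ((d.optionElim a.2).optionElim a.1) P := by
  simp only [← MvPolynomial.optionEquivLeft_coeff_coeff]
  rw [substPair_eq]
  generalize MvPolynomial.optionEquivLeft ℚ (Option σ) P = Q
  induction Q using Polynomial.induction_on' with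
  | add p q hp hq =>
    simp only [Polynomial.eval₂_add, HahnSeries.coeff_add, MvPolynomial.coeff_add, hp, hq,
      Polynomial.coeff_add, mul_add, sum_add_distrib, map_add]
  | monomial n a =>
    have h1 : (Polynomial.eval₂ (substOne (σ := σ) (-1)).toRingHom yy
        (Polynomial.monomial n a)).coeff (-(N : ℤ)) = (substOne (-1) a).coeff (-(N : ℤ) + n) := by
      rw [Polynomial.eval₂_monomial, yy, HahnSeries.single_pow, one_pow, mul_comm,
        show (-(N : ℤ)) = (-(N : ℤ) + n) + n • (-1 : ℤ) by simp, HahnSeries.coeff_single_mul_add, one_mul,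
        show (-(N : ℤ) + n) + n • (-1 : ℤ) + n = -(N : ℤ) + n by simp]
      rfl
    rw [h1]
    simp only [Polynomial.coeff_monomial]
    rcases Nat.lt_or_ge N n with h | h
    · rw [substOne_eq, coeff_polyEval_of_pos _ _ (by omega), MvPolynomial.coeff_zero, sum_eq_zero]
      intro b hb
      have := mem_antidiagonal.1 hb
      rw [if_neg (by omega)]
      simp
    · obtain ⟨m, rfl⟩ := Nat.exists_eq_add_of_le h
      rw [show -((n + m : ℕ) : ℤ) + n = -(m : ℤ) by push_cast; ring, coeff_substOne,
        sum_eq_single (n, m)]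
      · rw [if_pos rfl, MvPolynomial.optionEquivLeft_coeff_coeff]
      · rintro ⟨b, c⟩ hb hne
        have := mem_antidiagonal.1 hb
        rw [if_neg (by rintro rfl; exact hne (by simpa using this))]
        simp
      · intro h
        simp at h

end

section
variable {σ : Type*} [DecidableEq σ]

theorem Fp_unstable {s : Finset σ} {g : ℕ} (h : g = 0 ∧ s.card ≤ 2) : Fp s g = 0 := by
  rw [Fp, dif_neg fun h' => h'.2 h]

theorem bracket_eq_coeff_Fp {m g : ℕ} (hm : m ≠ 0) {d : Fin m → ℕ} (e : Fin m ↪ σ) {s : Finset σ}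
    (hs : univ.map e = s) {f : σ →₀ ℕ} (hf : ∀ i, f (e i) = d i) (hf0 : ∀ a, a ∉ s → f a = 0) :
    bracket g d = MvPolynomial.coeff f (Fp s g) := by
  subst hs
  by_cases h : g = 0 ∧ m ≤ 2
  · rw [bracket, if_pos h, Fp_unstable (by simpa using h), MvPolynomial.coeff_zero]
  · have hfe : f = Finsupp.mapDomain e (Finsupp.equivFunOnFinite.symm d) := by
      ext a
      by_cases ha : a ∈ univ.map e
      · obtain ⟨i, -, rfl⟩ := mem_map.1 ha
        rw [hf, Finsupp.mapDomain_apply e.injective]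
        rfl
      · rw [hf0 a ha, Finsupp.mapDomain_of_notMem_range]
        rintro ⟨i, rfl⟩
        exact ha (mem_map_of_mem _ (mem_univ i))
    rw [bracket_eq hm h d e, hfe]

theorem bracket_cons {n : ℕ} (g m : ℕ) (d : Fin n → ℕ) :
    bracket g (Fin.cons m d : Fin (n + 1) → ℕ) =
      MvPolynomial.coeff ((Finsupp.equivFunOnFinite.symm d).optionElim m)
        (Fp (insertNone univ) g) := by
  refine bracket_eq_coeff_Fp (by omega) (finSuccEquiv n).toEmbedding ?_ ?_ ?_
  · ext a
    cases a <;> simp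
  · intro i
    cases i using Fin.cases <;> simp
  · intro a ha
    cases a <;> simp at ha

theorem bracket_cons_cons {n : ℕ} (g a b : ℕ) (d : Fin n → ℕ) :
    bracket g (Fin.cons a (Fin.cons b d : Fin (n + 1) → ℕ) : Fin (n + 2) → ℕ) =
      MvPolynomial.coeff (((Finsupp.equivFunOnFinite.symm d).optionElim b).optionElim a)
        (Fp (insertNone (insertNone univ)) g) := by
  refine bracket_eq_coeff_Fp (by omega)
    ((finSuccEquiv (n + 1)).trans (finSuccEquiv n).optionCongr).toEmbedding ?_ ?_ ?_
  · ext a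
    simp only [univ_map_equiv_to_embedding, mem_univ, true_iff]
    rcases a with _ | _ | a <;> simp
  · intro i
    cases i using Fin.cases with
    | zero => simp
    | succ i =>
      rw [Equiv.coe_toEmbedding, Equiv.trans_apply, finSuccEquiv_succ, Fin.cons_succ]
      cases i using Fin.cases <;> simp
  · intro a ha
    rcases a with _ | _ | a <;> simp at ha

theorem bracketI_eq {n : ℕ} (g j : ℕ) (I : Finset (Fin n)) (d : Fin n → ℕ) :
    bracketI g j I d =
      MvPolynomial.coeff (((Finsupp.equivFunOnFinite.symm d).filter (· ∈ I)).optionElim j)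
        (Fp (insertNone I) g) := by
  refine bracket_eq_coeff_Fp (by omega)
    ((finSuccEquiv I.card).toEmbedding.trans
      ((I.orderIsoOfFin rfl).toEquiv.toEmbedding.trans (Function.Embedding.subtype _)).optionMap)
    ?_ ?_ ?_
  · ext a
    cases a with
    | none =>
      simp only [none_mem_insertNone, iff_true, mem_map, mem_univ, true_and]
      exact ⟨0, by simp⟩
    | some a =>
      simp only [some_mem_insertNone, mem_map, mem_univ, true_and]
      constructor
      · rintro ⟨i, hi⟩
        cases i using Fin.cases with
        | zero => simp at hi
        | succ i =>
          simp at hi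
          exact hi ▸ coe_mem _
      · intro ha
        exact ⟨((I.orderIsoOfFin rfl).symm ⟨a, ha⟩).succ, by simp⟩
  · intro i
    cases i using Fin.cases <;> simp
  · intro a ha
    cases a with
    | none => simp at ha
    | some a =>
      simp at ha
      simp [ha]

/-- The embedding replacing one label by `none`. -/
def optionOf {τ : Type*} [DecidableEq τ] (i : τ) : τ ↪ Option τ where
  toFun l := if l = i then none else some l
  inj' a b h := by
    by_cases ha : a = i <;> by_cases hb : b = i <;> simp_all

theorem optionOf_self {τ : Type*} [DecidableEq τ] (i : τ) : optionOf i i = none := if_pos rfl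

theorem optionOf_of_ne {τ : Type*} [DecidableEq τ] {i l : τ} (h : l ≠ i) :
    optionOf i l = some l := if_neg h

theorem bracket_update {n : ℕ} (g m : ℕ) (i : Fin n) (d : Fin n → ℕ) :
    bracket g (Function.update d i m) =
      MvPolynomial.coeff (((Finsupp.equivFunOnFinite.symm d).erase i).optionElim m)
        (Fp (insertNone (univ.erase i)) g) := by
  have hn : n ≠ 0 := fun h => (h ▸ i).elim0
  refine bracket_eq_coeff_Fp hn (optionOf i) ?_ ?_ ?_
  · ext a
    simp only [mem_map, mem_univ, true_and]
    cases a with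
    | none => simpa using ⟨i, optionOf_self i⟩
    | some a =>
      simp only [some_mem_insertNone, mem_erase, mem_univ, and_true]
      constructor
      · rintro ⟨l, hl⟩ rfl
        by_cases h : l = a
        · rw [h, optionOf_self] at hl
          cases hl
        · rw [optionOf_of_ne h] at hl
          exact h (Option.some.inj hl)
      · exact fun h => ⟨a, optionOf_of_ne h⟩
  · intro l
    by_cases hl : l = i
    · simp [hl, optionOf_self]
    · simp [hl, optionOf_of_ne hl]
  · intro a ha
    cases a with
    | none => simp at ha
    | some a =>
      simp at ha
      simp [ha]

end

section
variable {σ : Type*} [DecidableEq σ]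

theorem Fp_support {s : Finset σ} {g : ℕ} {d : σ →₀ ℕ} (h : MvPolynomial.coeff d (Fp s g) ≠ 0)
    {i : σ} (hi : i ∉ s) : d i = 0 := by
  have h1 := rename_Fp (Function.Embedding.subtype (· ∈ s)) s.attach g
  rw [show s.attach.map (Function.Embedding.subtype (· ∈ s)) = s from attach_map_val] at h1
  rw [← h1] at h
  obtain ⟨u, rfl, -⟩ := MvPolynomial.coeff_rename_ne_zero _ _ _ h
  refine Finsupp.mapDomain_of_notMem_range _ _ ?_
  rintro ⟨⟨j, hj⟩, rfl⟩
  exact hi hj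

theorem coeff_mul_of_support {I J : Finset σ} (hIJ : ∀ i, i ∈ J ↔ i ∉ I) {p q : MvPolynomial σ ℚ}
    (hp : ∀ e, MvPolynomial.coeff e p ≠ 0 → ∀ i, i ∉ I → e i = 0)
    (hq : ∀ e, MvPolynomial.coeff e q ≠ 0 → ∀ i, i ∉ J → e i = 0) (d : σ →₀ ℕ) :
    MvPolynomial.coeff d (p * q) =
      MvPolynomial.coeff (d.filter (· ∈ I)) p * MvPolynomial.coeff (d.filter (· ∈ J)) q := by
  rw [MvPolynomial.coeff_mul]
  refine sum_eq_single_of_mem (d.filter (· ∈ I), d.filter (· ∈ J)) ?_ ?_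
  · rw [HasAntidiagonal.mem_antidiagonal]
    ext i
    by_cases hi : i ∈ I <;> simp [hIJ]
  · rintro ⟨a, b⟩ hab hne
    by_contra h
    have ha := hp a (left_ne_zero_of_mul h)
    have hb := hq b (right_ne_zero_of_mul h)
    rw [HasAntidiagonal.mem_antidiagonal] at hab
    have hi : ∀ i, a i + b i = d i := fun i => by rw [← hab]; rfl
    refine hne (Prod.ext ?_ ?_)
    · ext i
      have := hi i
      by_cases h : i ∈ I
      · have := hb i (by simp [hIJ, h])
        simp [h]
        omega
      · simp [h, ha i h]
    · ext i
      have := hi i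
      by_cases h : i ∈ J
      · have := ha i ((hIJ i).1 h)
        simp [h]
        omega
      · simp [h, hb i h]

theorem coeff_substOne_Fp_mul {I J : Finset σ} (hIJ : ∀ i, i ∈ J ↔ i ∉ I) (a b N : ℕ)
    (d : σ →₀ ℕ) :
    MvPolynomial.coeff d ((substOne 1 (Fp (insertNone I) a) *
        substOne (-1) (Fp (insertNone J) b)).coeff (-(N : ℤ))) =
      ∑ j ∈ range (N + 1), (-1) ^ (N - j) *
        (MvPolynomial.coeff ((d.filter (· ∈ I)).optionElim j) (Fp (insertNone I) a) *
          MvPolynomial.coeff ((d.filter (· ∈ J)).optionElim (N - j)) (Fp (insertNone J) b)) := by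
  rw [coeff_substOne_mul, Finset.Nat.sum_antidiagonal_eq_sum_range_succ_mk]
  have key : ∀ (K : Finset σ) (c m : ℕ) (e : σ →₀ ℕ), MvPolynomial.coeff e
      ((MvPolynomial.optionEquivLeft ℚ σ (Fp (insertNone K) c)).coeff m) ≠ 0 →
      ∀ i, i ∉ K → e i = 0 := by
    intro K c m e he i hi
    rw [MvPolynomial.optionEquivLeft_coeff_coeff] at he
    simpa using Fp_support he (i := some i) (by simpa using hi)
  refine sum_congr rfl fun j _ => ?_
  dsimp only
  rw [coeff_mul_of_support hIJ (key I a j) (key J b (N - j)),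
    MvPolynomial.optionEquivLeft_coeff_coeff, MvPolynomial.optionEquivLeft_coeff_coeff]

theorem marked_eq_map (ε : ℚ) (I : Finset σ) :
    marked (sy ε) (lv MvPolynomial.X) I = PowerSeries.map (substOne (σ := σ) ε).toRingHom
      (U MvPolynomial.X (insertNone I)) := by
  have h1 : addVar (sy ε) (lv (MvPolynomial.X : σ → MvPolynomial σ ℚ)) =
      (substOne (σ := σ) ε).toRingHom ∘ MvPolynomial.X := by
    funext o
    simp [substOne]
  rw [← U_map, ← h1]
  rfl

theorem coeff_marked_zero_singleton {A : Type*} [CommRing A] [Algebra ℚ A] (y : A) (x : σ → A)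
    (i : σ) : PowerSeries.coeff 0 (marked y x {i}) = y + x i := by
  have h := congrArg (PowerSeries.coeff 0) (marked_eqn y x {i})
  have hU : PowerSeries.coeff 0 (U x {i}) = 1 := by
    rw [PowerSeries.coeff_zero_eq_constantCoeff_apply]
    exact (isU_U x).const_singleton i
  have hp : PowerSeries.coeff 0 ((marked y x * U x) {i}) = 1 := by
    rw [SetFun.mul_apply, ← insert_empty_eq i, sum_powerset_insert (notMem_empty i), powerset_empty,
      sum_singleton, sum_singleton, sdiff_self, bot_eq_empty, U_empty, mul_zero, add_zero,
      sdiff_empty, insert_empty_eq, PowerSeries.coeff_zero_eq_constantCoeff_apply, map_mul,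
      ← PowerSeries.coeff_zero_eq_constantCoeff_apply,
      ← PowerSeries.coeff_zero_eq_constantCoeff_apply, marked_empty, hU, mul_one]
  refine natCast_mul_cancel (N := 12) (by norm_num) ?_
  rw [mul_assoc, mul_assoc, map_add, coeff_ofNat_mul, coeff_ofNat_mul, map_add, coeff_theta,
    card_singleton, Nat.cast_one, one_mul, PowerSeries.coeff_C_mul, hp, S_singleton,
    PowerSeries.coeff_zero_X_mul] at h
  push_cast
  linear_combination h

theorem marked_div (ε : ℚ) (I : Finset σ) (a : ℕ) (w : (LaurentSeries (MvPolynomial σ ℚ))ˣ)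
    (hw : w.val = sy ε + HahnSeries.C (S MvPolynomial.X I)) :
    (w ^ (-2 : ℤ)).val * PowerSeries.coeff a (marked (sy ε) (lv MvPolynomial.X) I) =
      substOne ε (Fp (insertNone I) a) + (if a = 0 ∧ I = ∅ then (w ^ (-2 : ℤ)).val else 0) +
        if a = 0 ∧ I.card = 1 then (w⁻¹).val else 0 := by
  by_cases h : a = 0 ∧ (insertNone I).card ≤ 2
  · obtain ⟨rfl, hc⟩ := h
    rw [card_insertNone] at hc
    rw [Fp_unstable ⟨rfl, by rw [card_insertNone]; exact hc⟩, map_zero, zero_add]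
    rcases I.eq_empty_or_nonempty with rfl | hne
    · rw [marked_empty]
      simp
    · have hc' : I.card = 1 := by have := card_pos.2 hne; omega
      rw [if_neg (by simp [hne.ne_empty]), if_pos ⟨rfl, hc'⟩, zero_add]
      obtain ⟨i, rfl⟩ := card_eq_one.1 hc'
      have hw' : PowerSeries.coeff 0 (marked (sy ε) (lv (MvPolynomial.X : σ → MvPolynomial σ ℚ)) {i})
          = w.val := by
        rw [coeff_marked_zero_singleton, hw, S_singleton]
        rfl
      rw [hw', ← Units.val_mul]
      congr 1
      group
  · have h1 : ¬ (a = 0 ∧ I = ∅) := by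
      rintro ⟨rfl, rfl⟩
      exact h ⟨rfl, by simp⟩
    have h2 : ¬ (a = 0 ∧ I.card = 1) := by
      rintro ⟨rfl, hc⟩
      exact h ⟨rfl, by simp [hc]⟩
    rw [if_neg h1, if_neg h2, add_zero, add_zero, marked_eq_map, PowerSeries.coeff_map,
      Fp_spec ⟨none, by simp⟩ h, map_mul, map_pow]
    have h3 : (substOne (σ := σ) ε).toRingHom (S MvPolynomial.X (insertNone I)) = w.val := by
      rw [hw, ← S_lv, ← S_addVar, ← S_map]
      congr 1
      funext o
      simp [substOne]
    rw [h3, ← Units.val_pow_eq_pow_val, ← mul_assoc, ← Units.val_mul]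
    have h4 : w ^ (-2 : ℤ) * w ^ 2 = 1 := by group
    rw [h4, Units.val_one, one_mul]
    rfl

omit [DecidableEq σ] in
theorem zpow_neg_two_of_val {ε : ℚ} (hε : ε * ε = 1) {w : (LaurentSeries (MvPolynomial σ ℚ))ˣ}
    (hw : w.val = sy ε) : (w ^ (-2 : ℤ)).val = HahnSeries.single 2 1 := by
  have h : w.val * w.val * HahnSeries.single 2 1 = 1 := by
    rw [hw, sy, HahnSeries.single_mul_single, HahnSeries.single_mul_single, ← map_mul, hε]
    simp
  have h1 : w ^ (-2 : ℤ) * (w * w) = 1 := by group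
  rw [← Units.val_mul] at h
  calc (w ^ (-2 : ℤ)).val = (w ^ (-2 : ℤ)).val * ((w * w).val * HahnSeries.single 2 1) := by
        rw [h, mul_one]
    _ = HahnSeries.single 2 1 := by rw [← mul_assoc, ← Units.val_mul, h1, Units.val_one, one_mul]

omit [DecidableEq σ] in
theorem coeff_of_add_mul_eq {ε : ℚ} (hε : ε * ε = 1) {i : σ}
    {W V : LaurentSeries (MvPolynomial σ ℚ)} (h : (sy ε + HahnSeries.C (MvPolynomial.X i)) * W = V)
    (hV : ∀ m d, MvPolynomial.coeff d (V.coeff m) ≠ 0 → d i = 0) (N : ℕ) : ∀ (k : ℕ) (d : σ →₀ ℕ),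
    d i = N → MvPolynomial.coeff d (W.coeff (-(k : ℤ))) =
      (-ε) ^ N * ε * MvPolynomial.coeff (d.erase i) (V.coeff (-((k + 1 + N : ℕ) : ℤ))) := by
  classical
  have hrec : ∀ (k : ℕ) d, MvPolynomial.coeff d (W.coeff (-(k : ℤ))) =
      ε * (MvPolynomial.coeff d (V.coeff (-((k + 1 : ℕ) : ℤ))) -
        MvPolynomial.coeff d (MvPolynomial.X i * W.coeff (-((k + 1 : ℕ) : ℤ)))) := by
    intro k d
    have h1 : (sy ε * W).coeff (-((k + 1 : ℕ) : ℤ)) = MvPolynomial.C ε * W.coeff (-(k : ℤ)) := by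
      rw [sy, show -((k + 1 : ℕ) : ℤ) = -(k : ℤ) + -1 by push_cast; ring,
        HahnSeries.coeff_single_mul_add]
    rw [← h, add_mul, HahnSeries.coeff_add, coeff_C_mul_laurent, h1, MvPolynomial.coeff_add,
      MvPolynomial.coeff_C_mul]
    linear_combination (-MvPolynomial.coeff d (W.coeff (-(k : ℤ)))) * hε
  induction N with
  | zero =>
    intro k d hd
    rw [hrec, MvPolynomial.coeff_X_mul', if_neg (by simpa using hd), sub_zero, pow_zero, one_mul,
      Finsupp.erase_of_notMem_support (by simpa using hd)]
  | succ N ih =>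
    intro k d hd
    have h0 : MvPolynomial.coeff d (V.coeff (-((k + 1 : ℕ) : ℤ))) = 0 := by
      by_contra h
      have := hV _ _ h
      omega
    rw [hrec, MvPolynomial.coeff_X_mul', if_pos (by simp [hd]), h0, ih _ _ (by simp [hd])]
    have h1 : (d - Finsupp.single i 1).erase i = d.erase i := by
      ext l
      by_cases hl : l = i
      · simp [hl]
      · simp [hl]
    rw [h1, show k + 1 + 1 + N = k + 1 + (N + 1) by ring]
    ring

end

section
variable {n : ℕ} (g : ℕ) (d : Fin n → ℕ)

/-- The coefficient of `y^N x^d` in a Laurent series. -/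
def coeffAt (N : ℕ) (d : Fin n → ℕ) (f : LaurentSeries (MvPolynomial (Fin n) ℚ)) : ℚ :=
  MvPolynomial.coeff (Finsupp.equivFunOnFinite.symm d) (f.coeff (-(N : ℤ)))

theorem coeffAt_add (N : ℕ) (f h : LaurentSeries (MvPolynomial (Fin n) ℚ)) :
    coeffAt N d (f + h) = coeffAt N d f + coeffAt N d h := by
  rw [coeffAt, HahnSeries.coeff_add, MvPolynomial.coeff_add]
  rfl

theorem coeffAt_sum {ι : Type*} (N : ℕ) (s : Finset ι)
    (f : ι → LaurentSeries (MvPolynomial (Fin n) ℚ)) :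
    coeffAt N d (∑ i ∈ s, f i) = ∑ i ∈ s, coeffAt N d (f i) := by
  rw [coeffAt, coeff_sum_laurent, MvPolynomial.coeff_sum]
  rfl

theorem coeffAt_zero (N : ℕ) : coeffAt N d 0 = 0 := by
  rw [coeffAt, HahnSeries.coeff_zero, MvPolynomial.coeff_zero]

theorem sum_bracket_cons_cons :
    ∑ j ∈ range (2 * g + 1), (-1 : ℚ) ^ j *
        bracket g (Fin.cons (2 * g - j) (Fin.cons j d : Fin (n + 1) → ℕ) : Fin (n + 2) → ℕ) =
      MvPolynomial.coeff (Finsupp.equivFunOnFinite.symm d) (plead univ g) := by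
  rw [plead, show (2 * (g : ℤ)) = ((2 * g : ℕ) : ℤ) by push_cast; ring, coeff_substPair,
    ← Finset.Nat.sum_antidiagonal_swap, Finset.Nat.sum_antidiagonal_eq_sum_range_succ_mk]
  exact sum_congr rfl fun j _ => by rw [bracket_cons_cons]; rfl

theorem coeffAt_stable (N a b : ℕ) (I : Finset (Fin n)) (hN : Even N) :
    coeffAt N d (substOne 1 (Fp (insertNone I) a) * substOne (-1) (Fp (insertNone Iᶜ) b)) =
      ∑ j ∈ range (N + 1), (-1 : ℚ) ^ j * bracketI a j I d * bracketI b (N - j) Iᶜ d := by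
  rw [coeffAt, coeff_substOne_Fp_mul (fun i => mem_compl)]
  refine sum_congr rfl fun j hj => ?_
  have hj : j ≤ N := by simpa [Nat.lt_succ_iff] using hj
  have hsign : (-1 : ℚ) ^ (N - j) = (-1) ^ j := by
    have h := pow_add (-1 : ℚ) (N - j) j
    rw [Nat.sub_add_cancel hj, hN.neg_one_pow] at h
    rcases neg_one_pow_eq_or ℚ j with h1 | h1 <;> rw [h1] at h ⊢ <;> linarith
  rw [hsign, bracketI_eq, bracketI_eq, mul_assoc]

theorem coeffAt_point (N : ℕ) {ε : ℚ} (hε : ε * ε = 1) (hN : Even N) :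
    coeffAt N d (HahnSeries.single 2 1 * substOne ε (Fp (insertNone univ) g)) =
      bracket g (Fin.cons (N + 2) d : Fin (n + 1) → ℕ) := by
  rw [coeffAt, show -(N : ℤ) = -((N + 2 : ℕ) : ℤ) + 2 by push_cast; ring,
    HahnSeries.coeff_single_mul_add, one_mul, coeff_substOne, bracket_cons]
  obtain ⟨m, rfl⟩ := hN
  rw [show m + m + 2 = 2 * (m + 1) by ring, pow_mul, sq, hε, one_pow, one_mul]

theorem coeffAt_pair (N : ℕ) {ε : ℚ} (hε : ε * ε = 1) (hN : Even N) (i : Fin n)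
    {w : (LaurentSeries (MvPolynomial (Fin n) ℚ))ˣ}
    (hw : w.val = sy ε + HahnSeries.C (MvPolynomial.X i)) :
    coeffAt N d ((w⁻¹).val * substOne (-ε) (Fp (insertNone (univ.erase i)) g)) =
      -bracket g (Function.update d i (d i + N + 1)) := by
  have h := coeff_of_add_mul_eq hε (i := i)
    (W := (w⁻¹).val * substOne (-ε) (Fp (insertNone (univ.erase i)) g))
    (V := substOne (-ε) (Fp (insertNone (univ.erase i)) g))
    (by rw [← hw, Units.mul_inv_cancel_left]) ?_ (d i) N (Finsupp.equivFunOnFinite.symm d) rfl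
  · rw [coeffAt, h, coeff_substOne, bracket_update, show N + 1 + d i = d i + N + 1 by ring]
    obtain ⟨m, rfl⟩ := hN
    have h1 : (-ε) ^ (d i) * (-ε) ^ (d i + (m + m) + 1) * ε = -1 := by
      rw [← pow_add, show d i + (d i + (m + m) + 1) = 2 * (d i + m) + 1 by ring, pow_succ, pow_mul,
        show (-ε) ^ 2 = 1 by rw [sq, neg_mul_neg, hε], one_pow]
      linarith
    rw [← neg_one_mul (MvPolynomial.coeff _ _), ← h1]
    ring
  · intro m e he
    by_contra hne
    rcases lt_or_ge 0 m with hm | hm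
    · rw [substOne_eq, coeff_polyEval_of_pos _ _ hm, MvPolynomial.coeff_zero] at he
      exact he rfl
    · obtain ⟨k, rfl⟩ := Int.exists_eq_neg_ofNat hm
      rw [coeff_substOne] at he
      have := Fp_support (right_ne_zero_of_mul he) (i := some i) (by simp)
      exact hne (by simpa using this)

end

section
variable {n : ℕ} (g : ℕ) (d : Fin n → ℕ)

theorem coeffAt_ML :
    coeffAt (2 * g) d (PowerSeries.coeff (g + 1) (ML MvPolynomial.X (-2) (univ : Finset (Fin n)))) =
      0 := by
  rw [coeffAt, ML_fil univ (g + 1) (-2) _ (by push_cast; linarith), MvPolynomial.coeff_zero]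

theorem coeff_ML_neg_two :
    PowerSeries.coeff g (ML MvPolynomial.X (-2) (univ : Finset (Fin n))) =
      ∑ p ∈ antidiagonal g, ∑ I : Finset (Fin n),
        ((unitAdd (S MvPolynomial.X I) ^ (-2 : ℤ)).val *
          PowerSeries.coeff p.1 (marked (sy 1) (lv MvPolynomial.X) I)) *
        ((unitSub (S MvPolynomial.X Iᶜ) ^ (-2 : ℤ)).val *
          PowerSeries.coeff p.2 (marked (sy (-1)) (lv MvPolynomial.X) Iᶜ)) := by
  rw [ML, map_sum, powerset_univ, sum_comm]
  refine sum_congr rfl fun I _ => ?_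
  have hS : S MvPolynomial.X univ - S MvPolynomial.X I =
      S (MvPolynomial.X : Fin n → MvPolynomial (Fin n) ℚ) Iᶜ := by
    rw [sub_eq_iff_eq_add, S, S, S, sum_compl_add_sum]
  rw [PowerSeries.coeff_C_mul, pairVal, PowerSeries.coeff_mul, mul_sum, weight, hS, mul_zpow,
    Units.val_mul, sy_one, sy_neg_one, ← compl_eq_univ_sdiff]
  refine sum_congr rfl fun p _ => ?_
  ring

theorem coeffAt_unstable {ε : ℚ} (hε : ε * ε = 1) (J : Finset (Fin n))
    {w : (LaurentSeries (MvPolynomial (Fin n) ℚ))ˣ}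
    (hw : w.val = sy ε + HahnSeries.C (S MvPolynomial.X J)) :
    coeffAt (2 * g) d (((if J = ∅ then (w ^ (-2 : ℤ)).val else 0) +
        (if J.card = 1 then (w⁻¹).val else 0)) * substOne (-ε) (Fp (insertNone Jᶜ) (g + 1))) =
      (if J = ∅ then bracket (g + 1) (Fin.cons (2 * g + 2) d : Fin (n + 1) → ℕ) else 0) -
      (if J.card = 1 then
        ∑ i ∈ J, bracket (g + 1) (Function.update d i (d i + 2 * g + 1)) else 0) := by
  have hN : Even (2 * g) := even_two_mul g
  rcases J.eq_empty_or_nonempty with rfl | hne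
  · rw [S_empty, map_zero, add_zero] at hw
    simp only [if_true, card_empty, zero_ne_one, if_false, add_zero, sub_zero, compl_empty]
    rw [zpow_neg_two_of_val hε hw, coeffAt_point _ _ _ (by rw [neg_mul_neg, hε]) hN]
  · rw [if_neg hne.ne_empty, if_neg hne.ne_empty]
    by_cases hc : J.card = 1
    · obtain ⟨i, rfl⟩ := card_eq_one.1 hc
      rw [S_singleton] at hw
      rw [if_pos hc, if_pos hc, zero_add, zero_sub, sum_singleton, compl_singleton,
        coeffAt_pair _ _ _ hε hN i hw]
    · rw [if_neg hc, if_neg hc, add_zero, zero_mul, coeffAt_zero, sub_zero]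

theorem coeffAt_term {a b : ℕ} (hab : a + b = g + 1) (I : Finset (Fin n)) :
    coeffAt (2 * g) d
      (((unitAdd (S MvPolynomial.X I) ^ (-2 : ℤ)).val *
          PowerSeries.coeff a (marked (sy 1) (lv MvPolynomial.X) I)) *
        ((unitSub (S MvPolynomial.X Iᶜ) ^ (-2 : ℤ)).val *
          PowerSeries.coeff b (marked (sy (-1)) (lv MvPolynomial.X) Iᶜ))) =
      ∑ j ∈ range (2 * g + 1), (-1 : ℚ) ^ j * bracketI a j I d * bracketI b (2 * g - j) Iᶜ d +
      (if a = 0 then (if I = ∅ then bracket (g + 1) (Fin.cons (2 * g + 2) d : Fin (n + 1) → ℕ) else 0) -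
        (if I.card = 1 then ∑ i ∈ I, bracket (g + 1) (Function.update d i (d i + 2 * g + 1)) else 0)
        else 0) +
      (if b = 0 then (if Iᶜ = ∅ then bracket (g + 1) (Fin.cons (2 * g + 2) d : Fin (n + 1) → ℕ) else 0) -
        (if Iᶜ.card = 1 then ∑ i ∈ Iᶜ, bracket (g + 1) (Function.update d i (d i + 2 * g + 1)) else 0)
        else 0) := by
  have hN : Even (2 * g) := even_two_mul g
  have hw1 : ∀ J : Finset (Fin n), (unitAdd (S MvPolynomial.X J)).val =
      sy 1 + HahnSeries.C (S (MvPolynomial.X : Fin n → MvPolynomial (Fin n) ℚ) J) := fun J => by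
    rw [val_unitAdd, sy_one]
  have hw2 : ∀ J : Finset (Fin n), (unitSub (S MvPolynomial.X J)).val =
      sy (-1) + HahnSeries.C (S (MvPolynomial.X : Fin n → MvPolynomial (Fin n) ℚ) J) := fun J => by
    rw [val_unitSub, sy_neg_one]
  rw [marked_div 1 I a _ (hw1 I), marked_div (-1) Iᶜ b _ (hw2 Iᶜ), ← coeffAt_stable d _ _ _ _ hN]
  by_cases ha : a = 0
  · have hb : b = g + 1 := by omega
    have hb0 : b ≠ 0 := by omega
    simp only [ha, hb0, true_and, false_and, if_true, if_false, add_zero]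
    rw [← coeffAt_unstable g d (one_mul 1) I (hw1 I), ← coeffAt_add, hb]
    congr 1
    ring
  · by_cases hb : b = 0
    · have ha' : a = g + 1 := by omega
      simp only [ha, hb, true_and, false_and, if_true, if_false, add_zero]
      have h := coeffAt_unstable g d (by norm_num : (-1 : ℚ) * -1 = 1) Iᶜ (hw2 Iᶜ)
      rw [neg_neg, compl_compl] at h
      rw [← h, ← coeffAt_add, ha']
      congr 1
      ring
    · simp only [ha, hb, false_and, if_false, add_zero]

theorem sum_card_eq_one (f : Fin n → ℚ) :
    ∑ I : Finset (Fin n), (if I.card = 1 then ∑ i ∈ I, f i else 0) = ∑ i, f i := by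
  rw [← sum_filter, ← powerset_univ, ← powersetCard_eq_filter, powersetCard_one, sum_map]
  simp

theorem sum_unstable (A : ℚ) (f : Fin n → ℚ) :
    ∑ I : Finset (Fin n), ((if I = ∅ then A else 0) -
      (if I.card = 1 then ∑ i ∈ I, f i else 0)) = A - ∑ i, f i := by
  rw [sum_sub_distrib, sum_card_eq_one]
  simp

theorem sum_unstable_compl (A : ℚ) (f : Fin n → ℚ) :
    ∑ I : Finset (Fin n), ((if Iᶜ = ∅ then A else 0) -
      (if Iᶜ.card = 1 then ∑ i ∈ Iᶜ, f i else 0)) = A - ∑ i, f i := by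
  rw [← sum_unstable A f]
  exact Equiv.sum_comp (compl_involutive.toPerm (compl : Finset (Fin n) → Finset (Fin n)))
    fun I => (if I = ∅ then A else 0) - (if I.card = 1 then ∑ i ∈ I, f i else 0)

theorem bracket_relation :
    ∑ a ∈ range (g + 2), ∑ I : Finset (Fin n), ∑ j ∈ range (2 * g + 1),
        (-1 : ℚ) ^ j * bracketI a j I d * bracketI (g + 1 - a) (2 * g - j) Iᶜ d +
      2 * (bracket (g + 1) (Fin.cons (2 * g + 2) d : Fin (n + 1) → ℕ) -
        ∑ i, bracket (g + 1) (Function.update d i (d i + 2 * g + 1))) = 0 := by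
  have h := coeffAt_ML g d
  rw [coeff_ML_neg_two, coeffAt_sum] at h
  rw [← h, ← Finset.Nat.sum_antidiagonal_eq_sum_range_succ fun a b => ∑ I : Finset (Fin n),
    ∑ j ∈ range (2 * g + 1), (-1 : ℚ) ^ j * bracketI a j I d * bracketI b (2 * g - j) Iᶜ d]
  set A := bracket (g + 1) (Fin.cons (2 * g + 2) d : Fin (n + 1) → ℕ) -
        ∑ i, bracket (g + 1) (Function.update d i (d i + 2 * g + 1)) with hA
  have h0 : ∑ p ∈ antidiagonal (g + 1), (if p.1 = 0 then A else 0) = A := by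
    rw [sum_eq_single_of_mem (0, g + 1) (by simp)]
    · simp
    · rintro ⟨a, b⟩ hab hne
      have := HasAntidiagonal.mem_antidiagonal.1 hab
      refine if_neg fun ha => hne ?_
      ext <;> simp at * <;> omega
  have h1 : ∑ p ∈ antidiagonal (g + 1), (if p.2 = 0 then A else 0) = A := by
    rw [← Finset.Nat.sum_antidiagonal_swap]
    exact h0
  have h2 : 2 * A = ∑ p ∈ antidiagonal (g + 1), (if p.1 = 0 then A else 0) +
      ∑ p ∈ antidiagonal (g + 1), (if p.2 = 0 then A else 0) := by rw [h0, h1, two_mul]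
  rw [h2, ← sum_add_distrib, ← sum_add_distrib]
  refine sum_congr rfl fun p hp => ?_
  rw [coeffAt_sum, sum_congr rfl fun I _ => coeffAt_term g d (HasAntidiagonal.mem_antidiagonal.1 hp) I,
    sum_add_distrib, sum_add_distrib, add_assoc]
  congr 2
  · split_ifs
    · rw [sum_unstable]
    · rw [sum_const_zero]
  · split_ifs
    · rw [sum_unstable_compl]
    · rw [sum_const_zero]

end

end Faber

/-- **The Faber intersection number conjecture** (equivalent form (3) of the paper):
for `g ≥ 1`, `n ≥ 1`, `d_j ≥ 1` with `Σ d_j = g + n − 2`,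
`(2g−3+n)!/(2^{2g−1}(2g−1)! Π (2d_j−1)!!) = ⟨τ_{2g}Πτ_{d_j}⟩_g − Σ_j ⟨τ_{d_j+2g−1}Π_{i≠j}τ_{d_i}⟩_g
 + ½ Σ_{j=0}^{2g−2} (−1)^j ⟨τ_{2g−2−j}τ_j Πτ_{d_i}⟩_{g−1}
 + ½ Σ_{g'} Σ_{I⊔J} Σ_{j=0}^{2g−2} (−1)^j ⟨τ_jΠ_{i∈I}τ_{d_i}⟩_{g'}⟨τ_{2g−2−j}Π_{i∈J}τ_{d_i}⟩_{g−g'}`. -/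
theorem faber_intersection_number_conjecture
    (g n : ℕ) (hg : 1 ≤ g) (hn : 1 ≤ n) (d : Fin n → ℕ) (hd : ∀ j, 1 ≤ d j)
    (hsum : ∑ j, d j = g + n - 2) :
    ((2*g+n-3).factorial : ℚ) /
        (2^(2*g-1) * ((2*g-1).factorial : ℚ) * ∏ j, (Nat.doubleFactorial (2*(d j)-1) : ℚ))
      = bracket g (Fin.cons (2*g) d)
        - ∑ j, bracket g (Function.update d j (d j + 2*g - 1))
        + (1/2) * ∑ j ∈ Finset.range (2*g-1),
            (-1 : ℚ)^j * bracket (g-1) (Fin.cons (2*g-2-j) (Fin.cons j d))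
        + (1/2) * ∑ gp ∈ Finset.range (g+1), ∑ I : Finset (Fin n),
            ∑ j ∈ Finset.range (2*g-1),
              (-1 : ℚ)^j * bracketI gp j I d * bracketI (g-gp) (2*g-2-j) Iᶜ d := by
  obtain ⟨g, rfl⟩ := Nat.exists_eq_add_of_le' hg
  have h1 := Faber.bracket_relation g d
  have h2 := Faber.sum_bracket_cons_cons g d
  have h3 := Faber.coeff_plead g (i₀ := (⟨0, hn⟩ : Fin n)) _ univ (Finsupp.equivFunOnFinite.symm d)
    (mem_univ _) rfl (fun i _ => hd i) (fun i hi => absurd (mem_univ i) hi) (by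
      rw [card_univ, Fintype.card_fin]
      have hle : ∑ j : Fin n, 1 ≤ ∑ j, d j := sum_le_sum fun j _ => hd j
      simp only [sum_const, card_univ, Fintype.card_fin, smul_eq_mul, mul_one] at hle
      simp only [Finsupp.equivFunOnFinite_symm_apply_apply]
      omega)
  rw [← h2, card_univ, Fintype.card_fin] at h3
  have h4 : Faber.dfp univ (Finsupp.equivFunOnFinite.symm d) =
      ∏ j, (Nat.doubleFactorial (2 * d j - 1) : ℚ) := rfl
  have hp : (∏ j, (Nat.doubleFactorial (2 * d j - 1) : ℚ)) ≠ 0 :=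
    prod_ne_zero_iff.2 fun j _ => by exact_mod_cast (Nat.doubleFactorial_pos _).ne'
  have hf : ((2 * g + 1).factorial : ℚ) ≠ 0 := by exact_mod_cast Nat.factorial_ne_zero _
  rw [h4] at h3
  rw [show 2 * (g + 1) + n - 3 = 2 * g + n - 1 by omega, ← h3]
  simp only [show 2 * (g + 1) = 2 * g + 2 by ring, show g + 1 + 1 = g + 2 by ring,
    show ∀ m, m + (2 * g + 2) - 1 = m + 2 * g + 1 by intro m; omega, Nat.add_sub_cancel,
    show 2 * g + 2 - 1 = 2 * g + 1 by omega]
  rw [pow_succ, pow_mul, show (2 : ℚ) ^ 2 = 4 by norm_num, div_eq_iff (mul_ne_zero (by positivity) hp)]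
  generalize (∏ j, (Nat.doubleFactorial (2 * d j - 1) : ℚ)) = P at *
  linear_combination (-(1 / 2 : ℚ)) * (4 ^ g * 2 * ((2 * g + 1).factorial : ℚ) * P) * h1

end
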